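/- Let B' ⋐ B'' be Stein open sets in a complex n-fold, Z ⊆ B'' an analytic subset, ω̃ a Kähler form on B''∖Z with a smooth bounded potential Φ on B''∖Z (ω̃ = i∂∂̄Φ, Φ bounded), and h_ε a metric on a line bundle F, smooth on B''∖Z, with √−1Θ_{h_ε}(F) ≥ −εω̃ for ε ≤ 1/2. Then for every ∂̄-closed F-valued (n,p)-form u on B'∖Z with ∫_{B'∖Z}|u|²_{h_ε,ω̃} ω̃ⁿ < ∞, there exists v with ∂̄v = u and ∫_{B'∖Z}|v|²_{h_ε,ω̃} ω̃ⁿ ≤ C ∫_{B'∖Z}|u|²_{h_ε,ω̃} ω̃ⁿ, where C is independent of ε and u. -/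

import Mathlib

open Filter Topology MeasureTheory
open scoped ComplexOrder

noncomputable section

/-- The Wirtinger derivative `∂f/∂z_j` (of a smooth, not necessarily
holomorphic, function). -/
def wDz {n : ℕ} (j : Fin n) (f : (Fin n → ℂ) → ℂ) (z : Fin n → ℂ) : ℂ :=
  (1 / 2) * (fderiv ℝ f z (Pi.single j 1)
    - Complex.I * fderiv ℝ f z (Pi.single j Complex.I))

/-- The Wirtinger derivative `∂f/∂z̄_j`. -/
def wDzbar {n : ℕ} (j : Fin n) (f : (Fin n → ℂ) → ℂ) (z : Fin n → ℂ) : ℂ :=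
  (1 / 2) * (fderiv ℝ f z (Pi.single j 1)
    + Complex.I * fderiv ℝ f z (Pi.single j Complex.I))

/-- The complex Hessian `(∂²Φ/∂z_j∂z̄_k)_{j,k}` of a real-valued function,
i.e. the coefficient matrix of the `(1,1)`-form `i∂∂̄Φ`. -/
def cHess {n : ℕ} (Φ : (Fin n → ℂ) → ℝ) (z : Fin n → ℂ) :
    Matrix (Fin n) (Fin n) ℂ :=
  Matrix.of fun j k => wDz j (wDzbar k fun w => (Φ w : ℂ)) z

/-- The `p × p` minor determinant of a matrix, with rows indexed by the
`p`-element set `K` and columns by the `p`-element set `L`. -/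
def minorDet {n : ℕ} (p : ℕ) (M : Matrix (Fin n) (Fin n) ℂ)
    (K L : Finset (Fin n)) : ℂ :=
  if h : K.card = p ∧ L.card = p then
    Matrix.det (Matrix.of fun a b : Fin p =>
      M (K.orderIsoOfFin h.1 a : Fin n) (L.orderIsoOfFin h.2 b : Fin n))
  else 0

/-- The pointwise squared norm density `|u|²_{ω̃} ω̃ⁿ` (relative to the
Lebesgue measure, up to a universal constant) of an `(n,p)`-form
`u = ∑_K u_K dz ∧ dz̄_K` with respect to the Kähler metric with coefficient
matrix `g`: `∑_{K,L} det((g⁻¹)_{K,L}) u_K ū_L`. -/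
def formDensity {n : ℕ} (p : ℕ) (g : (Fin n → ℂ) → Matrix (Fin n) (Fin n) ℂ)
    (u : Finset (Fin n) → (Fin n → ℂ) → ℂ) (z : Fin n → ℂ) : ℝ :=
  (∑ K ∈ Finset.powersetCard p (Finset.univ : Finset (Fin n)),
    ∑ L ∈ Finset.powersetCard p (Finset.univ : Finset (Fin n)),
      minorDet p (g z)⁻¹ K L * u K z * (starRingEnd ℂ) (u L z)).re

/-- Test functions on an open set `Ω`. -/
def IsTest {n : ℕ} (Ω : Set (Fin n → ℂ)) (ψ : (Fin n → ℂ) → ℂ) : Prop :=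
  ContDiff ℝ (⊤ : ℕ∞) ψ ∧ HasCompactSupport ψ ∧ tsupport ψ ⊆ Ω

/-- The sign `(-1)^{position of m in L}`. -/
def csign {n : ℕ} (L : Finset (Fin n)) (m : Fin n) : ℂ :=
  (-1) ^ (L.filter fun x => x < m).card

/-- `v = ∂̄u` in the sense of distributions on `Ω`, for an `(n,p)`-form `u`
(given by its coefficients `u_K`, `|K| = p`) and an `(n,p+1)`-form `v`:
for every `|L| = p+1` and test function `ψ`,
`∫ v_L ψ = ∑_{m∈L} ±(−∫ u_{L∖m} ∂̄_m ψ)`. -/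
def HasWeakDbar {n : ℕ} (Ω : Set (Fin n → ℂ)) (p : ℕ)
    (u v : Finset (Fin n) → (Fin n → ℂ) → ℂ) : Prop :=
  ∀ L : Finset (Fin n), L.card = p + 1 →
    ∀ ψ : (Fin n → ℂ) → ℂ, IsTest Ω ψ →
      (∫ z in Ω, v L z * ψ z) =
        ∑ m ∈ L, csign L m * -(∫ z in Ω, u (L.erase m) z * wDzbar m ψ z)

/-- A Stein open subset of `ℂⁿ`: open and holomorphically convex. -/
def IsSteinOpen {n : ℕ} (B : Set (Fin n → ℂ)) : Prop :=
  IsOpen B ∧ ∀ K : Set (Fin n → ℂ), K ⊆ B → IsCompact K →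
    IsCompact {z ∈ B | ∀ f : (Fin n → ℂ) → ℂ, DifferentiableOn ℂ f B →
      ‖f z‖ ≤ sSup ((fun w => ‖f w‖) '' K)}

/-- `Z` is an analytic subset of the open set `B`: locally the common zero
set of finitely many holomorphic functions. -/
def IsAnalyticIn {n : ℕ} (Z B : Set (Fin n → ℂ)) : Prop :=
  Z ⊆ B ∧ ∀ z ∈ B, ∃ U ∈ nhds z, ∃ (m : ℕ) (F : Fin m → (Fin n → ℂ) → ℂ),
    (∀ i, DifferentiableOn ℂ (F i) U) ∧
    Z ∩ U = {w ∈ U | ∀ i, F i w = 0}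

set_option hygiene false
notation "Qa" => (Fin n → ℂ)
notation "Qb" => (Matrix (Fin n) (Fin n) ℂ)
notation "Qc" => (Qa → ℂ)
notation "Qd" => (∀ z ∈ Ω, (cHess Φ z).PosDef)
notation "Qe" => ((⊤ : ℕ∞) : WithTop ℕ∞)
notation "Qf" => ((k:ℝ)+1)
notation "Qg" => (q.factorial : ℂ)
notation "Qh" => (χ j z : ℂ)
notation "Qi" => ((Real.exp (ψ z) : ℝ) : ℂ)
notation "Qj" => (Real.exp (-ψ z) : ℂ)
notation "Qk" => {K : Finset (Fin n) // K.card = q}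
notation "Ql" => (k:ℝ)
notation "Qm" => (r+1)
notation "Qn" => (cHess Φ z)
notation "Qo" => (Fin q → Fin n)
notation "Qp" => (Fin Qm → Fin n)
notation "Qq" => (fun I => y I z)
notation "Qr" => (volume.restrict Ω)
notation "Qs" => (Fin.tail M)
notation "Qt" => (by positivity)
notation "Qu" => (fun I => rX Φ ψ y I z)
notation "Qv" => (x - t)
notation "Qw" => (Fin.cons k J)
notation "Qx" => (fun J => dX X J z)
notation "Qy" => (by simp)
notation "Qz" => (fun x => (L x)⁻¹)
notation "Ta" => (Fin.cons (cHess ψ z) fun _ => cHess Φ z)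
notation "Tb" => (ψ z)
notation "Tc" => (q+1)
notation "Td" => (M 0)
notation "Te" => (fun x => ∑ i, ‖F i x‖^2)
notation "Tf" => (𝓝 0)
notation "Tg" => (r+2)
notation "Th" => (fun I => X I z)
notation "Ti" => (I 0)
notation "Tj" => (l i)
notation "Tk" => (cHess Φ)
notation "Tl" => (Fin q)
notation "Tm" => (fun i => y i z)
notation "Tn" => (k + 1)
notation "To" => (by norm_num)
notation "Tp" => (hg z hz)
notation "Tq" => (fun _ i j => gi_sm hΩ hΦ hg i j)
notation "Tr" => (fun z => A z i j)
notation "Ts" => (Fin.tail I)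
notation "Tt" => (fun x => f x * g x)
notation "Tu" => (tp Qm Qn⁻¹)
notation "Tv" => (fun K => u K z)
notation "Tw" => (fun x => a i x * Mo k (f i) x)
notation "Tx" => (norm_nonneg _)
notation "Ty" => (Equiv.Perm.decomposeFin.symm (p, e))
notation "Tz" => (fun x => (-1) * Real.log (-f x))
notation "Ya" => (hΩ.mem_nhds hz)
notation "Yb" => (fun I => v I z)
notation "Yc" => (fun z => Qh)
notation "Yd" => (mol k)
notation "Ye" => (tp Qm (g z))
notation "Yf" => (m z)
notation "Yg" => (mW Φ ψ r z)
notation "Yh" => ((r:ℂ)+1)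
notation "Yi" => (fun x => ∑ i ∈ s, f i x)
notation "Yj" => (mWi_cont hΩ hΦ hψ hg)
notation "Yk" => (Fin n)
notation "Yl" => (ENNReal.ofReal (C * (Ql + 1)⁻¹) ^ 2 * sqn f)
notation "Ym" => (fun M => b Td * w Qs)
notation "Yn" => (fun x => (∫ t, K k x t * f t) - c * f x)
notation "Yo" => (wDz (M 1) η z * if Fin.tail Qs = J then 1 else 0)
notation "Yp" => (srt L ∘ ⇑(t * s⁻¹))
notation "Yq" => (Equiv.Perm.decomposeFin.symm (0, s))
notation "Yr" => (by linarith)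
notation "Ys" => (2*M)
notation "Yt" => (X I)
notation "Yu" => (s.piecewise N M)
notation "Yv" => (Finset.univ.image I)
notation "Yw" => (fun i => F i z)
notation "Yx" => (test_wD hη)
notation "Yy" => ((r:ℝ)+1)
notation "Yz" => (mul_nonneg (hfd _ _ z hz) (Real.exp_pos _).le)
notation "Ha" => (fun z => (ψ z : ℂ))
notation "Hb" => (dY (low Φ ψ X) z)
notation "Hc" => (fun z => (f z : ℂ))
notation "Hd" => (fun z => m z i j)
notation "He" => (fun z => star (η z))
notation "Hf" => (fun M => wDz Td η z * y Qs z)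
notation "Hg" => (Fin.succ 0)
notation "Hh" => (tp r Qn)
notation "Hi" => (x + s)
notation "Hj" => (fun x => θ x * (θ x * (L x)⁻¹))
notation "Hk" => (Alt w)
notation "Hl" => (f i)
notation "Hm" => (fun I => rX Φ ψ y2 I z)
notation "Hn" => (9 * A + 16 * R^2 + 1)
notation "Ho" => (fun x => θ x * θ x)
notation "Hp" => (S + ‖f z‖)
notation "Hq" => (fun i => w i z)
notation "Hr" => (fun J => D J z)
notation "Hs" => (tp r Qn⁻¹)
notation "Ht" => (Ql + 1)
notation "Hu" => (J ∘ s)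
notation "Hv" => (mol_sm k)
notation "Hw" => (s 0)
notation "Hy" => (f x)
notation "Hz" => (mW_sm hΩ hΦ hψ)
notation "Ua" => (z + circleMap 0 r θ • v)
notation "Ub" => (fun z => (χ k z : ℂ))
notation "Uc" => (((-1) * Real.log (-f x)) / Tn - 1)
notation "Ud" => (fun x => a * f x)
notation "Ue" => (fun z => σ z i j)
notation "Uf" => (fun z => Yf⁻¹)
notation "Ug" => (fun I => y1 I z)
notation "Uh" => (tp q M)
notation "Ui" => (E z * wDzbar (L 0) (X L) z)
notation "Uj" => (fun z => Real.exp (-ψ z) * qf Tu Qq)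
notation "Uk" => (fun x => Real.log (L x))
notation "Ul" => (Fin.cons i J)
notation "Um" => (a x - a t)
notation "Un" => (Fin r → Fin n)
set_option hygiene true
theorem scg {ι α : Type*} [AddCommMonoid α] {s : Finset ι} {f g : ι → α} (h : ∀ x ∈ s, f x = g x) : s.sum f = s.sum g := Finset.sum_congr rfl h
section qf
open Matrix
variable {ι : Type*} [Fintype ι]
theorem psd_factor [DecidableEq ι] {M : Matrix ι ι ℂ} (h : M.PosSemidef) :
    ∃ B : Matrix ι ι ℂ, M = Bᴴ * B := by
  open scoped MatrixOrder in
  refine ⟨CFC.sqrt M, ?_⟩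
  rw [(CFC.sqrt_nonneg M).posSemidef.1.eq]
  exact (CFC.sqrt_mul_sqrt_self M h.nonneg).symm
def qf (M : Matrix ι ι ℂ) (x : ι → ℂ) : ℝ := (star x ⬝ᵥ M *ᵥ x).re
theorem qf_nonneg {M : Matrix ι ι ℂ} (h : M.PosSemidef) (x : ι → ℂ) : 0 ≤ qf M x :=
  (Complex.le_def.1 (h.dotProduct_mulVec_nonneg x)).1
theorem qf_eq {M : Matrix ι ι ℂ} (h : M.PosSemidef) (x : ι → ℂ) :
    star x ⬝ᵥ M *ᵥ x = (qf M x : ℂ) := by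
  have := (Complex.le_def.1 (h.dotProduct_mulVec_nonneg x)).2
  apply Complex.ext <;> simp [qf] ; simpa using this.symm
theorem qf_mono {M N : Matrix ι ι ℂ} (h : (N - M).PosSemidef) (x : ι → ℂ) : qf M x ≤ qf N x := by
  have := qf_nonneg h x
  simp only [qf, Matrix.sub_mulVec, dotProduct_sub, Complex.sub_re] at *
  linarith
theorem qf_smul (M : Matrix ι ι ℂ) (c : ℝ) (x : ι → ℂ) : qf ((c : ℂ) • M) x = c * qf M x := by
  simp [qf, Matrix.smul_mulVec]
theorem qf_smul_vec (M : Matrix ι ι ℂ) (c : ℂ) (x : ι → ℂ) : qf M (c • x) = ‖c‖^2 * qf M x := by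
  simp only [qf, Matrix.mulVec_smul, dotProduct_smul, star_smul, smul_dotProduct, smul_eq_mul,
    ← mul_assoc]
  have : c * star c = ((‖c‖^2 : ℝ) : ℂ) := by
    rw [Complex.star_def, Complex.mul_conj, Complex.normSq_eq_norm_sq]
  rw [this, Complex.re_ofReal_mul]
theorem dot_cs (x y : ι → ℂ) :
    ‖star x ⬝ᵥ y‖^2 ≤ (star x ⬝ᵥ x).re * (star y ⬝ᵥ y).re := by
  have h := norm_inner_le_norm (𝕜 := ℂ) (WithLp.toLp 2 x : EuclideanSpace ℂ ι) (WithLp.toLp 2 y)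
  have e : ∀ x y : ι → ℂ, inner ℂ (WithLp.toLp 2 x : EuclideanSpace ℂ ι) (WithLp.toLp 2 y)
    = star x ⬝ᵥ y := fun x y => by
      rw [EuclideanSpace.inner_toLp_toLp, dotProduct_comm]
  have n : ∀ x : ι → ℂ, (star x ⬝ᵥ x).re = ‖(WithLp.toLp 2 x : EuclideanSpace ℂ ι)‖^2 := fun x => by
    rw [← e, inner_self_eq_norm_sq_to_K]; norm_cast
  rw [e] at h
  rw [n, n, ← mul_pow]
  exact pow_le_pow_left₀ Tx h 2
theorem qf_cs [DecidableEq ι] {M : Matrix ι ι ℂ} (h : M.PosSemidef) (x y : ι → ℂ) :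
    ‖star x ⬝ᵥ M *ᵥ y‖^2 ≤ qf M x * qf M y := by
  obtain ⟨B, rfl⟩ := psd_factor h
  have e : ∀ x y : ι → ℂ, star x ⬝ᵥ (Bᴴ * B) *ᵥ y = star (B *ᵥ x) ⬝ᵥ (B *ᵥ y) := fun x y => by
    rw [← Matrix.mulVec_mulVec, Matrix.star_mulVec, Matrix.dotProduct_mulVec]
  simp only [qf, e]
  exact dot_cs _ _
theorem qf_cs_inv [DecidableEq ι] {M : Matrix ι ι ℂ} (h : M.PosDef) (x y : ι → ℂ) :
    ‖star x ⬝ᵥ y‖^2 ≤ qf M⁻¹ x * qf M y := by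
  have hu := (Matrix.isUnit_iff_isUnit_det _).1 h.isUnit
  have := qf_cs h.posSemidef.inv x (M *ᵥ y)
  simp only [qf, Matrix.mulVec_mulVec, Matrix.nonsing_inv_mul _ hu, Matrix.one_mulVec] at *
  convert this using 3
  rw [Matrix.star_mulVec, h.isHermitian.eq, ← Matrix.dotProduct_mulVec]
theorem qf_add_le {M : Matrix ι ι ℂ} (h : M.PosSemidef) (x y : ι → ℂ) :
    qf M (x + y) ≤ 2 * qf M x + 2 * qf M y := by
  have := qf_nonneg h (x - y)
  simp only [qf, sub_eq_add_neg, Matrix.mulVec_add, Matrix.mulVec_neg, dotProduct_add, star_add, star_neg,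
    add_dotProduct, neg_dotProduct, dotProduct_neg, Complex.add_re, Complex.neg_re] at *
  linarith
theorem inv_anti [DecidableEq ι] {M N : Matrix ι ι ℂ} (hM : M.PosDef) (h : (N - M).PosSemidef) :
    (M⁻¹ - N⁻¹).PosSemidef := by
  have hN : N.PosDef := by simpa using hM.add_posSemidef h
  refine Matrix.PosSemidef.of_dotProduct_mulVec_nonneg
    (hM.posSemidef.inv.1.sub hN.posSemidef.inv.1) fun x => ?_
  rw [Matrix.sub_mulVec, dotProduct_sub, qf_eq hM.posSemidef.inv, qf_eq hN.posSemidef.inv,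
    ← Complex.ofReal_sub, Complex.zero_le_real, sub_nonneg]
  have hu := (Matrix.isUnit_iff_isUnit_det _).1 hN.isUnit
  have h1 := qf_cs_inv hM x (N⁻¹ *ᵥ x)
  have h2 := qf_mono h (N⁻¹ *ᵥ x)
  have h3 : qf N (N⁻¹ *ᵥ x) = qf N⁻¹ x := by
    simp only [qf]
    rw [Matrix.mulVec_mulVec, Matrix.mul_nonsing_inv _ hu, Matrix.one_mulVec, Matrix.star_mulVec,
      hN.posSemidef.inv.1.eq, ← Matrix.dotProduct_mulVec]
  rw [qf_eq hN.posSemidef.inv, Complex.norm_real, Real.norm_of_nonneg (qf_nonneg hN.posSemidef.inv x)] at h1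
  have h4 := qf_nonneg hN.posSemidef.inv x
  have h5 := qf_nonneg hM.posSemidef.inv x
  rw [h3] at h2
  have h6 := mul_le_mul_of_nonneg_left h2 h5
  rcases h4.eq_or_lt with h0 | h0
  · rw [← h0]; exact h5
  · nlinarith
end qf
def tpm {n q : ℕ} (M : Fin q → Qb) :
    Matrix Qo Qo ℂ :=
  Matrix.of fun J K => ∏ a, M a (J a) (K a)
abbrev tp {n : ℕ} (q : ℕ) (M : Qb) :
    Matrix Qo Qo ℂ := tpm (q := q) fun _ => M
section tpm
open Matrix
variable {n q : ℕ}
theorem tpm_mul (M N : Fin q → Qb) :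
    tpm (fun a => M a * N a) = tpm M * tpm N := by
  ext J K
  simp only [tpm, Matrix.mul_apply, Matrix.of_apply]
  rw [Finset.prod_univ_sum]
  simp [Finset.prod_mul_distrib]
theorem tpm_one : tpm (fun _ : Fin q => (1 : Qb)) = 1 := by
  ext J K
  simp only [tpm, Matrix.of_apply, Matrix.one_apply]
  by_cases h : J = K
  · subst h; simp
  · obtain ⟨a, ha⟩ := Function.ne_iff.1 h
    rw [if_neg h]
    exact Finset.prod_eq_zero (Finset.mem_univ a) (by simp [ha])
theorem tpm_conjTranspose (M : Fin q → Qb) :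
    (tpm M)ᴴ = tpm fun a => (M a)ᴴ := by
  ext J K
  simp [tpm, Matrix.conjTranspose_apply]
theorem tpm_psd {M : Fin q → Qb} (h : ∀ a, (M a).PosSemidef) :
    (tpm M).PosSemidef := by
  have : ∀ a, ∃ B : Qb, M a = Bᴴ * B := fun a =>
    psd_factor (h a)
  choose B hB using this
  have e : tpm M = (tpm B)ᴴ * tpm B := by
    rw [tpm_conjTranspose, ← tpm_mul]; congr 1; funext a; exact hB a
  rw [e]; exact Matrix.posSemidef_conjTranspose_mul_self _
theorem tp_inv {M : Qb} (h : M.PosDef) :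
    tp q M⁻¹ * tp q M = 1 := by
  have : M⁻¹ * M = 1 := Matrix.nonsing_inv_mul _ ((Matrix.isUnit_iff_isUnit_det _).1 h.isUnit)
  rw [tp, tp, ← tpm_mul, this, tpm_one]
theorem tp_inv' {M : Qb} (h : M.PosDef) :
    tp q M * tp q M⁻¹ = 1 := by
  have : M * M⁻¹ = 1 := Matrix.mul_nonsing_inv _ ((Matrix.isUnit_iff_isUnit_det _).1 h.isUnit)
  rw [tp, tp, ← tpm_mul, this, tpm_one]
theorem tp_posDef {M : Qb} (h : M.PosDef) : (tp q M).PosDef := by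
  refine ((tpm_psd fun _ => h.posSemidef).posDef_iff_isUnit).2 ?_
  exact IsUnit.of_mul_eq_one _ (tp_inv' h)
theorem tp_nonsing_inv {M : Qb} (h : M.PosDef) :
    Uh⁻¹ = tp q M⁻¹ := Matrix.inv_eq_left_inv (tp_inv h)
theorem tpm_update_sub (M : Fin q → Qb) (a : Fin q)
    (N : Qb) :
    tpm (Function.update M a N) - tpm M = tpm (Function.update M a (N - M a)) := by
  ext J K
  simp only [tpm, Matrix.sub_apply, Matrix.of_apply]
  rw [← Finset.mul_prod_erase _ _ (Finset.mem_univ a),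
    ← Finset.mul_prod_erase _ _ (Finset.mem_univ a),
    ← Finset.mul_prod_erase (Finset.univ) (fun x => (Function.update M a (N - M a)) x (J x) (K x))
      (Finset.mem_univ a)]
  have h : ∀ P : Qb,
      ∏ x ∈ Finset.univ.erase a, (Function.update M a P) x (J x) (K x)
       = ∏ x ∈ Finset.univ.erase a, M x (J x) (K x) := fun P =>
    Finset.prod_congr rfl fun x hx => by
      rw [Function.update_of_ne (Finset.ne_of_mem_erase hx)]
  rw [h, h]
  simp; ring
theorem tpm_mono {M N : Fin q → Qb} (hM : ∀ a, (M a).PosSemidef)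
    (h : ∀ a, (N a - M a).PosSemidef) : (tpm N - tpm M).PosSemidef := by
  have hN : ∀ a, (N a).PosSemidef := fun a => by simpa using (h a).add (hM a)
  have key : ∀ s : Finset Tl, (tpm Yu - tpm M).PosSemidef := by
    intro s
    induction s using Finset.induction_on with
    | empty => simpa using Matrix.PosSemidef.zero
    | insert a s ha ih =>
      have e : (insert a s).piecewise N M = Function.update Yu a (N a) := by
        rw [Finset.piecewise_insert]
      have h2 := tpm_update_sub Yu a (N a)
      rw [e]
      have : tpm (Function.update Yu a (N a)) - tpm M
        = tpm (Function.update Yu a (N a - Yu a))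
          + (tpm Yu - tpm M) := by rw [← h2]; abel
      rw [this]
      refine Matrix.PosSemidef.add (tpm_psd fun b => ?_) ih
      by_cases hb : b = a
      · subst hb; simpa [ha] using h b
      · rw [Function.update_of_ne hb]
        by_cases hs : b ∈ s
        · simpa [hs] using hN b
        · simpa [hs] using hM b
  simpa using key Finset.univ
theorem sum_cons {α : Type*} [AddCommMonoid α] (f : (Fin Tc → Fin n) → α) :
    ∑ I, f I = ∑ k, ∑ J : Fin q → Fin n, f Qw := by
  rw [← (Fin.consEquiv (fun _ => Fin n)).sum_comp, Fintype.sum_prod_type]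
  rfl
theorem tpm_cons (A : Qb) (M : Fin q → Qb)
    (k l : Fin n) (J K : Fin q → Fin n) :
    tpm (Fin.cons A M : Fin Tc → Qb) Qw (Fin.cons l K)
      = A k l * tpm M J K := by
  simp [tpm, Fin.prod_univ_succ]
theorem tp_cons (A : Qb)
    (k l : Fin n) (J K : Fin q → Fin n) :
    tp Tc A Qw (Fin.cons l K)
      = A k l * tp q A J K := by
  simp [tpm, Fin.prod_univ_succ]
theorem tp_perm (A : Qb) (s : Equiv.Perm Tl)
    (J K : Fin q → Fin n) : tp q A Hu (K ∘ s) = tp q A J K := by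
  simp only [tpm, Matrix.of_apply, Function.comp]
  exact Equiv.prod_comp s (fun a => A (J a) (K a))
end tpm
section alt
open Matrix
variable {n q : ℕ}
def sg (s : Equiv.Perm Tl) : ℂ := ((Equiv.Perm.sign s : ℤ) : ℂ)
theorem sg_mul (s t : Equiv.Perm Tl) : sg (s * t) = sg s * sg t := by simp [sg]
theorem sg_sq (s : Equiv.Perm Tl) : sg s * sg s = 1 := by
  have : (Equiv.Perm.sign s : ℤ) * (Equiv.Perm.sign s : ℤ) = 1 := by
    rw [← Units.val_mul]; simp
  unfold sg; exact_mod_cast this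
theorem sg_inv (s : Equiv.Perm Tl) : sg s⁻¹ = sg s := by simp [sg]
theorem star_sg (s : Equiv.Perm Tl) : star (sg s) = sg s := by simp [sg]
def Alt (w : Qo → ℂ) (J : Fin q → Fin n) : ℂ := ∑ s : Equiv.Perm Tl, sg s * w Hu
def Asym (w : Qo → ℂ) : Prop := ∀ (s : Equiv.Perm Tl) (J), w Hu = sg s * w J
theorem alt_asym (w : Qo → ℂ) : Asym Hk := by
  intro t J
  unfold Alt
  rw [Finset.mul_sum, ← Equiv.sum_comp (Equiv.mulLeft t⁻¹)]
  refine scg fun s _ => ?_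
  simp only [Equiv.coe_mulLeft, sg_mul, sg_inv]
  rw [show (J ∘ ⇑t) ∘ ⇑(t⁻¹ * s) = J ∘ s by funext x; simp]
  ring
theorem Asym.alt {w : Qo → ℂ} (h : Asym w) (J) : Alt w J = Qg * w J := by
  unfold Alt
  simp [h _ J, ← mul_assoc, sg_sq, Finset.card_univ, Fintype.card_perm]
theorem alt_zero_of_swap {w : Qo → ℂ} (a b : Fin q) (hab : a ≠ b)
    (h : ∀ J, w (J ∘ Equiv.swap a b) = w J) (J) : Alt w J = 0 := by
  have h1 : Alt w J = - Alt w J := by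
    conv_lhs => unfold Alt
    rw [← Equiv.sum_comp (Equiv.mulRight (Equiv.swap a b))]
    unfold Alt
    rw [← Finset.sum_neg_distrib]
    refine scg fun s _ => ?_
    simp only [Equiv.coe_mulRight, sg_mul, Equiv.Perm.coe_mul]
    rw [← Function.comp_assoc, h]
    simp [sg, Equiv.Perm.sign_swap hab]
  have : (2:ℂ) * Alt w J = 0 := by linear_combination h1
  simpa using this
theorem asym_zero {w : Qo → ℂ} (h : Asym w) (J) (hJ : ¬ Function.Injective J) : w J = 0 := by
  simp only [Function.Injective, not_forall] at hJ
  obtain ⟨a, b, e, hab⟩ := hJ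
  have h1 := h (Equiv.swap a b) J
  have : J ∘ Equiv.swap a b = J := by
    funext x
    simp only [Function.comp, Equiv.swap_apply_def]
    split_ifs with h1 h2
    · rw [h1, e]
    · rw [h2, e]
    · rfl
  rw [this] at h1
  have h2 : sg (Equiv.swap a b) = -1 := by simp [sg, Equiv.Perm.sign_swap hab]
  rw [h2] at h1
  have : (2:ℂ) * w J = 0 := by linear_combination h1
  simpa using this
theorem sum_perm (s : Equiv.Perm Tl) {α : Type*} [AddCommMonoid α] (f : Qo → α) :
    ∑ J, f Hu = ∑ J, f J :=
  (Equiv.arrowCongr s.symm (Equiv.refl Yk)).sum_comp f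
theorem sum_alt_mul (w x : Qo → ℂ) :
    ∑ J, Alt w J * x J = ∑ J, w J * Alt x J := by
  unfold Alt
  simp only [Finset.sum_mul, Finset.mul_sum]
  rw [Finset.sum_comm, Finset.sum_comm (s := Finset.univ (α := Fin q → Fin n))]
  rw [← Equiv.sum_comp (Equiv.inv (Equiv.Perm Tl))]
  refine scg fun s _ => ?_
  rw [← sum_perm s]
  refine scg fun J _ => ?_
  simp only [Equiv.inv_apply, sg_inv]
  rw [show (J ∘ ⇑s) ∘ ⇑(s⁻¹) = J by funext x; simp]
  ring
theorem alt_star (w : Qo → ℂ) : Alt (star w) = star Hk := by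
  funext J
  simp only [Alt, Pi.star_apply, star_sum, star_mul', star_sg]
theorem tp_mulVec_alt (A : Qb) (w : Qo → ℂ) :
    tp q A *ᵥ Alt w = Alt (tp q A *ᵥ w) := by
  funext J
  simp only [Matrix.mulVec, dotProduct, Alt, Finset.mul_sum]
  rw [Finset.sum_comm]
  refine scg fun s _ => ?_
  rw [← sum_perm s (fun K => sg s * (tp q A Hu K * w K))]
  refine scg fun K _ => ?_
  rw [tp_perm]; ring
theorem tp_mulVec_asym (A : Qb) {w : Qo → ℂ} (h : Asym w) :
    Asym (tp q A *ᵥ w) := by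
  intro s J
  simp only [Matrix.mulVec, dotProduct]
  rw [← sum_perm s, Finset.mul_sum]
  refine scg fun K _ => ?_
  rw [tp_perm, h]; ring
theorem sum_fac_zero {f : Fin Tc → ℂ} :
    ∑ s : Equiv.Perm (Fin Tc), f Hw = Qg * ∑ a, f a := by
  rw [← (Equiv.Perm.decomposeFin (n := q)).symm.sum_comp, Fintype.sum_prod_type, Finset.mul_sum]
  refine scg fun a _ => ?_
  simp [Finset.card_univ, Fintype.card_perm]
def Asym1 (w : (Fin Tc → Fin n) → ℂ) : Prop := ∀ k, Asym fun J : Fin q → Fin n => w Qw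
theorem alt_asym1 {w : (Fin Tc → Fin n) → ℂ} (h : Asym1 w) (J) :
    Alt w J = Qg * (w J - ∑ a : Fin q, w (J ∘ Equiv.swap 0 a.succ)) := by
  have key : ∀ (p : Fin Tc) (e : Equiv.Perm Tl),
      w (J ∘ Ty) = sg e * w (J ∘ Equiv.swap 0 p) := by
    intro p e
    have e1 : J ∘ Ty =
      Fin.cons (J p) ((fun x : Fin q => J (Equiv.swap 0 p x.succ)) ∘ e) := by
      funext x
      refine Fin.cases ?_ (fun x => ?_) x
      · simp
      · simp
    have e2 : J ∘ Equiv.swap 0 p = Fin.cons (J p) (fun x : Fin q => J (Equiv.swap 0 p x.succ)) := by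
      funext x
      refine Fin.cases ?_ (fun x => ?_) x
      · simp
      · simp
    rw [e1, e2]
    exact h _ e _
  unfold Alt
  rw [← (Equiv.Perm.decomposeFin (n := q)).symm.sum_comp, Fintype.sum_prod_type, Fin.sum_univ_succ]
  have k2 : ∀ (p : Fin Tc), ∑ e : Equiv.Perm Tl, sg Ty *
      w (J ∘ Ty) =
       (if p = 0 then 1 else -1) * (q.factorial * w (J ∘ Equiv.swap 0 p)) := by
    intro p
    rw [Finset.sum_congr rfl (g := fun e => (if p = 0 then (1:ℂ) else -1) * w (J ∘ Equiv.swap 0 p))]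
    · simp [Finset.card_univ, Fintype.card_perm]
    · intro e _
      rw [key, ← mul_assoc]
      congr 1
      have : sg Ty = (if p = 0 then 1 else -1) * sg e := by
        simp only [sg, Equiv.Perm.decomposeFin.symm_sign]; split_ifs <;> simp
      rw [this, mul_assoc, sg_sq, mul_one]
  simp only [k2]
  simp [sub_eq_add_neg]
  rw [← Finset.mul_sum]; ring
end alt
section eps
open Matrix
variable {n q : ℕ}
def epsZ (J : Fin q → Fin n) : ℤ := (SignType.sign (det (vandermonde fun a => ((J a : ℕ) : ℤ))) : ℤ)
def eps (J : Fin q → Fin n) : ℂ := (epsZ J : ℂ)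
theorem eps_asym : Asym (eps (n := n) (q := q)) := by
  intro s J
  unfold eps sg
  norm_cast
  unfold epsZ
  have : (vandermonde fun a => ((Hu a : ℕ) : ℤ)) =
    (vandermonde fun a => ((J a : ℕ) : ℤ)).submatrix s id := by ext a b; simp [vandermonde]
  rw [this, det_permute]
  rcases Int.units_eq_one_or (Equiv.Perm.sign s) with h | h <;> simp [h, Left.sign_neg]
theorem csign_ne {L : Finset Yk} {m} : csign L m * csign L m = 1 := by
  unfold csign; rw [← mul_pow]; simp
theorem eps_cons (I : Fin Tc → Fin n) (hI : Function.Injective I) :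
    eps I = csign Yv Ti * eps Ts := by
  unfold eps epsZ csign
  rw [det_vandermonde, Fin.prod_univ_succ, Fin.prod_Ioi_zero, det_vandermonde]
  have e2 : ∏ i : Fin q, ∏ j ∈ Finset.Ioi i.succ, (((I j : ℕ) : ℤ) - ((I i.succ : ℕ) : ℤ)) =
    ∏ i : Fin q, ∏ j ∈ Finset.Ioi i, (((Fin.tail I j : ℕ) : ℤ) - ((Fin.tail I i : ℕ) : ℤ)) := by
    refine Finset.prod_congr rfl fun i _ => ?_
    rw [Fin.prod_Ioi_succ]; rfl
  rw [e2, sign_mul, SignType.coe_mul, Int.cast_mul]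
  congr 1
  have e3 : (Finset.univ.image I).filter (fun x => x < I 0) =
    ((Finset.univ : Finset Tl).filter (fun j => I j.succ < I 0)).image (fun j => I j.succ) := by
    ext x
    simp only [Finset.mem_filter, Finset.mem_image, Finset.mem_univ, true_and]
    constructor
    · rintro ⟨⟨a, rfl⟩, h⟩
      refine Fin.cases (fun h => absurd h (lt_irrefl _)) (fun a h => ⟨a, h, rfl⟩) a h
    · rintro ⟨a, h, rfl⟩; exact ⟨⟨_, rfl⟩, h⟩
  rw [e3, Finset.card_image_of_injective _ (show Function.Injective (fun j : Fin q => I j.succ) from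
    hI.comp (Fin.succ_injective q))]
  rw [← Finset.prod_const, Finset.prod_filter]
  have : ∀ s : Finset Tl, ((SignType.sign (∏ j ∈ s, (((I j.succ : ℕ) : ℤ) - ((I 0 : ℕ) : ℤ))) : ℤ) : ℂ)
      = ∏ j ∈ s, (if I j.succ < I 0 then (-1 : ℂ) else 1) := by
    intro s
    induction s using Finset.induction_on with
    | empty => simp
    | insert a s ha ih =>
      rw [Finset.prod_insert ha, Finset.prod_insert ha, sign_mul, SignType.coe_mul, Int.cast_mul, ih]
      congr 1
      have hne : I a.succ ≠ I 0 := fun h => absurd (hI h) (Fin.succ_ne_zero a)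
      split_ifs with h
      · rw [sign_neg (by have : ((I a.succ : ℕ) : ℤ) < (I 0 : ℕ) := by exact_mod_cast h
                         linarith)]; simp
      · have h' : I 0 < I a.succ := lt_of_le_of_ne (not_lt.1 h) (Ne.symm hne)
        rw [sign_pos (by have : ((I 0 : ℕ) : ℤ) < (I a.succ : ℕ) := by exact_mod_cast h'
                         linarith)]; simp
  exact this _
def srt (K : Qk) : Fin q → Fin n := K.1.orderEmbOfFin K.2
theorem srt_inj (K : Qk) : Function.Injective (srt K) :=
  (K.1.orderEmbOfFin K.2).injective
theorem srt_image (K : Qk) : Finset.univ.image (srt K) = K.1 := by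
  unfold srt
  rw [← Finset.coe_inj]; simp
theorem eps_srt (K : Qk) : eps (srt K) = 1 := by
  unfold eps epsZ
  rw [det_vandermonde, sign_pos]
  · simp
  · refine Finset.prod_pos fun i _ => Finset.prod_pos fun j hj => ?_
    have : srt K i < srt K j := (K.1.orderEmbOfFin K.2).strictMono (Finset.mem_Ioi.1 hj)
    have : ((srt K i : ℕ) : ℤ) < (srt K j : ℕ) := by exact_mod_cast this
    linarith
theorem exists_srt (J : Fin q → Fin n) (hJ : Function.Injective J) :
    ∃ (K : Qk) (s : Equiv.Perm Tl),
      K.1 = Finset.univ.image J ∧ srt K ∘ s = J := by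
  have hc : (Finset.univ.image J).card = q := by
    rw [Finset.card_image_of_injective _ hJ]; simp
  refine ⟨⟨_, hc⟩, ?_⟩
  have hm : ∀ a, ∃ b, srt ⟨_, hc⟩ b = J a := by
    intro a
    have : J a ∈ Finset.univ.image (srt ⟨_, hc⟩) := by rw [srt_image]; simp
    simpa using this
  choose s hs using hm
  have hsi : Function.Injective s := fun a b h => hJ (by rw [← hs, ← hs, h])
  refine ⟨Equiv.ofBijective s (Finite.injective_iff_bijective.1 hsi), rfl, ?_⟩
  funext a; exact hs a
theorem image_perm (J : Fin q → Fin n) (s : Equiv.Perm Tl) :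
    Finset.univ.image Hu = Finset.univ.image J := by
  rw [← Finset.coe_inj]; simp only [Finset.coe_image, Finset.coe_univ, Set.image_univ]
  exact s.surjective.range_comp J
def tform (q : ℕ) (u : Finset Yk → ℂ) (J : Fin q → Fin n) : ℂ := eps J * u (Finset.univ.image J)
theorem tform_asym (u : Finset Yk → ℂ) : Asym (tform q u) := by
  intro s J
  simp only [tform, image_perm, eps_asym s J, mul_assoc]
theorem tform_srt (u : Finset Yk → ℂ) (K : Qk) :
    tform q u (srt K) = u K.1 := by
  simp [tform, eps_srt, srt_image]
theorem asym_eq_tform {w : Qo → ℂ} (h : Asym w) {u : Finset Yk → ℂ}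
    (hu : ∀ K : Qk, u K.1 = w (srt K)) : w = tform q u := by
  funext J
  by_cases hJ : Function.Injective J
  · obtain ⟨K, s, hK, rfl⟩ := exists_srt J hJ
    rw [h, tform_asym, tform_srt, hu]
  · rw [asym_zero h _ hJ, asym_zero (tform_asym u) _ hJ]
theorem alt_form (b : Qa) (u : Finset Yk → ℂ) (I : Fin Tc → Fin n)
    (hI : Function.Injective I) :
    Alt (fun I : Fin Tc → Fin n => b Ti * tform q u Ts) I =
     eps I * q.factorial * ∑ m ∈ Finset.univ.image I,
       csign Yv m * (b m * u ((Finset.univ.image I).erase m)) := by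
  unfold Alt
  have key : ∀ s : Equiv.Perm (Fin Tc), sg s * (b ((I ∘ s) 0) * tform q u (Fin.tail (I ∘ s))) =
      (fun a => eps I * (csign Yv (I a) * (b (I a) *
         u ((Finset.univ.image I).erase (I a))))) Hw := by
    intro s
    have h1 := eps_cons (I ∘ s) (hI.comp s.injective)
    rw [eps_asym, image_perm] at h1
    have h2 : Finset.univ.image (Fin.tail (I ∘ s)) = (Finset.univ.image I).erase (I Hw) := by
      rw [← image_perm I s]
      ext x
      simp only [Finset.mem_image, Finset.mem_univ, true_and, Finset.mem_erase, Fin.tail]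
      constructor
      · rintro ⟨a, rfl⟩
        exact ⟨fun h => absurd (s.injective (hI h)) (Fin.succ_ne_zero a), ⟨_, rfl⟩⟩
      · rintro ⟨hx, a, rfl⟩
        refine Fin.cases (fun h => absurd rfl h) (fun a _ => ⟨a, rfl⟩) a hx
    have h3 : eps (Fin.tail (I ∘ s)) = sg s * (csign Yv (I Hw) * eps I) := by
      have := congrArg (fun t => csign Yv (I Hw) * t) h1
      simp only [Function.comp_apply, ← mul_assoc, csign_ne, one_mul] at this
      rw [← this]; ring
    simp only [tform, h2, h3, Function.comp]
    linear_combination (b (I Hw) * (csign Yv (I Hw) * eps I) *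
      u ((Finset.univ.image I).erase (I Hw))) * sg_sq s
  rw [scg fun s _ => key s, sum_fac_zero (f := fun a => eps I * (csign Yv (I a) *
    (b (I a) * u ((Finset.univ.image I).erase (I a))))), Finset.sum_image (fun a _ b _ h => hI h),
    ← Finset.mul_sum]
  ring
theorem sum_inj {F : Qo → ℂ} (hF : ∀ J, ¬ Function.Injective J → F J = 0) :
    ∑ J, F J = ∑ K : Qk, ∑ s : Equiv.Perm Tl, F (srt K ∘ s) := by
  symm
  trans ∑ x : Qk × Equiv.Perm Tl, F (srt x.1 ∘ x.2)
  · exact (Fintype.sum_prod_type (fun x : Qk × Equiv.Perm Tl =>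
      F (srt x.1 ∘ x.2))).symm
  refine Finset.sum_of_injOn (fun x => srt x.1 ∘ x.2) ?_ Qy ?_ (fun _ _ => rfl)
  · rintro ⟨K, s⟩ _ ⟨L, t⟩ _ h
    simp only at h
    have h1 := congrArg (fun J => Finset.univ.image J) h
    simp only [image_perm, srt_image] at h1
    have h2 : K = L := Subtype.ext h1
    subst h2
    congr 1
    ext a
    have := srt_inj K (congrFun h a)
    rw [this]
  · intro J _ hJ
    refine hF J fun hi => hJ ?_
    obtain ⟨K, s, -, h⟩ := exists_srt J hi
    exact ⟨(K, s), by simp, h⟩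
theorem form_norm (M : Qb) (u : Finset Yk → ℂ) :
    star (star (tform q u)) ⬝ᵥ (tp q M *ᵥ star (tform q u)) = q.factorial *
      ∑ K ∈ Finset.powersetCard q (Finset.univ : Finset Yk),
    ∑ L ∈ Finset.powersetCard q (Finset.univ : Finset Yk),
      minorDet q M K L * u K * (starRingEnd ℂ) (u L) := by
  rw [Finset.sum_subtype (p := fun K => K.card = q) _ Qy]
  rw [scg fun K _ => Finset.sum_subtype
    (p := fun K : Finset Yk => K.card = q) (Finset.powersetCard q Finset.univ) Qy _]
  simp only [star_star, dotProduct, mulVec, Finset.mul_sum]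
  rw [sum_inj]
  swap
  · intro J hJ; rw [asym_zero (tform_asym u) _ hJ]; simp
  rw [scg fun K _ => scg fun s _ => sum_inj ?_]
  swap
  · intro J hJ; rw [Pi.star_apply, asym_zero (tform_asym u) _ hJ]; simp
  refine scg fun K _ => ?_
  rw [Finset.sum_comm]
  refine scg fun L _ => ?_
  have e1 : ∀ s t : Equiv.Perm Tl, tform q u (srt K ∘ s) * (tp q M (srt K ∘ s) (srt L ∘ t) *
      star (tform q u) (srt L ∘ t)) = (sg (t * s⁻¹) * tp q M (srt K) Yp) *
        (u K.1 * star (u L.1)) := by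
    intro s t
    rw [Pi.star_apply, tform_asym, tform_asym, tform_srt, tform_srt, star_mul', star_sg, sg_mul, sg_inv]
    rw [← tp_perm M s (srt K) Yp]
    rw [show Yp ∘ ⇑s = srt L ∘ t by funext x; simp]
    ring
  have e2 : ∀ s, ∑ t : Equiv.Perm Tl, (sg (t * s⁻¹) * tp q M (srt K) Yp) *
        (u K.1 * star (u L.1)) = minorDet q M K.1 L.1 * (u K.1 * star (u L.1)) := by
    intro s
    rw [← Finset.sum_mul]
    congr 1
    refine (Equiv.sum_comp (Equiv.mulRight s⁻¹) (fun t => sg t * tp q M (srt K) (srt L ∘ t))).trans ?_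
    rw [minorDet, dif_pos ⟨K.2, L.2⟩, ← det_transpose, det_apply']
    refine scg fun t _ => ?_
    simp [sg, tpm, srt]
  simp only [e1, e2]
  simp [Finset.card_univ, Fintype.card_perm, mul_assoc]
end eps
section wdcalc
variable {n : ℕ}
abbrev Sm {n : ℕ} {F : Type*} [NormedAddCommGroup F] [NormedSpace ℝ F] (Ω : Set Qa)
    (f : Qa → F) : Prop := ContDiffOn ℝ Qe f Ω
def wD (c : ℂ) (j : Fin n) (f : Qc) (z : Qa) : ℂ :=
  (1 / 2) * (fderiv ℝ f z (Pi.single j 1) + c * fderiv ℝ f z (Pi.single j Complex.I))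
theorem wDz_eq : (wDz : Fin n → _) = wD (-Complex.I) := by
  funext j f z; simp only [wDz, wD]; ring
theorem wDzbar_eq : (wDzbar : Fin n → _) = wD Complex.I := rfl
variable {c d : ℂ} {j k : Fin n} {f g : Qc} {z : Qa} {Ω : Set Qa}
theorem Sm.at (h : Sm Ω f) (hΩ : IsOpen Ω) (hz : z ∈ Ω) : ContDiffAt ℝ Qe f z :=
  h.contDiffAt Ya
theorem Sm.diff (h : Sm Ω f) (hΩ : IsOpen Ω) (hz : z ∈ Ω) : DifferentiableAt ℝ f z :=
  (h.at hΩ hz).differentiableAt Qy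
theorem wD_congr (h : f =ᶠ[𝓝 z] g) : wD c j f z = wD c j g z := by
  simp only [wD, h.fderiv_eq]
theorem wD_add (hf : DifferentiableAt ℝ f z) (hg : DifferentiableAt ℝ g z) :
    wD c j (fun x => f x + g x) z = wD c j f z + wD c j g z := by
  simp only [wD, fderiv_fun_add hf hg, add_apply]; ring
theorem wD_sub (hf : DifferentiableAt ℝ f z) (hg : DifferentiableAt ℝ g z) :
    wD c j (fun x => f x - g x) z = wD c j f z - wD c j g z := by
  simp only [wD, fderiv_fun_sub hf hg, sub_apply]; ring
theorem wD_mul (hf : DifferentiableAt ℝ f z) (hg : DifferentiableAt ℝ g z) :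
    wD c j Tt z = wD c j f z * g z + f z * wD c j g z := by
  simp only [wD, fderiv_fun_mul hf hg, add_apply, smul_apply,
    smul_eq_mul]; ring
theorem wD_const (a : ℂ) : wD c j (fun _ => a) z = 0 := by simp [wD]
theorem wD_const_mul (a : ℂ) : wD c j Ud z = a * wD c j f z := by
  by_cases ha : a = 0
  · simp [ha, wD_const]
  have : Ud = fun x => a • f x := rfl
  rw [this]
  have h2 : fderiv ℝ (fun x => a • f x) z = a • fderiv ℝ f z :=
    congrFun (fderiv_const_smul_field (𝕜 := ℝ) (f := f) a) z
  simp only [wD, h2]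
  simp; ring
theorem wD_sum {ι : Type*} (s : Finset ι) {f : ι → Qc} (h : ∀ i ∈ s, DifferentiableAt ℝ Hl z) :
    wD c j Yi z = ∑ i ∈ s, wD c j Hl z := by
  simp only [wD, fderiv_fun_sum h, sum_apply, Finset.mul_sum, Finset.sum_add_distrib, mul_add]
theorem wD_star : wD c j (fun x => star Hy) z = star (wD (star c) j f z) := by
  simp only [wD, fderiv_star]
  simp
theorem wD_zero_of_nmem (h : z ∉ tsupport f) : wD c j f z = 0 := by
  have : f =ᶠ[𝓝 z] fun _ => 0 := notMem_tsupport_iff_eventuallyEq.1 h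
  rw [wD_congr this, wD_const]
theorem tsupport_wD : tsupport (wD c j f) ⊆ tsupport f := by
  refine closure_minimal (fun z hz => ?_) (isClosed_tsupport f)
  by_contra h
  exact hz (wD_zero_of_nmem h)
theorem wD_sm (hΩ : IsOpen Ω) (h : Sm Ω f) : Sm Ω (wD c j f) := by
  have h1 : Sm Ω (fderiv ℝ f) := h.fderiv_of_isOpen hΩ Qy
  have h2 : ∀ v, Sm Ω (fun z => fderiv ℝ f z v) := fun v => h1.clm_apply contDiffOn_const
  unfold wD
  exact contDiffOn_const.mul ((h2 _).add (contDiffOn_const.mul (h2 _)))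
theorem wD_contDiff (h : ContDiff ℝ Qe f) : ContDiff ℝ Qe (wD c j f) :=
  contDiffOn_univ.1 (wD_sm isOpen_univ (contDiffOn_univ.2 h))
theorem wD_comm (h : ContDiffAt ℝ Qe f z) : wD c j (wD d k f) z = wD d k (wD c j f) z := by
  have h1 : DifferentiableAt ℝ (fderiv ℝ f) z :=
    (h.fderiv_right (m := 1) (by norm_cast)).differentiableAt Qy
  have h2 : ∀ v, DifferentiableAt ℝ (fun x => fderiv ℝ f x v) z := fun v =>
    h1.clm_apply (differentiableAt_const v)
  have h3 : ∀ v w, fderiv ℝ (fun x => fderiv ℝ f x v) z w = fderiv ℝ (fderiv ℝ f) z w v := by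
    intro v w
    rw [fderiv_clm_apply h1 (differentiableAt_const v)]; simp
  have e : ∀ (c : ℂ) (j : Fin n) (d : ℂ) (k : Fin n), wD c j (wD d k f) z = (1/2) * (1/2) *
     (fderiv ℝ (fderiv ℝ f) z (Pi.single j 1) (Pi.single k 1)
      + d * fderiv ℝ (fderiv ℝ f) z (Pi.single j 1) (Pi.single k Complex.I)
      + c * (fderiv ℝ (fderiv ℝ f) z (Pi.single j Complex.I) (Pi.single k 1)
      + d * fderiv ℝ (fderiv ℝ f) z (Pi.single j Complex.I) (Pi.single k Complex.I))) := by
    intro c j d k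
    have : (wD d k f) = fun x => (1/2) * (fderiv ℝ f x (Pi.single k 1) + d * fderiv ℝ f x (Pi.single k Complex.I)) := rfl
    rw [this, wD_const_mul, wD_add (h2 _) ((h2 _).const_mul d), wD_const_mul]
    simp only [wD, h3]; ring
  have hs : IsSymmSndFDerivAt ℝ f z := h.isSymmSndFDerivAt (by simp; norm_cast)
  rw [e, e, hs.eq (Pi.single j 1), hs.eq (Pi.single j 1), hs.eq (Pi.single j Complex.I), hs.eq (Pi.single j Complex.I)]
  ring
theorem integral_wD (h : ContDiff ℝ Qe f) (hc : HasCompactSupport f) :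
    ∫ x, wD c j f x = 0 := by
  have hd : Differentiable ℝ f := h.differentiable Qy
  have hi : ∀ v, Integrable (fun x => fderiv ℝ f x v) := fun v => by
    refine Continuous.integrable_of_hasCompactSupport ?_ (hc.fderiv_apply ℝ v)
    exact (h.continuous_fderiv Qy).clm_apply continuous_const
  have h0 : ∀ v, ∫ x, fderiv ℝ f x v = 0 := fun v => by
    have := integral_mul_fderiv_eq_neg_fderiv_mul_of_integrable (𝕜 := ℂ) (μ := volume)
      (f := fun _ : Qa => (1 : ℂ)) (g := f) (v := v) Qy (by simpa using hi v)
      (by simpa using h.continuous.integrable_of_hasCompactSupport hc)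
      (fun _ _ => differentiableAt_const _) (fun x _ => hd x)
    simpa using this
  unfold wD
  rw [integral_const_mul, integral_add (hi _) ((hi _).const_mul c), integral_const_mul, h0, h0]
  simp
theorem wD_real_comp {F : ℝ → ℝ} {F' : ℝ} {t : Qa → ℝ} (hF : HasDerivAt F F' (t z))
    (ht : DifferentiableAt ℝ t z) :
    wD c j (fun x => ((F (t x) : ℝ) : ℂ)) z = F' * wD c j (fun x => (t x : ℂ)) z := by
  have h1 : HasFDerivAt (fun x => ((F (t x) : ℝ) : ℂ))
      (Complex.ofRealCLM.comp (F' • fderiv ℝ t z)) z :=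
    Complex.ofRealCLM.hasFDerivAt.comp z (hF.comp_hasFDerivAt z ht.hasFDerivAt)
  have h2 : HasFDerivAt (fun x => ((t x : ℝ) : ℂ)) (Complex.ofRealCLM.comp (fderiv ℝ t z)) z :=
    Complex.ofRealCLM.hasFDerivAt.comp z ht.hasFDerivAt
  simp only [wD, h1.fderiv, h2.fderiv]
  simp; ring
theorem wDzbar_holo (h : DifferentiableAt ℂ f z) : wDzbar j f z = 0 := by
  unfold wDzbar
  rw [(h.hasFDerivAt.restrictScalars ℝ).fderiv]
  simp only [ContinuousLinearMap.coe_restrictScalars']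
  have : (Pi.single j Complex.I : Qa) = Complex.I • Pi.single j 1 := by
    rw [← Pi.single_smul]; simp
  rw [this, map_smul, smul_eq_mul, ← mul_assoc, Complex.I_mul_I]; ring
theorem ofReal_sm {t : Qa → ℝ} (h : Sm Ω t) : Sm Ω (fun x => (t x : ℂ)) :=
  Complex.ofRealCLM.contDiff.comp_contDiffOn h
theorem cHess_sm {t : Qa → ℝ} (hΩ : IsOpen Ω) (h : Sm Ω t) (j k : Fin n) :
    Sm Ω (fun z => cHess t z j k) := by
  simp only [cHess, Matrix.of_apply, wDz_eq, wDzbar_eq]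
  exact wD_sm hΩ (wD_sm hΩ (ofReal_sm h))
theorem wD_congr_on {f g : Qc} (hΩ : IsOpen Ω) (hz : z ∈ Ω) (h : ∀ x ∈ Ω, f x = g x) :
    wD c j f z = wD c j g z :=
  wD_congr (eventually_of_mem Ya h)
theorem cHess_dz {t : Qa → ℝ} (hΩ : IsOpen Ω) (h : Sm Ω t) (hz : z ∈ Ω) (m j k : Fin n) :
    wDz m (fun z => cHess t z j k) z = wDz j (fun z => cHess t z m k) z := by
  simp only [cHess, Matrix.of_apply, wDz_eq, wDzbar_eq]
  exact wD_comm ((wD_sm hΩ (ofReal_sm h)).at hΩ hz)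
theorem cHess_herm {t : Qa → ℝ} (hΩ : IsOpen Ω) (h : Sm Ω t) (hz : z ∈ Ω) :
    (cHess t z).IsHermitian := by
  ext j k
  simp only [cHess, Matrix.conjTranspose_apply, Matrix.of_apply, wDz_eq, wDzbar_eq]
  rw [show (-Complex.I) = star Complex.I by simp, ← wD_star]
  have : (fun x => star (wD Complex.I j (fun w => (t w : ℂ)) x)) = wD (star Complex.I) j fun w => (t w : ℂ) := by
    funext x
    rw [show Complex.I = star (star Complex.I) by simp, ← wD_star]
    simp
  rw [this]
  exact wD_comm ((ofReal_sm h).at hΩ hz)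
theorem cHess_add {s t : Qa → ℝ} (hΩ : IsOpen Ω) (hs : Sm Ω s) (h : Sm Ω t) (hz : z ∈ Ω) :
    cHess (fun x => s x + t x) z = cHess s z + cHess t z := by
  ext j k
  simp only [cHess, Matrix.add_apply, Matrix.of_apply, wDz_eq, wDzbar_eq, Complex.ofReal_add]
  rw [← wD_add ((wD_sm hΩ (ofReal_sm hs)).diff hΩ hz) ((wD_sm hΩ (ofReal_sm h)).diff hΩ hz)]
  exact wD_congr_on hΩ hz fun x hx => wD_add ((ofReal_sm hs).diff hΩ hx) ((ofReal_sm h).diff hΩ hx)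
theorem cHess_smul {t : Qa → ℝ} (a : ℝ) :
    cHess (fun x => a * t x) z = (a : ℂ) • cHess t z := by
  ext j k
  simp only [cHess, Matrix.smul_apply, Matrix.of_apply, wDz_eq, wDzbar_eq, Complex.ofReal_mul, smul_eq_mul]
  rw [← wD_const_mul]
  congr 1; funext x; exact wD_const_mul _
theorem test_mul (hΩ : IsOpen Ω) (hf : Sm Ω f) (hg : IsTest Ω g) : IsTest Ω Tt := by
  have hs : tsupport Tt ⊆ tsupport g := tsupport_mul_subset_right
  refine ⟨contDiff_iff_contDiffAt.2 fun x => ?_, hg.2.1.mul_left, hs.trans hg.2.2⟩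
  by_cases hx : x ∈ tsupport g
  · exact (hf.at hΩ (hg.2.2 hx)).mul hg.1.contDiffAt
  · have : Tt =ᶠ[𝓝 x] fun _ => 0 := by
      filter_upwards [notMem_tsupport_iff_eventuallyEq.1 hx] with y hy
      simp [hy]
    exact contDiffAt_const.congr_of_eventuallyEq this
theorem test_wD (hg : IsTest Ω g) : IsTest Ω (wD c j g) :=
  ⟨wD_contDiff hg.1, hg.2.1.mono' ((subset_tsupport _).trans tsupport_wD), tsupport_wD.trans hg.2.2⟩
theorem test_add (hf : IsTest Ω f) (hg : IsTest Ω g) : IsTest Ω (fun x => f x + g x) :=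
  ⟨hf.1.add hg.1, hf.2.1.add hg.2.1, (tsupport_add f g).trans (Set.union_subset hf.2.2 hg.2.2)⟩
theorem test_zero : IsTest Ω (fun _ => (0 : ℂ)) :=
  ⟨contDiff_const, HasCompactSupport.zero, by simp [tsupport]⟩
theorem test_sum {ι : Type*} (s : Finset ι) {f : ι → Qc} (h : ∀ i ∈ s, IsTest Ω Hl) :
    IsTest Ω Yi := by
  classical
  induction s using Finset.induction_on with
  | empty => simpa using test_zero
  | insert a s ha ih =>
    simp only [Finset.sum_insert ha]
    exact test_add (h a Qy) (ih fun i hi => h i (by simp [hi]))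
theorem test_star (hf : IsTest Ω f) : IsTest Ω (fun x => star Hy) := by
  have hs : Function.support (fun x => star Hy) = Function.support f := by ext; simp
  refine ⟨(starL' ℝ : ℂ ≃L[ℝ] ℂ).contDiff.comp hf.1, ?_, ?_⟩
  · unfold HasCompactSupport tsupport; rw [hs]; exact hf.2.1
  · unfold tsupport; rw [hs]; exact hf.2.2
theorem test_const_mul (a : ℂ) (hΩ : IsOpen Ω) (hg : IsTest Ω g) : IsTest Ω (fun x => a * g x) :=
  test_mul hΩ contDiffOn_const hg
theorem IsTest.sm (h : IsTest Ω f) : Sm Ω f := h.1.contDiffOn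
theorem IsTest.mono {Ω' : Set Qa} (h : IsTest Ω f) (hs : Ω ⊆ Ω') : IsTest Ω' f :=
  ⟨h.1, h.2.1, h.2.2.trans hs⟩
theorem IsTest.integrable (h : IsTest Ω f) : Integrable f := h.1.continuous.integrable_of_hasCompactSupport h.2.1
end wdcalc
section BI
variable {n r : ℕ} {Ω : Set Qa}
theorem wD_prod {c : ℂ} {j : Fin n} {z : Qa} {ι : Type*} [DecidableEq ι] (s : Finset ι)
    {f : ι → Qc} (h : ∀ i ∈ s, DifferentiableAt ℝ Hl z) :
    wD c j (fun x => ∏ i ∈ s, f i x) z = ∑ i ∈ s, wD c j Hl z * ∏ k ∈ s.erase i, f k z := by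
  induction s using Finset.induction_on with
  | empty => simp [wD_const]
  | insert a s ha ih =>
    have h1 := h a (Finset.mem_insert_self a s)
    have h2 : ∀ i ∈ s, DifferentiableAt ℝ Hl z := fun i hi => h i (Finset.mem_insert_of_mem hi)
    simp only [Finset.prod_insert ha]
    have h3 : DifferentiableAt ℝ (fun x => ∏ i ∈ s, f i x) z := by
      clear ih ha h
      induction s using Finset.induction_on with
      | empty => simp
      | insert b s hb ih =>
        simp only [Finset.prod_insert hb]
        exact (h2 b (Finset.mem_insert_self b s)).mul
          (ih fun i hi => h2 i (Finset.mem_insert_of_mem hi))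
    rw [wD_mul h1 h3, ih h2,
      Finset.sum_insert ha, Finset.erase_insert ha, Finset.mul_sum]
    congr 1
    refine scg fun i hi => ?_
    have hne : a ≠ i := fun e => ha (e ▸ hi)
    rw [Finset.erase_insert_of_ne hne, Finset.prod_insert (by simp [ha])]
    ring
theorem bi_point (hΩ : IsOpen Ω) {ψ : Qa → ℝ} (hψ : Sm Ω ψ) {x y γ : Qc}
    (hx : Sm Ω x) (hy : Sm Ω y) (hγ : Sm Ω γ) (i l : Fin n) {z : Qa} (hz : z ∈ Ω) :
    star (wDzbar i x z) * γ z * (Real.exp Tb * wDzbar l y z) =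
      wDz i (fun z => star (x z) * γ z * (Real.exp Tb * wDzbar l y z)) z
      - wDzbar l (fun z => star (x z) * γ z * wDz i (fun z => Real.exp Tb * y z) z) z
      + star (x z) * (cHess ψ z i l * γ z) * (Real.exp Tb * y z)
      + (Real.exp (-ψ z)) * (star (wDz l (fun z => Real.exp Tb * x z) z) * γ z *
          wDz i (fun z => Real.exp Tb * y z) z)
      - star (x z) * wDz i γ z * (Real.exp Tb * wDzbar l y z)
      + star (x z) * wDzbar l γ z * wDz i (fun z => Real.exp Tb * y z) z := by
  obtain ⟨E, hE⟩ : ∃ E : Qa → ℂ, ∀ z, (Real.exp Tb : ℂ) = E z := ⟨_, fun _ => rfl⟩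
  have hE' : E = fun z => Qi := by funext z; exact (hE z).symm
  simp only [hE]
  have sψ : Sm Ω Ha := ofReal_sm hψ
  have sE : Sm Ω E := by rw [hE']; exact ofReal_sm (Real.contDiff_exp.comp_contDiffOn hψ)
  have dE : ∀ c j, ∀ w ∈ Ω, wD c j E w = E w * wD c j Ha w := fun c j w hw => by
    rw [hE']; exact wD_real_comp (Real.hasDerivAt_exp _) ((hψ.contDiffAt (hΩ.mem_nhds hw)).differentiableAt Qy)
  have sx : Sm Ω (fun z => star (x z)) := (starL' ℝ : ℂ ≃L[ℝ] ℂ).contDiff.comp_contDiffOn hx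
  simp only [wDz_eq, wDzbar_eq, cHess, Matrix.of_apply]
  have dV : ∀ c j (y : Qc), Sm Ω y → ∀ w ∈ Ω, wD c j (fun z => E z * y z) w =
      E w * wD c j Ha w * y w + E w * wD c j y w := fun c j y hy w hw => by
    rw [wD_mul (sE.diff hΩ hw) (hy.diff hΩ hw), dE c j w hw]
  have sby := wD_sm (c := Complex.I) (j := l) hΩ hy
  have siy := wD_sm (c := -Complex.I) (j := i) hΩ hy
  have siψ := wD_sm (c := -Complex.I) (j := i) hΩ sψ
  have d := fun {f : Qc} (h : Sm Ω f) => h.diff hΩ hz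
  rw [wD_congr_on (c := Complex.I) (j := l) (f := fun z => star (x z) * γ z * wD (-Complex.I) i (fun z => E z * y z) z)
    hΩ hz (fun w hw => by rw [dV _ _ y hy w hw])]
  simp only [dV _ _ y hy z hz, dV _ _ x hx z hz]
  rw [wD_mul (d (sx.mul hγ)) (d (sE.mul sby)), wD_mul (d sx) (d hγ), wD_mul (d sE) (d sby),
    wD_mul (d (sx.mul hγ)) (d (((sE.mul siψ).mul hy).add (sE.mul siy))), wD_mul (d sx) (d hγ),
    wD_add (d ((sE.mul siψ).mul hy)) (d (sE.mul siy)), wD_mul (d (sE.mul siψ)) (d hy),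
    wD_mul (d sE) (d siψ), wD_mul (d sE) (d siy), dE _ _ z hz, dE _ _ z hz,
    wD_star, wD_star, wD_comm (hy.at hΩ hz) (c := Complex.I) (d := -Complex.I),
    wD_comm (sψ.at hΩ hz) (c := Complex.I) (d := -Complex.I)]
  have e1 : star (wD (-Complex.I) l Ha z) = wD Complex.I l Ha z := by
    have := wD_star (c := Complex.I) (j := l) (f := fun z => (ψ z : ℂ)) (z := z)
    simp only [Complex.star_def, Complex.conj_ofReal, Complex.conj_I] at this ⊢
    exact this.symm
  have e2 : Qj = (E z)⁻¹ := by simp [hE', Real.exp_neg]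
  have e3 : star (E z) = E z := by simp [hE', -Complex.ofReal_exp]
  have e4 : E z ≠ 0 := by simp [hE']
  rw [e2]
  simp only [star_add, star_mul', e1, e3]
  simp only [Complex.star_def, Complex.conj_I, map_neg, neg_neg]
  field_simp
  ring
theorem sum_sym_zero {q : ℕ} {F h : Qo → ℂ} (hF : Asym F) (a b : Fin q) (hab : a ≠ b)
    (hh : ∀ J, h (J ∘ Equiv.swap a b) = h J) : ∑ J, F J * h J = 0 := by
  have h1 : ∑ J, F J * h J = - ∑ J, F J * h J := by
    conv_lhs => rw [← sum_perm (Equiv.swap a b)]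
    rw [← Finset.sum_neg_distrib]
    refine scg fun J _ => ?_
    rw [hF, hh, sg, Equiv.Perm.sign_swap hab]; simp
  have : (2 : ℂ) * ∑ J, F J * h J = 0 := by linear_combination h1
  simpa using this
theorem Asym.star {q : ℕ} {F : Qo → ℂ} (hF : Asym F) : Asym (fun J => star (F J)) := by
  intro s J
  simp only [hF s J, star_mul', star_sg]
theorem Asym.mulc {q : ℕ} {F : Qo → ℂ} (hF : Asym F) (c : ℂ) : Asym (fun J => c * F J) := by
  intro s J
  simp only [hF s J]; ring
theorem alt_add {q : ℕ} (F G : Qo → ℂ) (J) : Alt (fun I => F I + G I) J = Alt F J + Alt G J := by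
  simp [Alt, mul_add, Finset.sum_add_distrib]
theorem alt_sum {q : ℕ} {ι : Type*} (s : Finset ι) (F : ι → Qo → ℂ) (J) :
    Alt (fun I => ∑ i ∈ s, F i I) J = ∑ i ∈ s, Alt (F i) J := by
  simp only [Alt, Finset.mul_sum]; rw [Finset.sum_comm]
theorem alt_mulc {q : ℕ} (F : Qo → ℂ) (c : ℂ) (J) : Alt (fun I => F I * c) J = Alt F J * c := by
  simp [Alt, Finset.sum_mul, mul_assoc]
variable {Φ ψ : Qa → ℝ} {z : Qa}
theorem tp_sm (hΩ : IsOpen Ω) (hΦ : Sm Ω Φ) (J K : Fin r → Fin n) : Sm Ω (fun z => tp r Qn J K) := by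
  simp only [tp, tpm, Matrix.of_apply]
  exact contDiffOn_prod fun a _ => cHess_sm hΩ hΦ _ _
theorem tp_wD {c : ℂ} (hΩ : IsOpen Ω) (hΦ : Sm Ω Φ) (hz : z ∈ Ω) (i : Fin n) (J K : Fin r → Fin n) :
    wD c i (fun z => tp r Qn J K) z = ∑ a, wD c i (fun z => cHess Φ z (J a) (K a)) z *
      ∏ b ∈ Finset.univ.erase a, cHess Φ z (J b) (K b) := by
  simp only [tp, tpm, Matrix.of_apply]
  exact wD_prod _ fun a _ => (cHess_sm hΩ hΦ _ _).diff hΩ hz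
def hz1 (Φ : Qa → ℝ) (z : Qa) (K : Fin r → Fin n) (a : Fin r) (I : Fin Qm → Fin n) : ℂ :=
  wDz Ti (fun z => cHess Φ z (I a.succ) (K a)) z *
      ∏ b ∈ Finset.univ.erase a, cHess Φ z (I b.succ) (K b)
theorem hz1_sym (hΩ : IsOpen Ω) (hΦ : Sm Ω Φ) (hz : z ∈ Ω) (K : Fin r → Fin n) (a : Fin r) (I : Fin Qm → Fin n) :
    hz1 Φ z K a (I ∘ Equiv.swap 0 a.succ) = hz1 Φ z K a I := by
  simp only [hz1, Function.comp, Equiv.swap_apply_left, Equiv.swap_apply_right]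
  rw [cHess_dz hΩ hΦ hz]
  congr 1
  refine Finset.prod_congr rfl fun b hb => ?_
  rw [Equiv.swap_apply_of_ne_of_ne (Fin.succ_ne_zero b) (by simpa using Finset.ne_of_mem_erase hb)]
theorem hz1_sum (hΩ : IsOpen Ω) (hΦ : Sm Ω Φ) (hz : z ∈ Ω) (K : Fin r → Fin n) (I : Fin Qm → Fin n) :
    wDz Ti (fun z => tp r Qn Ts K) z = ∑ a, hz1 Φ z K a I := by
  rw [wDz_eq, tp_wD hΩ hΦ hz]; simp only [hz1, wDz_eq]; rfl
theorem dtp_zero (hΩ : IsOpen Ω) (hΦ : Sm Ω Φ) (hz : z ∈ Ω) {F : Qp → ℂ} (hF : Asym F)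
    (K : Fin r → Fin n) : ∑ I, F I * wDz Ti (fun z => tp r Qn Ts K) z = 0 := by
  simp only [hz1_sum hΩ hΦ hz, Finset.mul_sum]
  rw [Finset.sum_comm]
  exact Finset.sum_eq_zero fun a _ => sum_sym_zero hF _ _ (Fin.succ_ne_zero a).symm
    (hz1_sym hΩ hΦ hz K a)
theorem alt_dtp (hΩ : IsOpen Ω) (hΦ : Sm Ω Φ) (hz : z ∈ Ω) (K : Fin r → Fin n) (M) :
    Alt (fun I => wDz Ti (fun z => tp r Qn Ts K) z) M = 0 := by
  simp only [hz1_sum hΩ hΦ hz, alt_sum]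
  exact Finset.sum_eq_zero fun a _ => alt_zero_of_swap _ _ (Fin.succ_ne_zero a).symm
    (hz1_sym hΩ hΦ hz K a) M
theorem dtpbar_zero (hΩ : IsOpen Ω) (hΦ : Sm Ω Φ) (hz : z ∈ Ω) {F : Qp → ℂ} (hF : Asym F)
    (K : Fin r → Fin n) : ∑ I, F I * wDzbar Ti (fun z => tp r Qn K Ts) z = 0 := by
  have := dtp_zero hΩ hΦ hz hF.star K
  have h2 := congrArg star this
  rw [star_sum, star_zero] at h2
  rw [← h2]
  refine scg fun I _ => ?_
  rw [star_mul', star_star]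
  congr 1
  rw [wDz_eq, wDzbar_eq, show (-Complex.I) = star Complex.I by simp, ← wD_star]
  refine wD_congr_on hΩ hz fun x hx => ?_
  have h := congrFun (congrFun (tpm_conjTranspose (q := r) fun _ => cHess Φ x) K) Ts
  rw [Matrix.conjTranspose_apply, (cHess_herm hΩ hΦ hx).eq] at h
  exact h.symm
end BI
section swp
open scoped Matrix
variable {n r q : ℕ}
theorem asym1_swap {w : (Fin Tc → Fin n) → ℂ} (h : Asym1 w) {i j : Fin q} (hij : i ≠ j) (M : Fin Tc → Fin n) :
    w (M ∘ Equiv.swap i.succ j.succ) = - w M := by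
  have e : M ∘ Equiv.swap i.succ j.succ = Fin.cons Td (Fin.tail M ∘ Equiv.swap i j) := by
    funext a
    refine Fin.cases ?_ (fun b => ?_) a
    · simp [Equiv.swap_apply_of_ne_of_ne (Fin.succ_ne_zero i).symm (Fin.succ_ne_zero j).symm]
    · simp only [Function.comp, Fin.cons_succ, Fin.tail]
      rw [← (Fin.succ_injective q).map_swap]
  have h2 := h Td (Equiv.swap i j) Qs
  simp only [Fin.cons_self_tail] at h2
  rw [e, h2, sg, Equiv.Perm.sign_swap hij]
  simp
theorem dot_herm {ι : Type*} [Fintype ι] {M : Matrix ι ι ℂ} (h : M.IsHermitian) (x y : ι → ℂ) :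
    star (M *ᵥ x) ⬝ᵥ y = star x ⬝ᵥ M *ᵥ y := by
  rw [Matrix.star_mulVec, h.eq, Matrix.dotProduct_mulVec]
def swap0 (g : Qb) (B : Fin n → Qp → ℂ) : ℂ :=
  ∑ I, ∑ L, star (B (L 0) I) * tp r g Ts (Fin.tail L) * B Ti L
def lowB (g : Qb) (B : Fin n → Qo → ℂ) (M : Fin Tc → Fin n) : ℂ :=
  (tp q g *ᵥ B Td) Qs
variable {g : Qb}
theorem lowB_asym1 {B : Fin n → Qo → ℂ} (hB : ∀ k, Asym (B k)) : Asym1 (lowB g B) := by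
  intro k
  simpa [lowB] using tp_mulVec_asym g (hB k)
theorem raise_lowB (hg : g.PosDef) (B : Fin n → Qo → ℂ) (k : Fin n) (I : Fin q → Fin n) :
    (tp Tc g⁻¹ *ᵥ lowB g B) (Fin.cons k I) = ∑ l, g⁻¹ k l * B l I := by
  simp only [Matrix.mulVec, dotProduct]
  rw [sum_cons]
  simp only [tp_cons, lowB, Fin.cons_zero, Fin.tail_cons, mul_assoc, ← Finset.mul_sum]
  refine scg fun l _ => ?_
  congr 1
  have : (tp q g⁻¹ *ᵥ (tp q g *ᵥ B l)) I = B l I := by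
    rw [Matrix.mulVec_mulVec, tp_inv hg, Matrix.one_mulVec]
  rw [← this]; rfl
theorem swap_a0 (hg : g.PosDef) (B : Fin n → Qp → ℂ) :
    ∑ M, star (lowB g B (M ∘ Equiv.swap 0 Hg)) * (tp Tg g⁻¹ *ᵥ lowB g B) M = swap0 g B := by
  have key : ∀ i, ∑ k, ∑ J, star ((tp Qm g *ᵥ B i) Qw) * ∑ l, g⁻¹ k l * B l Ul
      = ∑ I, ∑ J, star (B i I) * (tp r g Ts J * B Ti Ul) := by
    intro i
    have h1 : ∑ k, ∑ J, star ((tp Qm g *ᵥ B i) Qw) * ∑ l, g⁻¹ k l * B l Ul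
       = star (tp Qm g *ᵥ B i) ⬝ᵥ (fun I => ∑ l, g⁻¹ Ti l * B l (Fin.cons i Ts)) := by
      simp only [dotProduct]; rw [sum_cons]; simp
    rw [h1, dot_herm (tp_posDef hg).1]
    simp only [dotProduct]
    refine scg fun I _ => ?_
    rw [← Finset.mul_sum]
    congr 1
    rw [← Fin.cons_self_tail I]
    simp only [Matrix.mulVec, dotProduct]
    rw [sum_cons]
    simp only [tp_cons, Fin.cons_zero, Fin.tail_cons]
    rw [Finset.sum_comm]
    refine scg fun J _ => ?_
    have hu := (Matrix.isUnit_iff_isUnit_det _).1 hg.isUnit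
    have h2 : (g *ᵥ (g⁻¹ *ᵥ fun l => B l Ul)) Ti = B Ti Ul := by
      rw [Matrix.mulVec_mulVec, Matrix.mul_nonsing_inv _ hu, Matrix.one_mulVec]
    rw [← h2]
    simp only [Matrix.mulVec, dotProduct, Finset.mul_sum]
    refine scg fun a _ => scg fun b _ => by ring
  rw [sum_cons]
  simp only [raise_lowB hg]
  have h3 : ∀ k (I : Fin Qm → Fin n), lowB g B ((Fin.cons k I : Fin Tg → Fin n) ∘ Equiv.swap 0 Hg) =
      (tp Qm g *ᵥ B Ti) (Fin.cons k Ts) := by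
    intro k I
    simp only [lowB, Function.comp, Equiv.swap_apply_left, Fin.cons_succ]
    congr 1
    funext a
    refine Fin.cases ?_ (fun b => ?_) a
    · simp [Fin.tail]
    · simp only [Fin.tail, Fin.cons_succ, Function.comp]
      rw [Equiv.swap_apply_of_ne_of_ne (Fin.succ_ne_zero _) ((Fin.succ_injective _).ne (Fin.succ_ne_zero b))]
      simp
  simp only [h3]
  have h4 : ∀ k, ∑ I : Fin Qm → Fin n, star ((tp Qm g *ᵥ B Ti) (Fin.cons k Ts)) * ∑ l, g⁻¹ k l * B l I
     = ∑ i, ∑ J, star ((tp Qm g *ᵥ B i) Qw) * ∑ l, g⁻¹ k l * B l Ul := by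
    intro k; rw [sum_cons]; simp
  simp only [h4]
  rw [Finset.sum_comm]
  simp only [key, swap0]
  rw [Finset.sum_comm]
  refine scg fun I _ => ?_
  rw [sum_cons]
  simp [mul_assoc]
theorem swap_a (hg : g.PosDef) {B : Fin n → Qp → ℂ} (hB : ∀ k, Asym (B k)) (a : Fin Qm) :
    ∑ M, star (lowB g B (M ∘ Equiv.swap 0 a.succ)) * (tp Tg g⁻¹ *ᵥ lowB g B) M = swap0 g B := by
  by_cases ha : a = 0
  · subst ha; exact swap_a0 hg B
  rw [← swap_a0 hg, ← sum_perm (Equiv.swap Hg a.succ)]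
  refine scg fun M _ => ?_
  have hr : Asym1 (tp Tg g⁻¹ *ᵥ lowB g B) := by
    intro k s J
    simp only [raise_lowB hg, hB _ s J, Finset.mul_sum]
    refine scg fun l _ => by ring
  rw [asym1_swap hr (Ne.symm ha)]
  have e : (M ∘ Equiv.swap Hg a.succ) ∘ Equiv.swap 0 a.succ
     = (M ∘ Equiv.swap 0 Hg) ∘ Equiv.swap Hg a.succ := by
    rw [Function.comp_assoc, Function.comp_assoc]
    congr 1
    have : Equiv.swap Hg a.succ * Equiv.swap 0 a.succ = Equiv.swap 0 Hg * Equiv.swap Hg a.succ := by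
      have h2 : (Fin.succ 0 : Fin Tg) ≠ a.succ := fun h => ha (Fin.succ_injective _ h).symm
      have h3 : (Fin.succ 0 : Fin Tg) ≠ 0 := Fin.succ_ne_zero _
      have h4 : a.succ ≠ 0 := Fin.succ_ne_zero _
      ext x
      simp only [Equiv.Perm.mul_apply, Equiv.swap_apply_def]
      split_ifs <;> simp_all
    exact congrArg (fun e : Equiv.Perm (Fin Tg) => (e : Fin Tg → Fin Tg)) this
  rw [e, asym1_swap (lowB_asym1 hB) (Ne.symm ha)]
  simp
theorem swap_bound (hg : g.PosDef) {B : Fin n → Qp → ℂ} (hB : ∀ k, Asym (B k)) :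
    - qf (tp Tg g⁻¹) (Alt (lowB g B)) ≤ (swap0 g B).re := by
  set w := lowB g B with hw
  set H := tp Tg g⁻¹
  have hH : H.PosSemidef := tpm_psd fun _ => hg.posSemidef.inv
  set A : (Fin Tg → Fin n) → ℂ := fun M => w M - ∑ a : Fin Qm, w (M ∘ Equiv.swap 0 a.succ) with hA
  have h1 : Alt w = (((r+1).factorial : ℝ) : ℂ) • A := by
    funext M; rw [hw, alt_asym1 (lowB_asym1 hB)]; simp [hA, hw]
  have h2 : star A ⬝ᵥ H *ᵥ w = star w ⬝ᵥ H *ᵥ w - (r+1 : ℝ) * swap0 g B := by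
    have : (((r+1 : ℝ)) : ℂ) * swap0 g B = ∑ a : Fin Qm, ∑ M, star (w (M ∘ Equiv.swap 0 a.succ)) * (H *ᵥ w) M := by
      rw [scg fun a _ => swap_a hg hB a]; simp
    rw [this, Finset.sum_comm]
    simp only [dotProduct, ← Finset.sum_sub_distrib]
    refine scg fun M _ => ?_
    simp only [hA, Pi.star_apply, star_sub, star_sum, sub_mul, Finset.sum_mul]
  have h3 := qf_cs hH A w
  have h4 := congrArg Complex.re h2
  rw [Complex.sub_re, Complex.re_ofReal_mul] at h4
  change _ = qf H w - _ at h4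
  have h5 : (star A ⬝ᵥ H *ᵥ w).re ≤ ‖star A ⬝ᵥ H *ᵥ w‖ := Complex.re_le_norm _
  have h6 : ‖star A ⬝ᵥ H *ᵥ w‖ ≤ qf H w + qf H A / 4 := by
    have a1 := qf_nonneg hH w
    have a2 := qf_nonneg hH A
    refine abs_le_of_sq_le_sq' ?_ Qt |>.2
    nlinarith [sq_nonneg (qf H w - qf H A / 4)]
  have h7 : qf H Hk = ((r+1).factorial : ℝ)^2 * qf H A := by
    rw [h1, qf_smul_vec]; simp
  have h8 : (1:ℝ) ≤ (r+1).factorial := by exact_mod_cast Nat.one_le_iff_ne_zero.2 (Nat.factorial_ne_zero _)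
  have a2 := qf_nonneg hH A
  have h9 : qf H A ≤ qf H Hk := by rw [h7]; nlinarith [sq_nonneg ((r+1).factorial - 1 : ℝ)]
  have h10 : -(qf H A / 4) ≤ (r+1 : ℝ) * (swap0 g B).re := by linarith
  have hr : (0:ℝ) ≤ r := by positivity
  by_contra hcon
  push Not at hcon
  nlinarith
end swp
section BIc
open scoped Matrix
variable {n r q : ℕ} {Ω : Set Qa}
theorem det_sm {m : ℕ} {M : Qa → Matrix (Fin m) (Fin m) ℂ}
    (h : ∀ i j, Sm Ω (fun z => M z i j)) : Sm Ω (fun z => (M z).det) := by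
  simp only [Matrix.det_apply']
  refine ContDiffOn.sum fun s _ => contDiffOn_const.mul (contDiffOn_prod fun i _ => h _ _)
theorem inv_sm {m : ℕ} {M : Qa → Matrix (Fin m) (Fin m) ℂ}
    (h : ∀ i j, Sm Ω (fun z => M z i j)) (hu : ∀ z ∈ Ω, (M z).det ≠ 0) (i j) :
    Sm Ω (fun z => (M z)⁻¹ i j) := by
  simp only [Matrix.inv_def, Matrix.smul_apply, Ring.inverse_eq_inv', smul_eq_mul, Matrix.adjugate_apply]
  refine ((det_sm h).inv hu).mul (det_sm fun a b => ?_)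
  by_cases e : a = j
  · subst e; simp only [Matrix.updateRow_self]; exact contDiffOn_const
  · simp only [Matrix.updateRow_ne e]; exact h _ _
theorem tpm_sm {M : Qa → Fin q → Qb}
    (h : ∀ a i j, Sm Ω (fun z => M z a i j)) (J K) : Sm Ω (fun z => tpm (M z) J K) := by
  simp only [tpm, Matrix.of_apply]
  exact contDiffOn_prod fun a _ => h _ _ _
variable {Φ ψ : Qa → ℝ}
theorem gi_sm (hΩ : IsOpen Ω) (hΦ : Sm Ω Φ) (hg : Qd) (i j) :
    Sm Ω (fun z => Qn⁻¹ i j) :=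
  inv_sm (cHess_sm hΩ hΦ) (fun z hz => ((Matrix.isUnit_iff_isUnit_det _).1 (hg z hz).isUnit).ne_zero) i j
theorem exp_sm (hψ : Sm Ω ψ) : Sm Ω (fun z => Qi) :=
  ofReal_sm (Real.contDiff_exp.comp_contDiffOn hψ)
theorem star_sm {f : Qc} (h : Sm Ω f) : Sm Ω (fun z => star (f z)) :=
  (starL' ℝ : ℂ ≃L[ℝ] ℂ).contDiff.comp_contDiffOn h
theorem test_mulr {f g : Qc} (hΩ : IsOpen Ω) (hf : IsTest Ω f) (hg : Sm Ω g) :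
    IsTest Ω Tt := by
  simpa only [mul_comm] using test_mul hΩ hg hf
theorem int_test {f : Qc} (hf : IsTest Ω f) : ∫ z in Ω, f z = ∫ z, f z :=
  setIntegral_eq_integral_of_forall_compl_eq_zero fun _ hz =>
    image_eq_zero_of_notMem_tsupport fun h => hz (hf.2.2 h)
theorem int_wD_test {f : Qc} {c j} (hf : IsTest Ω f) : ∫ z in Ω, wD c j f z = 0 := by
  rw [int_test (test_wD hf), integral_wD hf.1 hf.2.1]
theorem test_qf {ι : Type*} [Fintype ι] (hΩ : IsOpen Ω) {M : Qa → Matrix ι ι ℂ} {x y : ι → Qc}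
    (hM : ∀ i j, Sm Ω (fun z => M z i j)) (hx : ∀ i, Sm Ω (x i)) (hy : ∀ i, IsTest Ω (y i)) :
    IsTest Ω (fun z => star (fun i => x i z) ⬝ᵥ M z *ᵥ Tm) := by
  simp only [dotProduct, Matrix.mulVec]
  exact test_sum _ fun i _ => test_mul hΩ (star_sm (hx i)) (test_sum _ fun j _ => test_mul hΩ (hM i j) (hy j))
def dX (X : Qp → Qc) (J : Fin r → Fin n) (z : Qa) : ℂ :=
  ∑ k, wDzbar k (X Qw) z
theorem test_dX {X : Qp → Qc} (hX : ∀ I, IsTest Ω Yt) (J) : IsTest Ω (dX X J) :=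
  test_sum _ fun k _ => by rw [wDzbar_eq]; exact test_wD (hX _)
def dY (y : Qo → Qc) (z : Qa) (M : Fin Tc → Fin n) : ℂ :=
  wDz Td (y Qs) z
def low (Φ ψ : Qa → ℝ) (X : Qo → Qc) (I : Fin q → Fin n) (z : Qa) : ℂ :=
  Real.exp Tb * (tp q Qn *ᵥ fun J => X J z) I
theorem test_low (hΩ : IsOpen Ω) (hΦ : Sm Ω Φ) (hψ : Sm Ω ψ) {X : Qo → Qc}
    (hX : ∀ I, IsTest Ω Yt) (I) : IsTest Ω (low Φ ψ X I) := by
  refine test_mul hΩ (exp_sm hψ) ?_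
  simp only [Matrix.mulVec, dotProduct]
  exact test_sum _ fun J _ => test_mul hΩ (tp_sm hΩ hΦ _ _) (hX J)
theorem test_altdY {y : Qo → Qc} (hΩ : IsOpen Ω) (hy : ∀ I, IsTest Ω (y I)) (M) :
    IsTest Ω (fun z => Alt (dY y z) M) := by
  simp only [Alt, dY, wDz_eq]
  exact test_sum _ fun s _ => test_const_mul _ hΩ (test_wD (hy _))
theorem alt_dY_low (hΩ : IsOpen Ω) (hΦ : Sm Ω Φ) (hψ : Sm Ω ψ) {X : Qo → Qc}
    (hX : ∀ I, IsTest Ω Yt) {z} (hz : z ∈ Ω) :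
    Alt Hb = Alt (lowB Qn fun k I => wDz k (fun z => Real.exp Tb * X I z) z) := by
  have h1 : dY (low Φ ψ X) z = fun M => lowB Qn (fun k I => wDz k (fun z => Real.exp Tb * X I z) z) M
      + ∑ I, wDz Td (fun z => tp q Qn Qs I) z * (Real.exp Tb * X I z) := by
    funext M
    simp only [dY, lowB, Matrix.mulVec, dotProduct, ← Finset.sum_add_distrib, wDz_eq]
    have : low Φ ψ X Qs = fun z => ∑ I, tp q Qn Qs I * (Real.exp Tb * X I z) := by
      funext z
      simp only [low, Matrix.mulVec, dotProduct, Finset.mul_sum]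
      exact scg fun I _ => by ring
    rw [this, wD_sum]
    · refine scg fun I _ => ?_
      rw [wD_mul ((tp_sm hΩ hΦ _ _).diff hΩ hz) (Sm.diff ((exp_sm hψ).mul (hX I).sm) hΩ hz)]
      ring
    · exact fun I _ => Sm.diff ((tp_sm hΩ hΦ _ _).mul ((exp_sm hψ).mul (hX I).sm)) hΩ hz
  funext M
  rw [h1, alt_add, alt_sum]
  simp only [alt_mulc, alt_dtp hΩ hΦ hz, zero_mul, Finset.sum_const_zero, add_zero]
theorem BI (hΩ : IsOpen Ω) (hΦ : Sm Ω Φ) (hψ : Sm Ω ψ) (hg : Qd)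
    {X : Qp → Qc} (hX : ∀ I, IsTest Ω Yt) (hA : ∀ z, Asym Th) :
    ∫ z in Ω, Real.exp Tb * qf (tpm Ta) Th ≤
      (∫ z in Ω, Real.exp Tb * qf Hh Qx) +
      ∫ z in Ω, Real.exp (-ψ z) * qf (tp Tg Qn⁻¹) (Alt Hb) := by
  set E : Qc := fun z => (Real.exp Tb : ℂ) with hE
  set B : Qa → Fin n → Qp → ℂ := fun z k I => wDz k (fun z => E z * X I z) z with hB
  set γ : Qp → Qp → Qc :=
    fun I L z => tp r Qn Ts (Fin.tail L) with hγ
  have sγ : ∀ I L, Sm Ω (γ I L) := fun I L => tp_sm hΩ hΦ _ _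
  have sE : Sm Ω E := exp_sm hψ
  set T : Qc := fun z => E z * (star Qx ⬝ᵥ tp r Qn *ᵥ Qx)
  set Cv : Qc := fun z => E z * (star Th ⬝ᵥ
    tpm Ta *ᵥ Th)
  set Sw : Qc := fun z => Qj * swap0 Qn (B z)
  set Q : Qc := fun z => Qj * (star (fun M => Alt Hb M) ⬝ᵥ
    tp Tg Qn⁻¹ *ᵥ (fun M => Alt Hb M))
  set P : Qp → Qp → Qc :=
    fun I L z => star (X I z) * γ I L z * Ui with hP
  set R : Qp → Qp → Qc :=
    fun I L z => star (X I z) * γ I L z * wDz Ti (fun z => E z * X L z) z with hR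
  have tV : ∀ I, IsTest Ω (fun z => E z * X I z) := fun I => test_mul hΩ sE (hX I)
  have tB : ∀ k I, IsTest Ω (fun z => B z k I) := fun k I => by
    simp only [hB, wDz_eq]; exact test_wD (tV I)
  have tP : ∀ I L, IsTest Ω (P I L) := fun I L =>
    test_mul hΩ ((star_sm (hX I).sm).mul (sγ I L)) (test_mul hΩ sE (test_wD (hX L)))
  have tR : ∀ I L, IsTest Ω (R I L) := fun I L =>
    test_mul hΩ ((star_sm (hX I).sm).mul (sγ I L)) (tB _ _)
  have sψ' : Sm Ω (fun z => -ψ z) := hψ.neg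
  have tT : IsTest Ω T := test_mul hΩ sE (test_qf hΩ (tp_sm hΩ hΦ) (fun J => (test_dX hX J).sm) (test_dX hX))
  have tC : IsTest Ω Cv := test_mul hΩ sE (test_qf hΩ (tpm_sm fun a i j => by
    refine Fin.cases ?_ (fun b => ?_) a
    · simpa using cHess_sm hΩ hψ i j
    · simpa using cHess_sm hΩ hΦ i j) (fun J => (hX J).sm) hX)
  have tQ : IsTest Ω Q := test_mul hΩ (exp_sm sψ') (test_qf hΩ (tpm_sm fun a i j => gi_sm hΩ hΦ hg i j)
    (fun M => (test_altdY hΩ (test_low hΩ hΦ hψ hX) M).sm) (test_altdY hΩ (test_low hΩ hΦ hψ hX)))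
  have tS : IsTest Ω Sw := test_mul hΩ (exp_sm sψ') (test_sum _ fun I _ => test_sum _ fun L _ =>
    test_mul hΩ ((star_sm (tB _ _).sm).mul (tp_sm hΩ hΦ _ _)) (tB _ _))
  have aB : ∀ z ∈ Ω, ∀ k, Asym (B z k) := fun z hz k s I => by
    simp only [hB, wDz_eq]
    rw [← wD_const_mul]
    refine wD_congr_on hΩ hz fun x _ => ?_
    rw [show X (I ∘ s) x = sg s * X I x from hA x s I]; ring
  have point : ∀ z ∈ Ω, T z = ∑ I, ∑ L, (wDz Ti (P I L) z - wDzbar (L 0) (R I L) z) + Cv z + Sw z := by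
    intro z hz
    have e1 : T z = ∑ I, ∑ L, star (wDzbar Ti Yt z) * γ I L z * Ui := by
      have s : ∀ f : Qp → ℂ, ∑ I, f I = ∑ J : Fin r → Fin n, ∑ k, f Qw :=
        fun f => by rw [sum_cons, Finset.sum_comm]
      rw [s]
      simp only [T, dotProduct, Matrix.mulVec, dX]
      rw [Finset.mul_sum]
      refine scg fun J _ => ?_
      simp only [Pi.star_apply, star_sum]
      rw [Finset.sum_mul, Finset.mul_sum]
      refine scg fun k _ => ?_
      rw [s, Finset.mul_sum, Finset.mul_sum]
      refine scg fun K _ => ?_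
      rw [Finset.mul_sum, Finset.mul_sum, Finset.mul_sum]
      refine scg fun l _ => ?_
      simp only [hγ, Fin.tail_cons, Fin.cons_zero]
      ring
    have e2 : Cv z = ∑ I, ∑ L, star (X I z) * (cHess ψ z Ti (L 0) * γ I L z) * (E z * X L z) := by
      simp only [Cv, dotProduct, Matrix.mulVec, Finset.mul_sum, Pi.star_apply]
      refine scg fun I _ => scg fun L _ => ?_
      conv_lhs => enter [2, 2, 1]; rw [← Fin.cons_self_tail I, ← Fin.cons_self_tail L, tpm_cons]
      simp only [hγ]; ring
    have e3 : Sw z = ∑ I, ∑ L, (Real.exp (-ψ z)) * (star (wDz (L 0) (fun z => E z * X I z) z) * γ I L z *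
          wDz Ti (fun z => E z * X L z) z) := by
      simp only [Sw, swap0, Finset.mul_sum]; rfl
    have z1 : ∑ I, ∑ L, star (X I z) * wDz Ti (γ I L) z * Ui = 0 := by
      rw [Finset.sum_comm]
      refine Finset.sum_eq_zero fun L _ => ?_
      rw [← Finset.sum_mul]
      rw [dtp_zero hΩ hΦ hz (hA z).star, zero_mul]
    have z2 : ∑ I, ∑ L, star (X I z) * wDzbar (L 0) (γ I L) z * wDz Ti (fun z => E z * X L z) z = 0 := by
      refine Finset.sum_eq_zero fun I _ => ?_
      have := dtpbar_zero hΩ hΦ hz (aB z hz Ti) Ts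
      rw [← mul_zero (star (X I z)), ← this, Finset.mul_sum]
      exact scg fun L _ => by simp only [hB, hγ]; ring
    rw [e1, e2, e3, scg fun I _ => scg fun L _ =>
      bi_point hΩ hψ (hX I).sm (hX L).sm (sγ I L) Ti (L 0) hz]
    simp only [Finset.sum_sub_distrib, Finset.sum_add_distrib]
    rw [z1, z2]
    ring
  have hint : ∫ z in Ω, T z = (∫ z in Ω, Cv z) + ∫ z in Ω, Sw z := by
    rw [setIntegral_congr_fun hΩ.measurableSet point]
    have t1 : ∀ I L, IsTest Ω (fun z => wDz Ti (P I L) z - wDzbar (L 0) (R I L) z) := fun I L => by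
      have := test_add (test_wD (c := -Complex.I) (j := I 0) (tP I L))
        (test_const_mul (-1) hΩ (test_wD (c := Complex.I) (j := L 0) (tR I L)))
      simpa [wDz_eq, wDzbar_eq, sub_eq_add_neg] using this
    have t2 := test_sum Finset.univ fun I _ => test_sum Finset.univ fun L _ => t1 I L
    rw [integral_add (test_add t2 tC).integrable.integrableOn tS.integrable.integrableOn,
      integral_add t2.integrable.integrableOn tC.integrable.integrableOn,
      integral_finset_sum _ fun I _ => (test_sum Finset.univ fun L _ => t1 I L).integrable.integrableOn,
      Finset.sum_eq_zero, zero_add]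
    intro I _
    rw [integral_finset_sum _ fun L _ => (t1 I L).integrable.integrableOn]
    refine Finset.sum_eq_zero fun L _ => ?_
    rw [wDz_eq, wDzbar_eq, integral_sub (test_wD (tP I L)).integrable.integrableOn (test_wD (tR I L)).integrable.integrableOn,
      int_wD_test (tP I L), int_wD_test (tR I L), sub_zero]
  have re : ∀ f : Qa → ℂ, IsTest Ω f → (∫ z in Ω, f z).re = ∫ z in Ω, (f z).re := fun f hf =>
    (integral_re hf.integrable.integrableOn).symm
  have ri : ∀ f : Qa → ℂ, IsTest Ω f → IntegrableOn (fun z => (f z).re) Ω := fun f hf =>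
    hf.integrable.integrableOn.re
  have h1 := congrArg Complex.re hint
  rw [Complex.add_re, re _ tT, re _ tC, re _ tS] at h1
  have h2 : - ∫ z in Ω, (Q z).re ≤ ∫ z in Ω, (Sw z).re := by
    rw [← integral_neg]
    refine setIntegral_mono_on (ri _ tQ).neg (ri _ tS) hΩ.measurableSet fun z hz => ?_
    simp only [Sw, Q, Complex.re_ofReal_mul]
    rw [← mul_neg]
    refine mul_le_mul_of_nonneg_left ?_ (Real.exp_pos _).le
    have := swap_bound Tp (aB z hz)
    rw [← alt_dY_low hΩ hΦ hψ hX hz] at this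
    exact this
  have f1 : ∀ z, (T z).re = Real.exp Tb * qf Hh Qx := fun z => by
    simp only [T, hE, Complex.re_ofReal_mul, qf]
  have f2 : ∀ z, (Cv z).re = Real.exp Tb * qf (tpm Ta) Th := fun z => by
    simp only [Cv, hE, Complex.re_ofReal_mul, qf]
  have f3 : ∀ z, (Q z).re = Real.exp (-ψ z) * qf (tp Tg Qn⁻¹) (Alt Hb) := fun z => by
    simp only [Q, Complex.re_ofReal_mul, qf]
  simp only [f1, f2, f3] at h1 h2
  linarith
end BIc
section moll
open scoped ENNReal
variable {n : ℕ}
def sqn (f : Qc) : ℝ≥0∞ := ∫⁻ x, ‖f x‖ₑ ^ 2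
theorem sqn_eq (f : Qc) : sqn f = eLpNorm f 2 volume ^ 2 := by
  have := eLpNorm_nnreal_pow_eq_lintegral (μ := volume) (f := f) (p := 2) To
  simp only [NNReal.coe_ofNat, ENNReal.rpow_ofNat, ENNReal.coe_ofNat] at this
  rw [this, sqn]
theorem sqn_tendsto {f : ℕ → Qc} (h : Tendsto (fun k => sqn (f k)) atTop Tf) :
    Tendsto (fun k => eLpNorm (f k) 2 volume) atTop Tf := by
  have h2 : Tendsto (fun k => (sqn (f k)) ^ (1/2:ℝ)) atTop (𝓝 (0 ^ (1/2:ℝ))) := h.ennrpow_const _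
  rw [ENNReal.zero_rpow_of_pos To] at h2
  refine h2.congr fun k => ?_
  rw [sqn_eq, ← ENNReal.rpow_natCast, ← ENNReal.rpow_mul]; norm_num
theorem tr_cont {f : Qc} (hf : MemLp f 2 volume) (ε : ℝ≥0∞) (hε : 0 < ε) :
    ∃ δ > (0:ℝ), ∀ s : Qa, ‖s‖ ≤ δ → ∫⁻ x, ‖f Hi - f x‖ₑ ^ 2 ≤ ε := by
  have mp : ∀ s : Qa, MeasurePreserving (fun x => x + s) (volume : Measure Qa) volume :=
    fun s => measurePreserving_add_right _ s
  have hg : Continuous (fun s : Qa => (⟨fun x => x + s, by fun_prop⟩ : C(Fin n → ℂ, Fin n → ℂ))) :=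
    ContinuousMap.continuous_of_continuous_uncurry _ (by simp only [Function.uncurry_def, ContinuousMap.coe_mk]; fun_prop)
  have hc : Continuous (fun s : Qa => Lp.compMeasurePreserving _ (mp s) (hf.toLp f)) :=
    Continuous.compMeasurePreservingLp (continuous_const) hg mp To
  have h1 : Tendsto (fun s : Qa => edist (Lp.compMeasurePreserving _ (mp s) (hf.toLp f)) (hf.toLp f) ^ 2) Tf Tf := by
    have h0 : Lp.compMeasurePreserving _ (mp 0) (hf.toLp f) = hf.toLp f := by
      rw [Lp.toLp_compMeasurePreserving]; congr 1; funext x; simp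
    have := ENNReal.Tendsto.pow (n := 2) ((hc.edist (continuous_const (y := hf.toLp f))).tendsto 0)
    simp only [h0, edist_self] at this
    simpa using this
  have h2 := (h1.eventually (gt_mem_nhds hε))
  obtain ⟨δ, hδ, h3⟩ := Metric.nhds_basis_closedBall.eventually_iff.1 h2
  refine ⟨δ, hδ, fun s hs => ?_⟩
  have h4 := (h3 (by simpa using hs)).le
  refine le_trans (le_of_eq ?_) h4
  rw [Lp.toLp_compMeasurePreserving, Lp.edist_toLp_toLp]
  exact sqn_eq (fun x => f Hi - f x)
theorem cs_set {s : Set Qa} {g : Qa → ℝ≥0∞} (hg : AEMeasurable g volume) :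
    (∫⁻ x in s, g x) ^ 2 ≤ volume s * ∫⁻ x in s, g x ^ 2 := by
  have h := ENNReal.lintegral_mul_le_Lp_mul_Lq (volume.restrict s) Real.HolderConjugate.two_two
    (f := fun _ => 1) (g := g) aemeasurable_const hg.restrict
  simp only [Pi.mul_apply, one_mul, ENNReal.one_rpow, lintegral_const, Measure.restrict_apply_univ] at h
  calc _ ≤ _ := pow_le_pow_left' h 2
    _ = _ := by
      rw [mul_pow, ← ENNReal.rpow_natCast, ← ENNReal.rpow_natCast, ← ENNReal.rpow_mul, ← ENNReal.rpow_mul]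
      norm_num
theorem e_sq_add (a b : ℂ) : ‖a + b‖ₑ ^ 2 ≤ 2 * ‖a‖ₑ ^ 2 + 2 * ‖b‖ₑ ^ 2 := by
  simp only [← ofReal_norm]
  rw [← ENNReal.ofReal_pow Qt, ← ENNReal.ofReal_pow Qt, ← ENNReal.ofReal_pow Qt,
    show (2:ℝ≥0∞) = ENNReal.ofReal 2 by simp, ← ENNReal.ofReal_mul Qt, ← ENNReal.ofReal_mul Qt,
    ← ENNReal.ofReal_add Qt Qt]
  apply ENNReal.ofReal_le_ofReal
  nlinarith [norm_add_le a b, norm_nonneg (a+b), sq_nonneg (‖a‖-‖b‖)]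
abbrev dm (n : ℕ) : ℕ := Module.finrank ℝ Qa
theorem ML {f : Qc} (hf : MemLp f 2 volume) (C : ℝ) (c : ℂ) (hC : 0 ≤ C)
    (K : ℕ → Qa → Qc) (hcont : ∀ k x, Continuous (K k x))
    (hsup : ∀ (k : ℕ) x t, Ht⁻¹ < ‖t - x‖ → K k x t = 0)
    (hbd : ∀ k x t, ‖K k x t‖ ≤ C * Ht ^ dm n)
    (hint : ∀ k x, ‖(∫ t, K k x t) - c‖ ≤ C * Ht⁻¹) :
    Tendsto (fun k => sqn Yn) atTop Tf := by
  set V : ℝ≥0∞ := volume (Metric.closedBall (0 : Qa) 1)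
  have hV : V ≠ ∞ := measure_closedBall_lt_top.ne
  have hfli : LocallyIntegrable f := hf.locallyIntegrable To
  have hKs : ∀ k x, HasCompactSupport (K k x) := fun k x => by
    refine HasCompactSupport.intro (isCompact_closedBall x Ht⁻¹) fun t ht => hsup k x t ?_
    rw [Metric.mem_closedBall, dist_eq_norm] at ht; exact not_le.1 ht
  have hKi : ∀ k x, Integrable (K k x) := fun k x => (hcont k x).integrable_of_hasCompactSupport (hKs k x)
  have hKf : ∀ k x, Integrable (fun t => K k x t * f t) := fun k x =>
    hfli.integrable_smul_left_of_hasCompactSupport (hcont k x) (hKs k x)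
  -- pointwise bound
  set A : ℕ → ℝ≥0∞ := fun k => ENNReal.ofReal (C * Qf ^ dm n)
  set B : ℕ → ℝ≥0∞ := fun k => volume (Metric.closedBall (0 : Qa) Qf⁻¹)
  have hB : ∀ k, B k = ENNReal.ofReal (Qf⁻¹ ^ dm n) * V := fun k =>
    Measure.addHaar_closedBall' _ _ Qt
  have hAB : ∀ k, A k * B k = ENNReal.ofReal C * V := fun k => by
    rw [hB, ← mul_assoc, ← ENNReal.ofReal_mul Qt, mul_assoc, ← mul_pow,
      mul_inv_cancel₀ Qt, one_pow, mul_one]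
  have hfm := hf.1
  have hpt : ∀ k x, ‖(∫ t, K k x t * f t) - c * f x‖ₑ ^ 2 ≤
      2 * (A k ^ 2 * (B k * ∫⁻ s in Metric.closedBall 0 Qf⁻¹, ‖f Hi - f x‖ₑ ^ 2)) +
      2 * (ENNReal.ofReal (C * Ht⁻¹) ^ 2 * ‖f x‖ₑ ^ 2) := fun k x => by
    have e : (∫ t, K k x t * f t) - c * f x = (∫ t, K k x t * (f t - f x)) + ((∫ t, K k x t) - c) * f x := by
      simp only [mul_sub]
      rw [integral_sub (hKf k x) ((hKi k x).mul_const _), integral_mul_const]; ring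
    rw [e]
    refine (e_sq_add _ _).trans ?_
    gcongr
    · calc ‖∫ t, K k x t * (f t - f x)‖ₑ ^ 2 ≤ (∫⁻ t, ‖K k x t * (f t - f x)‖ₑ) ^ 2 := by
            gcongr; exact enorm_integral_le_lintegral_enorm _
        _ = (∫⁻ s, ‖K k x Hi * (f Hi - f x)‖ₑ) ^ 2 := by
            rw [lintegral_add_left_eq_self (fun t => ‖K k x t * (f t - f x)‖ₑ) x]
        _ ≤ (∫⁻ s in Metric.closedBall 0 Qf⁻¹, A k * ‖f Hi - f x‖ₑ) ^ 2 := by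
            refine pow_le_pow_left' ?_ 2
            rw [← lintegral_indicator measurableSet_closedBall]
            refine lintegral_mono fun s => ?_
            by_cases hs : s ∈ Metric.closedBall (0 : Qa) Qf⁻¹
            · rw [Set.indicator_of_mem hs, enorm_mul]
              gcongr
              rw [← ofReal_norm]
              exact ENNReal.ofReal_le_ofReal (hbd _ _ _)
            · rw [hsup k x Hi (by simpa using hs)]; simp
        _ ≤ _ := by
            rw [lintegral_const_mul' _ _ (by simp [A]), mul_pow]
            gcongr
            refine cs_set ?_
            have : AEStronglyMeasurable (fun s => f Hi) volume :=
              hfm.comp_quasiMeasurePreserving (quasiMeasurePreserving_add_left _ x)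
            exact (this.sub aestronglyMeasurable_const).enorm
    · rw [enorm_mul, mul_pow]
      gcongr
      rw [← ofReal_norm]
      exact ENNReal.ofReal_le_ofReal (hint _ _)
  have hprod : AEMeasurable (fun p : Qa × Qa => ‖f (p.1 + p.2) - f p.1‖ₑ ^ 2) (volume.prod volume) := by
    have h1 : AEStronglyMeasurable (fun p : Qa × Qa => f (p.1 + p.2)) (volume.prod volume) :=
      hfm.comp_quasiMeasurePreserving (quasiMeasurePreserving_add _ _)
    have h2 : AEStronglyMeasurable (fun p : Qa × Qa => f p.1) (volume.prod volume) :=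
      hfm.comp_fst
    exact (h1.sub h2).enorm.pow_const 2
  have hq : ∀ k, sqn Yn ≤
      2 * (A k ^ 2 * (B k * ∫⁻ s in Metric.closedBall 0 Qf⁻¹, ∫⁻ x, ‖f Hi - f x‖ₑ ^ 2)) +
      2 * Yl := fun k => by
    have hBk : B k ≠ ∞ := measure_closedBall_lt_top.ne
    refine (lintegral_mono (hpt k)).trans ?_
    rw [lintegral_add_right', lintegral_const_mul' 2 _ Qy, lintegral_const_mul' 2 _ Qy, lintegral_const_mul' (A k ^ 2) _ (by simp [A]),
      lintegral_const_mul' (B k) _ hBk, lintegral_const_mul' (ENNReal.ofReal _ ^ 2) _ Qy, lintegral_lintegral_swap]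
    · rfl
    · refine AEMeasurable.mono_measure hprod (Measure.prod_mono le_rfl Measure.restrict_le_self)
    · exact ((hfm.enorm.pow_const 2).const_mul _).const_mul _
  have hsf : sqn f ≠ ∞ := by rw [sqn_eq]; exact ENNReal.pow_ne_top hf.2.ne
  set σ : ℕ → ℝ≥0∞ := fun k => ⨆ s ∈ Metric.closedBall (0 : Qa) Qf⁻¹, ∫⁻ x, ‖f Hi - f x‖ₑ ^ 2
  have hinv : Tendsto (fun k : ℕ => Qf⁻¹) atTop Tf := by
    simpa using tendsto_one_div_add_atTop_nhds_zero_nat (𝕜 := ℝ)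
  have hσ : Tendsto σ atTop Tf := by
    rw [ENNReal.tendsto_atTop_zero]
    intro ε hε
    obtain ⟨δ, hδ, h⟩ := tr_cont hf ε hε
    obtain ⟨N, hN⟩ := (hinv.eventually (gt_mem_nhds hδ)).exists_forall_of_atTop
    refine ⟨N, fun k hk => iSup₂_le fun s hs => h s ?_⟩
    have := hN k hk
    rw [mem_closedBall_zero_iff] at hs; linarith
  have hb : ∀ k, sqn Yn ≤
      2 * ((ENNReal.ofReal C * V) ^ 2 * σ k) + 2 * Yl := fun k => by
    refine (hq k).trans ?_
    rw [← hAB k, mul_pow, mul_assoc (A k ^ 2), pow_two (B k), mul_assoc (B k)]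
    gcongr
    refine (setLIntegral_mono' measurableSet_closedBall fun s hs => le_iSup₂ (f := fun s _ => ∫⁻ x, ‖f Hi - f x‖ₑ ^ 2) s hs).trans ?_
    rw [setLIntegral_const, mul_comm]
  refine tendsto_of_tendsto_of_tendsto_of_le_of_le tendsto_const_nhds ?_ (fun _ => zero_le) hb
  have h1 : Tendsto (fun k => 2 * ((ENNReal.ofReal C * V) ^ 2 * σ k)) atTop (𝓝 (2 * ((ENNReal.ofReal C * V) ^ 2 * 0))) :=
    ENNReal.Tendsto.const_mul (ENNReal.Tendsto.const_mul hσ (Or.inr (by finiteness))) (Or.inr Qy)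
  have h2 : Tendsto (fun k : ℕ => ENNReal.ofReal (C * Ht⁻¹)) atTop Tf := by
    have := ENNReal.tendsto_ofReal (hinv.const_mul C)
    simpa using this
  have h3 : Tendsto (fun k : ℕ => 2 * Yl) atTop (𝓝 (2 * (0 ^ 2 * sqn f))) :=
    ENNReal.Tendsto.const_mul (ENNReal.Tendsto.mul_const (ENNReal.Tendsto.pow h2) (Or.inr hsf)) (Or.inr Qy)
  simpa using h1.add h3
end moll
section moll2
open scoped ENNReal
variable {n : ℕ}
def bump0 (n : ℕ) : ContDiffBump (0 : Qa) := ⟨1/2, 1, by norm_num, by norm_num⟩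
def rho0 (t : Qa) : ℂ := ((bump0 n).normed volume t : ℝ)
def mol (k : ℕ) (t : Qa) : ℂ := (Qf ^ dm n : ℝ) * rho0 (Qf • t)
theorem rho0_sm : ContDiff ℝ (⊤:ℕ∞) (rho0 (n := n)) :=
  Complex.ofRealCLM.contDiff.comp ((bump0 n).contDiff_normed)
theorem rho0_zero {t : Qa} (h : 1 < ‖t‖) : rho0 t = 0 := by
  have : t ∉ Function.support ((bump0 n).normed volume) := by
    rw [(bump0 n).support_normed_eq]; simp [bump0]; linarith
  simp [rho0, Function.notMem_support.1 this]
theorem rho0_cs : HasCompactSupport (rho0 (n := n)) :=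
  HasCompactSupport.intro (isCompact_closedBall 0 1) fun t ht => rho0_zero (by simpa using ht)
theorem mol_sm (k : ℕ) : ContDiff ℝ (⊤:ℕ∞) (mol (n := n) k) :=
  contDiff_const.mul (rho0_sm.comp (contDiff_const_smul _))
theorem mol_zero (k : ℕ) {t : Qa} (h : Qf⁻¹ < ‖t‖) : mol k t = 0 := by
  rw [mol, rho0_zero, mul_zero]
  rw [norm_smul, Real.norm_of_nonneg Qt]
  rwa [inv_lt_iff_one_lt_mul₀' Qt] at h
theorem mol_cs (k : ℕ) : HasCompactSupport (mol (n := n) k) :=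
  HasCompactSupport.intro (isCompact_closedBall 0 Qf⁻¹) fun t ht => mol_zero k (by simpa using ht)
theorem mol_int (k : ℕ) : ∫ t, mol (n := n) k t = 1 := by
  simp only [mol]
  rw [integral_const_mul, Measure.integral_comp_smul]
  have : ∫ t, rho0 (n := n) t = 1 := by
    simp only [rho0]; rw [integral_complex_ofReal, (bump0 n).integral_normed]; simp
  rw [this, abs_of_nonneg Qt]
  simp
  rw [mul_inv_cancel₀]
  norm_cast; positivity
theorem mol_bd : ∃ C, 0 ≤ C ∧ ∀ (k : ℕ) (t : Qa), ‖mol k t‖ ≤ C * Qf ^ dm n := by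
  obtain ⟨C, hC⟩ := rho0_cs.exists_bound_of_continuous (rho0_sm (n := n)).continuous
  refine ⟨C, (norm_nonneg _).trans (hC 0), fun k t => ?_⟩
  rw [mol, norm_mul, Complex.norm_of_nonneg Qt, mul_comm]
  gcongr; exact hC _
theorem wD_mol (c : ℂ) (l : Fin n) (k : ℕ) (t : Qa) :
    wD c l Yd t = (Qf ^ (dm n + 1) : ℝ) * wD c l rho0 (Qf • t) := by
  have e : mol (n := n) k = fun t => ((Qf ^ dm n : ℝ) : ℂ) * rho0 (Qf • t) := rfl
  rw [e, wD_const_mul]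
  simp only [wD]
  rw [fderiv_comp_smul]
  simp only [smul_apply, Complex.real_smul]; push_cast; ring
theorem wD_mol_bd (c : ℂ) (l : Fin n) : ∃ C, 0 ≤ C ∧ ∀ (k : ℕ) (t : Qa), ‖wD c l Yd t‖ ≤ C * Qf ^ (dm n + 1) := by
  obtain ⟨C, hC⟩ := (rho0_cs.mono' (subset_trans subset_closure (tsupport_wD (c := c) (j := l)))).exists_bound_of_continuous (wD_contDiff rho0_sm (c := c) (j := l)).continuous
  refine ⟨C, (norm_nonneg _).trans (hC 0), fun k t => ?_⟩
  rw [wD_mol, norm_mul, Complex.norm_of_nonneg Qt, mul_comm]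
  gcongr; exact hC _
theorem wD_mol_zero (c : ℂ) (l : Fin n) (k : ℕ) {t : Qa} (h : Qf⁻¹ < ‖t‖) : wD c l Yd t = 0 := by
  have : mol k =ᶠ[𝓝 t] fun _ => 0 := by
    filter_upwards [(continuous_norm.tendsto t).eventually (lt_mem_nhds h)] with s hs using mol_zero k hs
  rw [wD_congr this, wD_const]
theorem wD_refl {f : Qc} (hf : Differentiable ℝ f) (c : ℂ) (l : Fin n) (x t : Qa) :
    wD c l (fun t => f Qv) t = - wD c l f Qv := by
  have : fderiv ℝ (fun t => f Qv) t = - fderiv ℝ f Qv := by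
    have := ((hf Qv).hasFDerivAt.comp t ((hasFDerivAt_id t).const_sub x)).fderiv
    simpa [Function.comp_def] using this
  simp only [wD, this, neg_apply]; ring
def Mo (k : ℕ) (f : Qc) (x : Qa) : ℂ := ∫ t, mol k Qv * f t
theorem Mo_eq (k : ℕ) (f : Qc) : Mo k f = convolution f Yd (ContinuousLinearMap.mul ℝ ℂ) volume := by
  funext x; simp [Mo, convolution_def, mul_comm]
theorem Mo_sm (k : ℕ) {f : Qc} (hf : LocallyIntegrable f) : ContDiff ℝ (⊤:ℕ∞) (Mo k f) := by
  rw [Mo_eq]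
  exact (mol_cs k).contDiff_convolution_right _ hf Hv
theorem wD_Mo (k : ℕ) {f : Qc} (hf : LocallyIntegrable f) (c : ℂ) (l : Fin n) (x : Qa) :
    wD c l (Mo k f) x = ∫ t, wD c l Yd Qv * f t := by
  have h := (mol_cs k).hasFDerivAt_convolution_right (ContinuousLinearMap.mul ℝ ℂ) hf ((mol_sm k).of_le (by norm_cast)) x
  have hv : ∀ v, Integrable (fun t => fderiv ℝ Yd Qv v * f t) := fun v => by
    refine hf.integrable_smul_left_of_hasCompactSupport (g := fun t => fderiv ℝ Yd Qv v) ?_ ?_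
    · have := (mol_sm (n := n) k).continuous_fderiv Qy
      fun_prop
    · exact (((mol_cs k).fderiv_apply ℝ v).comp_homeomorph (Homeomorph.subLeft x))
  have h2 : ∀ v, fderiv ℝ (Mo k f) x v = ∫ t, fderiv ℝ Yd Qv v * f t := fun v => by
    rw [Mo_eq, h.fderiv]
    rw [convolution_precompR_apply _ hf ((mol_cs k).fderiv ℝ) ((mol_sm k).continuous_fderiv Qy)]
    simp [convolution_def, mul_comm]
  simp only [wD, h2, add_mul, mul_assoc]
  rw [integral_const_mul, integral_add (hv _) ((hv _).const_mul c), integral_const_mul]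
theorem Mo_tendsto {f : Qc} (hf : MemLp f 2 volume) :
    Tendsto (fun k => sqn (fun x => Mo k f x - f x)) atTop Tf := by
  obtain ⟨C, hC, h⟩ := mol_bd (n := n)
  have := ML hf C 1 hC (fun k x t => mol k Qv) (fun k x => (mol_sm k).continuous.comp (by fun_prop))
    (fun k x t ht => mol_zero k (by rwa [norm_sub_rev])) (fun k x t => h k _) (fun k x => by
      rw [integral_sub_left_eq_self (fun t => mol k t), mol_int]; simp; positivity)
  simpa [Mo] using this
theorem refl_cs {g : Qc} (hg : HasCompactSupport g) (x : Qa) : HasCompactSupport (fun t => g Qv) :=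
  hg.comp_homeomorph (Homeomorph.subLeft x)
theorem refl_sm {g : Qc} (hg : ContDiff ℝ (⊤:ℕ∞) g) (x : Qa) : ContDiff ℝ (⊤:ℕ∞) (fun t => g Qv) :=
  hg.comp (contDiff_const.sub contDiff_id)
theorem wD_mol_cont (c : ℂ) (l : Fin n) (k : ℕ) : Continuous (wD c l (mol (n := n) k)) :=
  (wD_contDiff Hv (c := c) (j := l)).continuous
theorem wD_mol_cs (c : ℂ) (l : Fin n) (k : ℕ) : HasCompactSupport (wD c l (mol (n := n) k)) :=
  HasCompactSupport.intro (isCompact_closedBall 0 Qf⁻¹) fun t ht => wD_mol_zero c l k (by simpa using ht)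
theorem comm_tendsto {a f : Qc} (ha : ContDiff ℝ (⊤:ℕ∞) a) (hac : HasCompactSupport a)
    (hf : MemLp f 2 volume) (c : ℂ) (l : Fin n) :
    Tendsto (fun k => sqn (fun x => wD c l (fun x => a x * Mo k f x) x - ∫ t, wD c l Yd Qv * (a t * f t)))
      atTop Tf := by
  obtain ⟨C1, hC1, h1⟩ := mol_bd (n := n)
  obtain ⟨C2, hC2, h2⟩ := wD_mol_bd (n := n) c l
  have hda := wD_contDiff ha (c := c) (j := l)
  have hdac : HasCompactSupport (wD c l a) := hac.mono' (subset_trans subset_closure (tsupport_wD (c := c) (j := l)))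
  obtain ⟨L1, hL1⟩ := ContDiff.lipschitzWith_of_hasCompactSupport hac (ha.of_le (m := 1) (by norm_cast)) Qy
  obtain ⟨L2, hL2⟩ := ContDiff.lipschitzWith_of_hasCompactSupport hdac (hda.of_le (m := 1) (by norm_cast)) Qy
  obtain ⟨C3, hC3⟩ := hdac.exists_bound_of_continuous hda.continuous
  have hC3' : 0 ≤ C3 := (norm_nonneg _).trans (hC3 0)
  have hfli : LocallyIntegrable f := hf.locallyIntegrable To
  set V : ℝ := (volume (Metric.closedBall (0 : Qa) 1)).toReal
  have hmi : ∀ k x, Integrable (fun t : Qa => mol k Qv) := fun k x =>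
    (refl_sm Hv x).continuous.integrable_of_hasCompactSupport (refl_cs (mol_cs k) x)
  -- L1 norm of the mollifier
  have hm1 : ∀ k x, ∫ t : Qa, ‖mol k Qv‖ = 1 := fun k x => by
    rw [integral_sub_left_eq_self (fun t => ‖mol k t‖)]
    have : ∀ t : Qa, mol k t = ((‖mol k t‖ : ℝ) : ℂ) := fun t => by
      have : mol k t = (((Qf ^ dm n) * ((bump0 n).normed volume (Qf • t)) : ℝ) : ℂ) := by
        simp [mol, rho0]
      rw [this, Complex.norm_of_nonneg]
      exact mul_nonneg Qt ((bump0 n).nonneg_normed _)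
    have h := mol_int (n := n) k
    rw [integral_congr_ae (Eventually.of_forall this), integral_complex_ofReal] at h
    exact_mod_cast h
  have key := ML hf (C3 * C1 + L1 * C2 + L2) 0 Qt
    (fun k x t => wD c l a x * mol k Qv + Um * wD c l Yd Qv)
    (fun k x => by
      have := (mol_sm (n := n) k).continuous
      have := wD_mol_cont (n := n) c l k
      have := ha.continuous
      fun_prop)
    (fun k x t ht => by
      rw [norm_sub_rev] at ht
      rw [mol_zero k ht, wD_mol_zero c l k ht]; simp)
    (fun k x t => by
      by_cases ht : Qf⁻¹ < ‖x - t‖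
      · rw [mol_zero k ht, wD_mol_zero c l k ht]; simp; positivity
      · have e1 : ‖a x - a t‖ ≤ L1 * Qf⁻¹ := by
          refine (hL1.norm_sub_le x t).trans ?_
          gcongr; exact not_lt.1 ht
        calc _ ≤ ‖wD c l a x‖ * ‖mol k Qv‖ + ‖a x - a t‖ * ‖wD c l Yd Qv‖ := by
              refine (norm_add_le _ _).trans ?_; rw [norm_mul, norm_mul]
          _ ≤ C3 * (C1 * Qf ^ dm n) + (L1 * Qf⁻¹) * (C2 * Qf ^ (dm n + 1)) := by
              gcongr
              · exact hC3 x
              · exact h1 _ _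
              · exact h2 _ _
          _ = (C3 * C1 + L1 * C2) * Qf ^ dm n := by
              rw [pow_succ]; field_simp
          _ ≤ _ := by
              refine mul_le_mul_of_nonneg_right ?_ Qt
              have := L2.2; linarith [show (0:ℝ) ≤ L2 from L2.2])
    (fun k x => by
      have i1 : Integrable (fun t => wD c l a t * mol k Qv) :=
        (hda.continuous.mul (refl_sm Hv x).continuous).integrable_of_hasCompactSupport ((refl_cs (mol_cs k) x).mul_left)
      have i2 : Integrable (fun t => Um * wD c l Yd Qv) := by
        refine Continuous.integrable_of_hasCompactSupport ?_ ((refl_cs (wD_mol_cs c l k) x).mul_left)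
        have := wD_mol_cont (n := n) c l k
        have := ha.continuous
        fun_prop
      have ibp : ∫ t, Um * wD c l Yd Qv = - ∫ t, wD c l a t * mol k Qv := by
        have h0 := integral_wD (c := c) (j := l) (f := fun t => Um * mol k Qv)
          ((contDiff_const.sub ha).mul (refl_sm Hv x)) ((refl_cs (mol_cs k) x).mul_left)
        have h3 : ∀ t, wD c l (fun t => Um * mol k Qv) t =
            -(wD c l a t * mol k Qv) - Um * wD c l Yd Qv := fun t => by
          have d1 : DifferentiableAt ℝ a t := (ha.differentiable Qy) t
          have d2 : DifferentiableAt ℝ (fun t => mol k Qv) t := ((refl_sm Hv x).differentiable Qy) t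
          rw [wD_mul (f := fun t => a x - a t) ((differentiableAt_const _).sub d1) d2, wD_sub (differentiableAt_const _) d1, wD_const,
            wD_refl ((mol_sm k).differentiable Qy)]
          ring
        rw [integral_congr_ae (Eventually.of_forall h3), integral_sub (f := fun t => -(wD c l a t * mol k Qv)) i1.neg i2, integral_neg] at h0
        linear_combination -h0
      rw [integral_add ((hmi k x).const_mul _) i2, ibp, ← sub_eq_add_neg, ← integral_sub ((hmi k x).const_mul _) i1, sub_zero]
      calc _ ≤ ∫ t, ‖wD c l a x * mol k Qv - wD c l a t * mol k Qv‖ := norm_integral_le_integral_norm _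
        _ ≤ ∫ t, (L2 * Qf⁻¹) * ‖mol k Qv‖ := by
            refine integral_mono (((hmi k x).const_mul _).sub i1).norm ((hmi k x).norm.const_mul _) fun t => ?_
            simp only
            rw [← sub_mul, norm_mul]
            by_cases ht : Qf⁻¹ < ‖x - t‖
            · rw [mol_zero k ht]; simp
            · gcongr
              refine (hL2.norm_sub_le x t).trans ?_
              gcongr; exact not_lt.1 ht
        _ = L2 * Qf⁻¹ := by rw [integral_const_mul, hm1, mul_one]
        _ ≤ _ := by
            gcongr; nlinarith [mul_nonneg hC3' hC1, mul_nonneg L1.2 hC2])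
  refine key.congr fun k => ?_
  congr 1; funext x
  have j1 : Integrable (fun t => mol k Qv * f t) :=
    hfli.integrable_smul_left_of_hasCompactSupport (refl_sm Hv x).continuous (refl_cs (mol_cs k) x)
  have hc2 : Continuous (fun t => wD c l Yd Qv) := (wD_mol_cont c l k).comp (by fun_prop)
  have j2 : Integrable (fun t => wD c l Yd Qv * f t) :=
    hfli.integrable_smul_left_of_hasCompactSupport hc2 (refl_cs (wD_mol_cs c l k) x)
  have j3 : Integrable (fun t => wD c l Yd Qv * (a t * f t)) := by
    simp only [← mul_assoc]
    exact hfli.integrable_smul_left_of_hasCompactSupport (hc2.mul ha.continuous) (hac.mul_left)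
  rw [wD_mul (ha.differentiable Qy x) ((Mo_sm k hfli).differentiable Qy x), wD_Mo k hfli, Mo,
    ← integral_const_mul, ← integral_const_mul, ← integral_add (j1.const_mul _) (j2.const_mul _),
    ← integral_sub (by exact ((j1.const_mul _).add (j2.const_mul _))) j3]
  simp only [zero_mul, sub_zero]
  refine integral_congr_ae (Eventually.of_forall fun t => ?_)
  simp only []; ring
theorem friedrichs {ι : Type*} (s : Finset ι) (c : ℂ) (l : ι → Fin n) (b : ι → ℂ) (a f : ι → Qc) (h : Qc)
    (ha : ∀ i ∈ s, ContDiff ℝ (⊤:ℕ∞) (a i)) (hac : ∀ i ∈ s, HasCompactSupport (a i))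
    (hf : ∀ i ∈ s, MemLp Hl 2 volume) (hh : MemLp h 2 volume)
    (hw : ∀ η : Qa → ℂ, ContDiff ℝ (⊤:ℕ∞) η → HasCompactSupport η →
      ∑ i ∈ s, b i * ∫ t, wD c Tj η t * (a i t * f i t) = - ∫ t, η t * h t) :
    Tendsto (fun k => eLpNorm (fun x => (∑ i ∈ s, b i * wD c Tj Tw x) - h x) 2 volume)
      atTop Tf := by
  have key : ∀ k x, (∑ i ∈ s, b i * wD c Tj Tw x) - h x =
      (∑ i ∈ s, b i * (wD c Tj Tw x - ∫ t, wD c Tj Yd Qv * (a i t * f i t))) +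
      (Mo k h x - h x) := fun k x => by
    have := hw (fun t => mol k Qv) (refl_sm Hv x) (refl_cs (mol_cs k) x)
    simp only [wD_refl ((mol_sm k).differentiable Qy), neg_mul, integral_neg, mul_neg, Finset.sum_neg_distrib, neg_inj] at this
    simp only [mul_sub, Finset.sum_sub_distrib, this, Mo]; ring
  have li : ∀ i ∈ s, LocallyIntegrable Hl := fun i hi => (hf i hi).locallyIntegrable To
  have laf : ∀ i ∈ s, LocallyIntegrable (fun t => a i t * f i t) := fun i hi =>
    ((li i hi).integrable_smul_left_of_hasCompactSupport (ha i hi).continuous (hac i hi)).locallyIntegrable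
  have m1 : ∀ k, ∀ i ∈ s, AEStronglyMeasurable (fun x => b i * (wD c Tj Tw x -
      ∫ t, wD c Tj Yd Qv * (a i t * f i t))) volume := fun k i hi => by
    simp only [← wD_Mo k (laf i hi)]
    have c1 := (wD_contDiff ((ha i hi).mul (Mo_sm k (li i hi))) (c := c) (j := l i)).continuous
    have c2 := (wD_contDiff (Mo_sm k (laf i hi)) (c := c) (j := l i)).continuous
    exact (continuous_const.mul (c1.sub c2)).aestronglyMeasurable
  have m2 : ∀ k, AEStronglyMeasurable (fun x => Mo k h x - h x) volume := fun k =>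
    (Mo_sm k (hh.locallyIntegrable To)).continuous.aestronglyMeasurable.sub hh.1
  have t2 := sqn_tendsto (Mo_tendsto hh)
  have t1 : ∀ i ∈ s, Tendsto (fun k => eLpNorm (fun x => b i * (wD c Tj Tw x -
      ∫ t, wD c Tj Yd Qv * (a i t * f i t))) 2 volume) atTop Tf := fun i hi => by
    have := ENNReal.Tendsto.const_mul (a := ‖b i‖ₑ) (sqn_tendsto (comm_tendsto (ha i hi) (hac i hi) (hf i hi) c Tj)) (Or.inr Qy)
    rw [mul_zero] at this
    refine this.congr fun k => ?_
    rw [← eLpNorm_const_smul]; rfl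
  have t3 := (tendsto_finsetSum s t1).add t2
  simp only [Finset.sum_const_zero, add_zero] at t3
  refine tendsto_of_tendsto_of_tendsto_of_le_of_le tendsto_const_nhds t3 (fun _ => zero_le) fun k => ?_
  simp only [key k]
  refine (eLpNorm_add_le ?_ (m2 k) To).trans ?_
  · exact Finset.aestronglyMeasurable_fun_sum s (m1 k)
  · gcongr
    have := eLpNorm_sum_le (m1 k) (p := 2) To
    refine le_trans (le_of_eq ?_) this
    congr 1; funext x; simp
end moll2
section qlim
open scoped ENNReal Matrix
variable {n : ℕ} {ι : Type*} [Fintype ι]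
theorem bdd_memLp {B g : Qc} {C : ℝ} (hBm : AEStronglyMeasurable B volume) (hB : ∀ x, ‖B x‖ ≤ C)
    (hg : MemLp g 2 volume) : MemLp (fun x => B x * g x) 2 volume :=
  MemLp.of_le_mul (c := C) hg (hBm.mul hg.1) (Eventually.of_forall fun x => by
    rw [norm_mul]; gcongr; exact hB x)
theorem bil {B : Qc} {C : ℝ} (hBm : AEStronglyMeasurable B volume) (hB : ∀ x, ‖B x‖ ≤ C)
    {f g : ℕ → Qc} {f0 g0 : Qc} (hf : ∀ k, MemLp (f k) 2 volume) (hg : ∀ k, MemLp (g k) 2 volume)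
    (hf0 : MemLp f0 2 volume) (hg0 : MemLp g0 2 volume)
    (tf : Tendsto (fun k => eLpNorm (fun x => f k x - f0 x) 2 volume) atTop Tf)
    (tg : Tendsto (fun k => eLpNorm (fun x => g k x - g0 x) 2 volume) atTop Tf) :
    Tendsto (fun k => ∫ x, star (f k x) * (B x * g k x)) atTop (𝓝 (∫ x, star (f0 x) * (B x * g0 x))) := by
  have hBg : ∀ k, MemLp (fun x => B x * g k x) 2 volume := fun k => bdd_memLp hBm hB (hg k)
  have hBg0 := bdd_memLp hBm hB hg0
  have e : ∀ {a b : Qc} (ha : MemLp a 2 volume) (hb : MemLp b 2 volume),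
      ∫ x, star (a x) * b x = inner ℂ (ha.toLp a) (hb.toLp b) := fun ha hb => by
    rw [L2.inner_def]
    refine integral_congr_ae ?_
    filter_upwards [ha.coeFn_toLp, hb.coeFn_toLp] with x h1 h2
    rw [h1, h2]; simp [mul_comm]
  simp only [fun k => e (hf k) (hBg k), e hf0 hBg0]
  have t1 : Tendsto (fun k => (hf k).toLp (f k)) atTop (𝓝 (hf0.toLp f0)) :=
    (Lp.tendsto_Lp_iff_tendsto_eLpNorm'' _ hf _ hf0).2 tf
  have t2 : Tendsto (fun k => (hBg k).toLp _) atTop (𝓝 (hBg0.toLp _)) := by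
    refine (Lp.tendsto_Lp_iff_tendsto_eLpNorm'' _ hBg _ hBg0).2 ?_
    have := ENNReal.Tendsto.const_mul (a := ENNReal.ofReal C) tg (Or.inr Qy)
    rw [mul_zero] at this
    refine tendsto_of_tendsto_of_tendsto_of_le_of_le tendsto_const_nhds this (fun _ => zero_le) fun k => ?_
    refine eLpNorm_le_mul_eLpNorm_of_ae_le_mul (Eventually.of_forall fun x => ?_) 2
    simp only [Pi.sub_apply]
    rw [← mul_sub, norm_mul]; gcongr; exact hB x
  exact t1.inner t2
theorem ind_cont {S : Set Qa} (hS : IsCompact S) {a : Qc} (ha : ContinuousOn a S) :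
    AEStronglyMeasurable (S.indicator a) volume ∧ ∃ C, ∀ x, ‖S.indicator a x‖ ≤ C := by
  refine ⟨(aestronglyMeasurable_indicator_iff hS.measurableSet).2 (ha.aestronglyMeasurable hS.measurableSet), ?_⟩
  obtain ⟨C, hC⟩ := hS.exists_bound_of_continuousOn ha
  refine ⟨max C 0, fun x => ?_⟩
  by_cases hx : x ∈ S
  · rw [Set.indicator_of_mem hx]; exact (hC x hx).trans (le_max_left _ _)
  · rw [Set.indicator_of_notMem hx]; simp
theorem qf_expand (A : Matrix ι ι ℂ) (x : ι → ℂ) : qf A x = (∑ i, ∑ j, star (x i) * (A i j * x j)).re := by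
  simp only [qf, dotProduct, Matrix.mulVec, Pi.star_apply, Finset.mul_sum]
theorem qf_int {A : Qa → Matrix ι ι ℂ} {S Ω : Set Qa} (hS : IsCompact S) (hSΩ : S ⊆ Ω)
    (hA : ∀ i j, ContinuousOn Tr S) {F : ι → Qc} (hF : ∀ i, MemLp (F i) 2 volume)
    (hz : ∀ i, ∀ x ∉ S, F i x = 0) :
    Integrable (fun z => qf (A z) Yw) ∧ ∫ z in Ω, qf (A z) Yw =
      (∑ i, ∑ j, ∫ x, star (F i x) * (S.indicator Tr x * F j x)).re := by
  have hq : ∀ z, qf (A z) Yw = (∑ i, ∑ j, star (F i z) * (S.indicator Tr z * F j z)).re := fun z => by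
    rw [qf_expand]; congr 1
    refine scg fun i _ => scg fun j _ => ?_
    by_cases h : z ∈ S
    · rw [Set.indicator_of_mem h]
    · simp [hz i z h]
  have hi : ∀ i j, Integrable (fun z => star (F i z) * (S.indicator Tr z * F j z)) := fun i j => by
    obtain ⟨h1, C, h2⟩ := ind_cont hS (hA i j)
    exact (hF i).star.integrable_mul (bdd_memLp h1 h2 (hF j))
  have hs : Integrable (fun z => ∑ i, ∑ j, star (F i z) * (S.indicator Tr z * F j z)) :=
    integrable_finset_sum _ fun i _ => integrable_finset_sum _ fun j _ => hi i j
  refine ⟨?_, ?_⟩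
  · simp only [hq]; exact hs.re
  rw [setIntegral_eq_integral_of_forall_compl_eq_zero]
  · simp only [hq]
    have := integral_re hs
    simp only [RCLike.re_to_complex] at this
    rw [this, integral_finsetSum _ fun i _ => integrable_finset_sum _ fun j _ => hi i j]
    simp only [integral_finsetSum _ fun j _ => hi _ j]
  · intro z hz'
    have : Yw = 0 := by funext i; exact hz i z fun h => hz' (hSΩ h)
    simp [this, qf]
theorem qlim {A : Qa → Matrix ι ι ℂ} {S Ω : Set Qa} (hS : IsCompact S) (hSΩ : S ⊆ Ω)
    (hA : ∀ i j, ContinuousOn Tr S) {F : ℕ → ι → Qc} {F0 : ι → Qc}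
    (hF : ∀ k i, MemLp (F k i) 2 volume) (hF0 : ∀ i, MemLp (F0 i) 2 volume)
    (hz : ∀ᶠ k in atTop, ∀ i, ∀ x ∉ S, F k i x = 0) (hz0 : ∀ i, ∀ x ∉ S, F0 i x = 0)
    (ht : ∀ i, Tendsto (fun k => eLpNorm (fun x => F k i x - F0 i x) 2 volume) atTop Tf) :
    Tendsto (fun k => ∫ z in Ω, qf (A z) (fun i => F k i z)) atTop (𝓝 (∫ z in Ω, qf (A z) (fun i => F0 i z))) := by
  rw [(qf_int hS hSΩ hA hF0 hz0).2]
  have : Tendsto (fun k => (∑ i, ∑ j, ∫ x, star (F k i x) * (S.indicator Tr x * F k j x)).re) atTop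
      (𝓝 (∑ i, ∑ j, ∫ x, star (F0 i x) * (S.indicator Tr x * F0 j x)).re) := by
    refine (Complex.continuous_re.tendsto _).comp (tendsto_finsetSum _ fun i _ => tendsto_finsetSum _ fun j _ => ?_)
    obtain ⟨h1, C, h2⟩ := ind_cont hS (hA i j)
    exact bil h1 h2 (fun k => hF k i) (fun k => hF k j) (hF0 i) (hF0 j) (ht i) (ht j)
  refine this.congr' ?_
  filter_upwards [hz] with k hk
  rw [(qf_int hS hSΩ hA (hF k) hk).2]
end qlim
section hilb
open scoped ENNReal Matrix
variable {n : ℕ} {ι : Type*} [Fintype ι] [DecidableEq ι]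
section
open scoped Matrix.Norms.L2Operator MatrixOrder
theorem sqrt_field {Ω : Set Qa} {m : Qa → Matrix ι ι ℂ}
   (hm : ∀ i j, ContinuousOn Hd Ω) (hp : ∀ z ∈ Ω, (m z).PosSemidef) :
   ∃ σ : Qa → Matrix ι ι ℂ, (∀ i j, ContinuousOn Ue Ω) ∧ ∀ z ∈ Ω, (σ z).IsHermitian ∧ σ z * σ z = m z := by
  have hc : ContinuousOn m Ω := by
    refine continuousOn_pi.2 fun i => continuousOn_pi.2 fun j => hm i j
  refine ⟨fun z => CFC.sqrt Yf, fun i j => ?_, fun z hz => ⟨?_, CFC.sqrt_mul_sqrt_self _ (hp z hz).nonneg⟩⟩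
  · have : ContinuousOn (fun z => CFC.sqrt Yf) Ω :=
      CFC.continuousOn_sqrt.comp hc fun z hz => (hp z hz).nonneg
    exact (continuous_apply_apply i j).comp_continuousOn this
  · exact (Matrix.nonneg_iff_posSemidef.1 (CFC.sqrt_nonneg Yf)).1
end
def WL (Ω : Set Qa) (A : Qa → Matrix ι ι ℂ) (w : ι → Qc) : Prop :=
  (∀ i, AEStronglyMeasurable (w i) Qr) ∧ IntegrableOn (fun z => qf (A z) Hq) Ω
def emb (σ : Qa → Matrix ι ι ℂ) (w : ι → Qc) (z : Qa) : EuclideanSpace ℂ ι :=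
  WithLp.toLp 2 (σ z *ᵥ fun i => w i z)
variable {Ω : Set Qa} {A σ : Qa → Matrix ι ι ℂ} {w : ι → Qc}
theorem inner_toLp (a b : ι → ℂ) : inner ℂ (WithLp.toLp 2 a : EuclideanSpace ℂ ι) (WithLp.toLp 2 b) = star a ⬝ᵥ b := by
  rw [EuclideanSpace.inner_toLp_toLp, dotProduct_comm]
theorem norm_emb {z : Qa} (hσ : (σ z).IsHermitian ∧ σ z * σ z = A z) : ‖emb σ w z‖ ^ 2 = qf (A z) Hq := by
  rw [← inner_self_eq_norm_sq (𝕜 := ℂ), emb, inner_toLp, dot_herm hσ.1, Matrix.mulVec_mulVec, hσ.2]; rfl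
theorem emb_meas (hΩ : MeasurableSet Ω) (hc : ∀ i j, ContinuousOn Ue Ω)
    (hw : ∀ i, AEStronglyMeasurable (w i) Qr) : AEStronglyMeasurable (emb σ w) Qr := by
  refine (PiLp.continuous_toLp 2 (fun _ : ι => ℂ)).comp_aestronglyMeasurable ?_
  refine (aemeasurable_pi_lambda _ fun i => AEStronglyMeasurable.aemeasurable ?_).aestronglyMeasurable
  simp only [Matrix.mulVec, dotProduct]
  exact Finset.aestronglyMeasurable_fun_sum _ fun j _ => ((hc i j).aestronglyMeasurable hΩ).mul (hw j)
theorem emb_memLp (hΩ : MeasurableSet Ω) (hc : ∀ i j, ContinuousOn Ue Ω)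
    (hσ : ∀ z ∈ Ω, (σ z).IsHermitian ∧ σ z * σ z = A z) (hw : WL Ω A w) : MemLp (emb σ w) 2 Qr := by
  rw [memLp_two_iff_integrable_sq_norm (emb_meas hΩ hc hw.1)]
  refine hw.2.congr ?_
  filter_upwards [ae_restrict_mem hΩ] with z hz using (norm_emb (hσ z hz)).symm
theorem emb_normsq (hΩ : MeasurableSet Ω)
    (hσ : ∀ z ∈ Ω, (σ z).IsHermitian ∧ σ z * σ z = A z) (hw : MemLp (emb σ w) 2 Qr) :
    ‖hw.toLp _‖ ^ 2 = ∫ z in Ω, qf (A z) Hq := by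
  rw [← inner_self_eq_norm_sq (𝕜 := ℂ), L2.inner_def]
  have : ∫ a, inner ℂ ((hw.toLp (emb σ w)) a) ((hw.toLp (emb σ w)) a) ∂Qr =
     ((∫ z in Ω, qf (A z) Hq : ℝ) : ℂ) := by
    rw [← integral_complex_ofReal]
    refine integral_congr_ae ?_
    filter_upwards [hw.coeFn_toLp, ae_restrict_mem hΩ] with z h1 h2
    rw [h1, inner_self_eq_norm_sq_to_K]
    rw [← norm_emb (hσ z h2)]; simp
  rw [this]; simp
variable {m : Qa → Matrix ι ι ℂ}
theorem frame (hm : ∀ i j, ContinuousOn Hd Ω) (hmi : ∀ i j, ContinuousOn (fun z => Yf⁻¹ i j) Ω)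
    (hp : ∀ z ∈ Ω, (m z).PosDef) : ∃ σ τ : Qa → Matrix ι ι ℂ,
    (∀ i j, ContinuousOn Ue Ω) ∧ (∀ z ∈ Ω, (σ z).IsHermitian ∧ σ z * σ z = m z) ∧
    (∀ i j, ContinuousOn (fun z => τ z i j) Ω) ∧ (∀ z ∈ Ω, (τ z).IsHermitian ∧ τ z * τ z = Yf⁻¹) ∧
    ∀ z ∈ Ω, σ z * τ z = 1 ∧ τ z * σ z = 1 := by
  obtain ⟨σ, h1, h2⟩ := sqrt_field hm fun z hz => (hp z hz).posSemidef
  have hu : ∀ z ∈ Ω, IsUnit (σ z) := fun z hz => by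
    have := (hp z hz).isUnit
    rw [← (h2 z hz).2] at this
    exact isUnit_of_mul_isUnit_left this
  have hdu := fun z hz => (Matrix.isUnit_iff_isUnit_det _).1 (hu z hz)
  have e : ∀ z ∈ Ω, (σ z)⁻¹ * (σ z)⁻¹ = Yf⁻¹ := fun z hz => by rw [← Matrix.mul_inv_rev, (h2 z hz).2]
  refine ⟨σ, fun z => (σ z)⁻¹, h1, h2, fun i j => ?_, fun z hz => ⟨(h2 z hz).1.inv, e z hz⟩,
    fun z hz => ⟨Matrix.mul_nonsing_inv _ (hdu z hz), Matrix.nonsing_inv_mul _ (hdu z hz)⟩⟩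
  have : ContinuousOn (fun z => ∑ k, Yf⁻¹ i k * σ z k j) Ω := continuousOn_finset_sum _ fun k _ => (hmi i k).mul (h1 k j)
  refine this.congr fun z hz => ?_
  show (σ z)⁻¹ i j = (Yf⁻¹ * σ z) i j
  rw [← e z hz, mul_assoc, Matrix.nonsing_inv_mul _ (hdu z hz), mul_one]
theorem emb_inner (hΩ : MeasurableSet Ω) {σ τ : Qa → Matrix ι ι ℂ}
    (hσ : ∀ z ∈ Ω, (σ z).IsHermitian ∧ σ z * τ z = 1) {a b : ι → Qc}
    (ha : MemLp (emb σ a) 2 Qr) (hb : MemLp (emb τ b) 2 Qr) :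
    inner ℂ (ha.toLp _) (hb.toLp _) = ∫ z in Ω, star (fun i => a i z) ⬝ᵥ fun i => b i z := by
  rw [L2.inner_def]
  refine integral_congr_ae ?_
  filter_upwards [ha.coeFn_toLp, hb.coeFn_toLp, ae_restrict_mem hΩ] with z h1 h2 h3
  rw [h1, h2, emb, emb, inner_toLp, dot_herm (hσ z h3).1, Matrix.mulVec_mulVec, (hσ z h3).2, Matrix.one_mulVec]
theorem emb_surj (hΩ : MeasurableSet Ω) (hσc : ∀ i j, ContinuousOn Ue Ω) {τ : Qa → Matrix ι ι ℂ}
    {mi : Qa → Matrix ι ι ℂ}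
    (hτ : ∀ z ∈ Ω, ((τ z).IsHermitian ∧ τ z * τ z = mi z) ∧ τ z * σ z = 1) (W : Lp (EuclideanSpace ℂ ι) 2 Qr) :
    ∃ (y : ι → Qc), WL Ω mi y ∧ ∃ hy : MemLp (emb τ y) 2 Qr, hy.toLp _ = W := by
  set y : ι → Qc := fun i z => (σ z *ᵥ (WithLp.ofLp (W z))) i
  have e : ∀ z ∈ Ω, emb τ y z = W z := fun z hz => by
    simp only [emb, y]
    rw [Matrix.mulVec_mulVec, (hτ z hz).2, Matrix.one_mulVec]
  have ae : emb τ y =ᵐ[volume.restrict Ω] W := by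
    filter_upwards [ae_restrict_mem hΩ] with z hz using e z hz
  have hmem : MemLp (emb τ y) 2 Qr := (memLp_congr_ae ae).2 (Lp.memLp W)
  have hWm : ∀ i, AEStronglyMeasurable (fun z => (WithLp.ofLp (W z)) i) Qr := fun i =>
    (EuclideanSpace.proj i : EuclideanSpace ℂ ι →L[ℂ] ℂ).continuous.comp_aestronglyMeasurable (Lp.aestronglyMeasurable W)
  refine ⟨y, ⟨fun i => ?_, ?_⟩, hmem, ?_⟩
  · simp only [y, Matrix.mulVec, dotProduct]
    exact Finset.aestronglyMeasurable_fun_sum _ fun j _ => ((hσc i j).aestronglyMeasurable hΩ).mul (hWm j)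
  · have := (memLp_two_iff_integrable_sq_norm hmem.1).1 hmem
    refine this.congr ?_
    filter_upwards [ae_restrict_mem hΩ] with z hz using norm_emb (hτ z hz).1
  · refine Lp.ext (hmem.coeFn_toLp.trans ae)
theorem proj_lemma (hΩ : MeasurableSet Ω) (hm : ∀ i j, ContinuousOn Hd Ω) (hmi : ∀ i j, ContinuousOn (fun z => Yf⁻¹ i j) Ω)
    (hp : ∀ z ∈ Ω, (m z).PosDef) (S : Set (ι → Qc)) (hS : ∀ Y ∈ S, WL Ω m Y) {X : ι → Qc} (hX : WL Ω m X) :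
    ∃ y1, WL Ω Uf y1 ∧ (∀ Y ∈ S, ∫ z in Ω, star (fun i => Y i z) ⬝ᵥ (fun i => y1 i z) = 0) ∧
      ∀ y, WL Ω Uf y → (∀ Y ∈ S, ∫ z in Ω, star (fun i => Y i z) ⬝ᵥ Tm = 0) →
        ∫ z in Ω, star (fun i => X i z) ⬝ᵥ Tm =
        ∫ z in Ω, star (Yf⁻¹ *ᵥ fun i => y1 i z) ⬝ᵥ Tm := by
  obtain ⟨σ, τ, h1, h2, h3, h4, h5⟩ := frame hm hmi hp
  have mS := fun Y (hY : WL Ω m Y) => emb_memLp hΩ h1 h2 hY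
  have my := fun y (hy : WL Ω Uf y) => emb_memLp hΩ h3 h4 hy
  have inn := fun Y (hY : WL Ω m Y) y (hy : MemLp (emb τ y) 2 Qr) => emb_inner hΩ (fun z hz => ⟨(h2 z hz).1, (h5 z hz).1⟩) (mS Y hY) hy
  set K : Submodule ℂ (Lp (EuclideanSpace ℂ ι) 2 Qr) :=
    (Submodule.span ℂ {W | ∃ Y, ∃ hY : Y ∈ S, W = (mS Y (hS Y hY)).toLp _})ᗮ
  have hK : ∀ y (hy : MemLp (emb τ y) 2 Qr), hy.toLp _ ∈ K ↔
      ∀ Y ∈ S, ∫ z in Ω, star (fun i => Y i z) ⬝ᵥ Tm = 0 := fun y hy => by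
    constructor
    · intro h Y hY
      rw [← inn Y (hS Y hY) y hy]
      exact h _ (Submodule.subset_span ⟨Y, hY, rfl⟩)
    · intro h
      rw [Submodule.mem_orthogonal]
      intro u hu
      induction hu using Submodule.span_induction with
      | mem u hu => obtain ⟨Y, hY, rfl⟩ := hu; rw [inn Y (hS Y hY) y hy]; exact h Y hY
      | zero => simp
      | add a b _ _ ha hb => rw [inner_add_left, ha, hb, add_zero]
      | smul c a _ ha => rw [inner_smul_left, ha, mul_zero]
  obtain ⟨y1, w1, hy1, e1⟩ := emb_surj hΩ h1 (fun z hz => ⟨h4 z hz, (h5 z hz).2⟩) (K.starProjection ((mS X hX).toLp _))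
  refine ⟨y1, w1, (hK y1 hy1).1 (e1 ▸ Submodule.starProjection_apply_mem _ _), fun y hy hc => ?_⟩
  have hy' := (hK y (my y hy)).2 hc
  rw [← inn X hX y (my y hy)]
  have : inner ℂ ((mS X hX).toLp _) ((my y hy).toLp _) = inner ℂ (hy1.toLp _) ((my y hy).toLp _) := by
    rw [e1, ← sub_eq_zero, ← inner_sub_left]
    exact (Submodule.mem_orthogonal' _ _).1 (Submodule.sub_starProjection_mem_orthogonal _) _ hy'
  rw [this, L2.inner_def]
  refine integral_congr_ae ?_
  filter_upwards [hy1.coeFn_toLp, (my y hy).coeFn_toLp, ae_restrict_mem hΩ] with z k1 k2 k3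
  rw [k1, k2, emb, emb, inner_toLp, dot_herm (h4 z k3).1, Matrix.mulVec_mulVec, (h4 z k3).2,
    dot_herm (hp z k3).1.inv]
theorem riesz_wl (hΩ : MeasurableSet Ω) (hm : ∀ i j, ContinuousOn Hd Ω) (hmi : ∀ i j, ContinuousOn (fun z => Yf⁻¹ i j) Ω)
    (hp : ∀ z ∈ Ω, (m z).PosDef) {V : Type*} [AddCommGroup V] [Module ℂ V] (T : V →ₗ[ℂ] (ι → Qc))
    (hT : ∀ X, WL Ω m (T X)) (l : V →ₗ[ℂ] ℂ) (N : ℝ) (hN : 0 ≤ N)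
    (hb : ∀ X, ‖l X‖ ^ 2 ≤ N * ∫ z in Ω, qf Yf (fun i => T X i z)) :
    ∃ v, WL Ω Uf v ∧ (∫ z in Ω, qf Yf⁻¹ (fun i => v i z)) ≤ N ∧
      ∀ X, l X = ∫ z in Ω, star (fun i => v i z) ⬝ᵥ (fun i => T X i z) := by
  obtain ⟨σ, τ, h1, h2, h3, h4, h5⟩ := frame hm hmi hp
  have mS := fun X => emb_memLp hΩ h1 h2 (hT X)
  set U : V →ₗ[ℂ] Lp (EuclideanSpace ℂ ι) 2 Qr :=
    { toFun := fun X => (mS X).toLp _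
      map_add' := fun X Y => by
        rw [← MemLp.toLp_add]; congr 1; funext z
        simp only [emb, map_add, Pi.add_apply]
        rw [← WithLp.toLp_add, ← Matrix.mulVec_add]; rfl
      map_smul' := fun c X => by
        rw [RingHom.id_apply, ← MemLp.toLp_const_smul]; congr 1; funext z
        simp only [emb, map_smul, Pi.smul_apply]
        rw [← WithLp.toLp_smul, ← Matrix.mulVec_smul]; rfl }
  have hU : ∀ X, ‖l X‖ ≤ √N * ‖U X‖ := fun X => by
    refine abs_le_of_sq_le_sq' ?_ Qt |>.2
    rw [mul_pow, Real.sq_sqrt hN]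
    exact (hb X).trans (le_of_eq (by rw [← emb_normsq hΩ h2 (mS X)]; rfl))
  -- factor through the range
  have hker : LinearMap.ker U ≤ LinearMap.ker l := fun X hX => by
    rw [LinearMap.mem_ker] at hX ⊢
    have := hU X
    rw [hX] at this; simpa using this
  obtain ⟨l', hl'⟩ : ∃ l' : LinearMap.range U →ₗ[ℂ] ℂ, ∀ X, l' ⟨U X, X, rfl⟩ = l X := by
    refine ⟨((LinearMap.ker U).liftQ l hker).comp (U.quotKerEquivRange.symm.toLinearMap), fun X => ?_⟩
    have : U.quotKerEquivRange.symm ⟨U X, X, rfl⟩ = (LinearMap.ker U).mkQ X := by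
      rw [LinearEquiv.symm_apply_eq]; rfl
    simp only [LinearMap.comp_apply, LinearEquiv.coe_coe]
    rw [this]; simp
  set L : StrongDual ℂ (LinearMap.range U) := l'.mkContinuous (√N) (by rintro ⟨_, X, rfl⟩; rw [hl']; exact hU X)
  obtain ⟨G, hG1, hG2⟩ := exists_extension_norm_eq _ L
  set W := (InnerProductSpace.toDual ℂ _).symm G
  have hW : ‖W‖ ≤ √N := by
    rw [LinearIsometryEquiv.norm_map, hG2]; exact LinearMap.mkContinuous_norm_le _ Qt _
  obtain ⟨v, wv, hv, ev⟩ := emb_surj hΩ h1 (fun z hz => ⟨h4 z hz, (h5 z hz).2⟩) W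
  refine ⟨v, wv, ?_, fun X => ?_⟩
  · rw [← emb_normsq hΩ h4 hv, ev, ← Real.sq_sqrt hN]; gcongr
  · rw [← emb_inner hΩ (fun z hz => ⟨(h4 z hz).1, (h5 z hz).2⟩) hv (mS X), ev, InnerProductSpace.toDual_symm_apply]
    exact ((hG1 ⟨U X, X, rfl⟩).trans (hl' X)).symm
end hilb
section core
open scoped Matrix
variable {n r q : ℕ} {Ω : Set Qa} {Φ ψ : Qa → ℝ}
def LL (Ω : Set Qa) (w : Qc) : Prop := ∀ S, IsCompact S → S ⊆ Ω → MemLp (S.indicator w) 2 volume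
theorem LL.mul {a w : Qc} (ha : ContinuousOn a Ω) (hw : LL Ω w) : LL Ω (fun z => a z * w z) := fun S hS hSΩ => by
  obtain ⟨h1, C, h2⟩ := ind_cont hS (ha.mono hSΩ)
  convert bdd_memLp h1 h2 (hw S hS hSΩ) using 2 with z
  by_cases h : z ∈ S <;> simp [h]
theorem LL.sum {ι : Type*} (s : Finset ι) {w : ι → Qc} (hw : ∀ i ∈ s, LL Ω (w i)) : LL Ω (fun z => ∑ i ∈ s, w i z) := fun S hS hSΩ => by
  convert memLp_finsetSum s (fun i hi => hw i hi S hS hSΩ) using 2 with z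
  by_cases h : z ∈ S <;> simp [h]
theorem LL.test {a w : Qc} (ha : IsTest Ω a) (hw : LL Ω w) : MemLp (fun z => a z * w z) 2 volume := by
  convert (hw.mul ha.1.continuous.continuousOn) _ ha.2.1 ha.2.2 using 1
  funext z
  by_cases h : z ∈ tsupport a
  · simp [h]
  · simp [h, image_eq_zero_of_notMem_tsupport h]
theorem IsTest.memLp {a : Qc} (ha : IsTest Ω a) : MemLp a 2 volume :=
  ha.1.continuous.memLp_of_hasCompactSupport ha.2.1
theorem bdd_tendsto {a : Qc} (ha : IsTest Ω a) {f : ℕ → Qc}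
    (hf : Tendsto (fun k => eLpNorm (f k) 2 volume) atTop Tf) :
    Tendsto (fun k => eLpNorm (fun x => a x * f k x) 2 volume) atTop Tf := by
  obtain ⟨C, hC⟩ := ha.2.1.exists_bound_of_continuous ha.1.continuous
  have h2 : Tendsto (fun k => ENNReal.ofReal C * eLpNorm (f k) 2 volume) atTop Tf := by
    simpa using ENNReal.Tendsto.const_mul hf (Or.inr ENNReal.ofReal_ne_top)
  refine tendsto_of_tendsto_of_tendsto_of_le_of_le tendsto_const_nhds h2 (fun _ => zero_le) fun k => ?_
  refine eLpNorm_le_mul_eLpNorm_of_ae_le_mul (Eventually.of_forall fun x => ?_) _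
  rw [norm_mul]; gcongr; exact hC x
theorem sum_tendsto {ι : Type*} (s : Finset ι) {f : ι → ℕ → Qc} (hm : ∀ i ∈ s, ∀ k, AEStronglyMeasurable (f i k) volume)
    (hf : ∀ i ∈ s, Tendsto (fun k => eLpNorm (f i k) 2 volume) atTop Tf) :
    Tendsto (fun k => eLpNorm (fun x => ∑ i ∈ s, f i k x) 2 volume) atTop Tf := by
  have h2 : Tendsto (fun k => ∑ i ∈ s, eLpNorm (f i k) 2 volume) atTop Tf := by
    simpa using tendsto_finsetSum s hf
  refine tendsto_of_tendsto_of_tendsto_of_le_of_le tendsto_const_nhds h2 (fun _ => zero_le) fun k => ?_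
  have := eLpNorm_sum_le (fun i hi => hm i hi k) (p := 2) (μ := volume) To
  refine le_trans (le_of_eq ?_) this
  congr 1; funext x; simp
theorem test_cut (hΩ : IsOpen Ω) {K : Set Qa} (hK : IsCompact K) (hKΩ : K ⊆ Ω) :
    ∃ χ : Qa → ℝ, IsTest Ω (fun z => (χ z : ℂ)) ∧ (∀ z, 0 ≤ χ z ∧ χ z ≤ 1) ∧ ∀ z ∈ K, χ z = 1 := by
  obtain ⟨L, hL, h1, h2⟩ := exists_compact_between hK hΩ hKΩ
  obtain ⟨f, hf, hr, hs, he⟩ := exists_contMDiff_support_eq_eq_one_iff (modelWithCornersSelf ℝ Qa) (n := (⊤:ℕ∞)) isOpen_interior hK.isClosed h1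
  have hsub : tsupport Hc ⊆ L := by
    refine closure_minimal (fun z hz => interior_subset ?_) hL.isClosed
    rw [← hs]; simpa using hz
  refine ⟨f, ⟨?_, hL.of_isClosed_subset (isClosed_tsupport _) hsub, hsub.trans h2⟩, fun z => hr ⟨z, rfl⟩, fun z hz => (he z).1 hz⟩
  exact Complex.ofRealCLM.contDiff.comp hf.contDiff
theorem cont_of_sm {f : Qc} (h : Sm Ω f) : ContinuousOn f Ω := h.continuousOn
theorem exp_smul_tp_sm (hψ : Sm Ω ψ) {M : Qa → Fin q → Qb}
    (h : ∀ a i j, Sm Ω (fun z => M z a i j)) (J K) : Sm Ω (fun z => (Qi • tpm (M z)) J K) :=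
  ContDiffOn.mul (exp_sm hψ) (tpm_sm h J K)
theorem LL.int {a w : Qc} (ha : IsTest Ω a) (hw : LL Ω w) : Integrable (fun z => a z * w z) := by
  refine (MemLp.integrable_mul ha.memLp (hw _ ha.2.1 ha.2.2)).congr (Eventually.of_forall fun z => ?_)
  by_cases h : z ∈ tsupport a
  · simp [h]
  · simp [h, image_eq_zero_of_notMem_tsupport h]
theorem LL.set {a w : Qc} (ha : IsTest Ω a) : ∫ z in Ω, a z * w z = ∫ z, a z * w z :=
  setIntegral_eq_integral_of_forall_compl_eq_zero fun z hz => by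
    rw [image_eq_zero_of_notMem_tsupport fun h => hz (ha.2.2 h), zero_mul]
theorem weak_cut (hΩ : IsOpen Ω) {ι : Type*} (s : Finset ι) (b : ι → ℂ) (c : ℂ) (l : ι → Fin n) {w : ι → Qc}
    (hw : ∀ i ∈ s, LL Ω (w i)) {D : Qc} (hD : IsTest Ω D)
    (H : ∀ η, IsTest Ω η → ∫ z in Ω, ∑ i ∈ s, b i * (wD c Tj η z * w i z) = - ∫ z in Ω, η z * D z)
    {χ η : Qc} (hχ : IsTest Ω χ) (hη : ContDiff ℝ (⊤:ℕ∞) η) :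
    ∑ i ∈ s, b i * ∫ z, wD c Tj η z * (χ z * w i z) = - ∫ z, η z * (χ z * D z + ∑ i ∈ s, b i * (wD c Tj χ z * w i z)) := by
  have t1 : IsTest Ω (fun z => χ z * η z) := test_mulr hΩ hχ hη.contDiffOn
  have tA : ∀ l, IsTest Ω (fun z => χ z * wD c l η z) := fun l => test_mulr hΩ hχ (wD_contDiff hη).contDiffOn
  have tB : ∀ l, IsTest Ω (fun z => wD c l χ z * η z) := fun l => test_mulr hΩ (test_wD hχ) hη.contDiffOn
  have iA := fun i hi => LL.int (tA Tj) (hw i hi)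
  have iB := fun i hi => LL.int (tB Tj) (hw i hi)
  have h := H _ t1
  have e : ∀ z i, wD c Tj (fun z => χ z * η z) z * w i z = wD c Tj χ z * η z * w i z + χ z * wD c Tj η z * w i z := fun z i => by
    rw [wD_mul (hχ.1.differentiable Qy z) (hη.differentiable Qy z)]; ring
  simp only [e] at h
  rw [integral_finsetSum _ (f := fun i z => b i * (wD c Tj χ z * η z * w i z + χ z * wD c Tj η z * w i z))
    fun i hi => (((iB i hi).add (iA i hi)).const_mul (b i)).integrableOn, LL.set t1] at h
  have h2 : ∀ i ∈ s, ∫ z in Ω, b i * (wD c Tj χ z * η z * w i z + χ z * wD c Tj η z * w i z) =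
      b i * (∫ z, wD c Tj χ z * η z * w i z) + b i * ∫ z, χ z * wD c Tj η z * w i z := fun i hi => by
    rw [integral_const_mul, integral_add (iB i hi).integrableOn (iA i hi).integrableOn, LL.set (tA _), LL.set (tB _), mul_add]
  rw [Finset.sum_congr rfl h2, Finset.sum_add_distrib] at h
  have e2 : ∀ z, η z * (χ z * D z + ∑ i ∈ s, b i * (wD c Tj χ z * w i z)) =
      χ z * η z * D z + ∑ i ∈ s, b i * (wD c Tj χ z * η z * w i z) := fun z => by
    rw [mul_add, Finset.mul_sum]
    congr 1
    · ring
    · exact scg fun i _ => by ring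
  simp only [e2]
  rw [integral_add (test_mulr hΩ t1 hD.sm).integrable (integrable_finsetSum _ fun i hi => (iB i hi).const_mul (b i)),
    integral_finsetSum _ fun i hi => (iB i hi).const_mul (b i)]
  simp only [integral_const_mul]
  have e3 : ∀ i z, wD c Tj η z * (χ z * w i z) = χ z * wD c Tj η z * w i z := fun i z => by ring
  simp only [e3]
  linear_combination h
end core
section core
open scoped Matrix
variable {n r q : ℕ} {Ω : Set Qa} {Φ ψ : Qa → ℝ}
def rX (Φ ψ : Qa → ℝ) (y : Qo → Qc) (I : Fin q → Fin n) (z : Qa) : ℂ :=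
  Qj * (tp q Qn⁻¹ *ᵥ fun J => y J z) I
theorem rX_LL (hΩ : IsOpen Ω) (hΦ : Sm Ω Φ) (hψ : Sm Ω ψ) (hg : Qd)
    {y : Qo → Qc} (hL : ∀ I, LL Ω (y I)) (I) : LL Ω (rX Φ ψ y I) :=
  LL.mul (cont_of_sm (exp_sm hψ.neg)) (LL.sum _ fun J _ => (hL J).mul (tpm_sm Tq I J).continuousOn)
theorem alt_fun {F : Qo → ℂ} (M) : Alt F M = ∑ s : Equiv.Perm Tl, sg s * F (M ∘ s) := rfl
theorem bdd_memLp_int {a η f : Qc} {c l} (ha : IsTest Ω a) (hη : ContDiff ℝ (⊤:ℕ∞) η) (hf : MemLp f 2 volume) :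
    Integrable (fun z => wD c l η z * (a z * f z)) := by
  have := MemLp.integrable_mul (test_mulr isOpen_univ (ha.mono (Set.subset_univ _)) (wD_contDiff hη (c := c) (j := l)).contDiffOn).memLp hf
  refine this.congr (Eventually.of_forall fun z => ?_)
  simp; ring
set_option maxHeartbeats 1000000 in
theorem cutBI (hΩ : IsOpen Ω) (hΦ : Sm Ω Φ) (hψ : Sm Ω ψ) (hg : Qd)
    {y : Qp → Qc} (hL : ∀ I, LL Ω (y I)) (hA : ∀ z, Asym Qq)
    (hcl : ∀ M, ∀ η, IsTest Ω η → ∫ z in Ω, Alt Hf M = 0)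
    {D : Un → Qc} (hD : ∀ J, IsTest Ω (D J))
    (hw : ∀ J, ∀ η, IsTest Ω η → ∫ z in Ω, ∑ k, wDzbar k η z * rX Φ ψ y Qw z = - ∫ z in Ω, η z * D J z)
    {χ : Qc} (hχ : IsTest Ω χ) :
    ∫ z in Ω, Real.exp Tb * qf (tpm Ta) (fun I => χ z * rX Φ ψ y I z) ≤
      (∫ z in Ω, Real.exp Tb * qf Hh (fun J => χ z * D J z + ∑ k, wDzbar k χ z * rX Φ ψ y Qw z)) +
      ∫ z in Ω, Real.exp (-ψ z) * qf (tp Tg Qn⁻¹) (Alt (fun M => wDz Td χ z * y Qs z)) := by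
  obtain ⟨χ', hχ', -, hχ1⟩ := test_cut hΩ hχ.2.1 hχ.2.2
  have hmul : ∀ z, (χ' z : ℂ) * χ z = χ z := fun z => by
    by_cases h : z ∈ tsupport χ
    · simp [hχ1 z h]
    · simp [image_eq_zero_of_notMem_tsupport h]
  have gs := fun (I J : Fin Qm → Fin n) => ContDiffOn.mul (exp_sm hψ.neg) (tpm_sm (q := r+1) Tq I J)
  set a : Qp → Qp → Qc := fun I J z =>
    (χ' z : ℂ) * (((Real.exp (-ψ z) : ℝ) : ℂ) * tp Qm Qn⁻¹ I J)
  have ha : ∀ I J, IsTest Ω (a I J) := fun I J => test_mulr hΩ hχ' (gs I J)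
  set f : Qp → Qc := fun I z => χ z * y I z
  have hf : ∀ I, MemLp (f I) 2 volume := fun I => (hL I).test hχ
  have hfl : ∀ I, LocallyIntegrable (f I) := fun I => (hf I).locallyIntegrable To
  have hMo := fun k I => Mo_sm k (hfl I)
  set X : ℕ → Qp → Qc := fun k I z => ∑ J, a I J z * Mo k (f J) z
  have hX : ∀ k I, IsTest Ω (X k I) := fun k I => test_sum _ fun J _ => test_mulr hΩ (ha I J) (hMo k J).contDiffOn
  have hXe : ∀ k z, (fun I => X k I z) = fun I => (χ' z : ℂ) * (Qj * (tp Qm Qn⁻¹ *ᵥ fun J => Mo k (f J) z) I) := fun k z => by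
    funext I; simp only [X, a, Matrix.mulVec, dotProduct, Finset.mul_sum, mul_assoc]
  have hMA : ∀ k z, Asym (fun J => Mo k (f J) z) := fun k z s J => by
    simp only [Mo]
    rw [← integral_const_mul]
    congr 1; funext t
    simp only [f]; have := hA t s J; simp only at this; rw [this]; ring
  have hXA : ∀ k z, Asym (fun I => X k I z) := fun k z => by
    rw [hXe]
    exact ((tp_mulVec_asym _ (hMA k z)).mulc _).mulc _
  have hlow : ∀ k I, ∀ z ∈ Ω, low Φ ψ (X k) I z = χ' z * Mo k (f I) z := fun k I z hz => by
    rw [low, hXe]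
    have : (fun I => (χ' z : ℂ) * (Qj * (tp Qm Qn⁻¹ *ᵥ fun J => Mo k (f J) z) I)) =
       ((χ' z : ℂ) * Qj) • (tp Qm Qn⁻¹ *ᵥ fun J => Mo k (f J) z) := by
      funext I; simp [mul_assoc]
    rw [this, Matrix.mulVec_smul, Matrix.mulVec_mulVec, tp_inv' Tp, Matrix.one_mulVec]
    simp only [Pi.smul_apply, smul_eq_mul]
    have e : Qi * ((Real.exp (-ψ z) : ℝ) : ℂ) = 1 := by
      rw [← Complex.ofReal_mul, ← Real.exp_add]; simp
    linear_combination (χ' z * Mo k (f I) z) * e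
  -- limits
  have hXL := rX_LL hΩ hΦ hψ hg hL
  have haf : ∀ I z, ∑ J, a I J z * f J z = χ z * rX Φ ψ y I z := fun I z => by
    simp only [a, f, rX, Matrix.mulVec, dotProduct, Finset.mul_sum]
    refine scg fun J _ => ?_
    linear_combination (((Real.exp (-ψ z) : ℝ) : ℂ) * tp Qm Qn⁻¹ I J * y J z) * hmul z
  have L1 : ∀ I, Tendsto (fun k => eLpNorm (fun x => X k I x - χ x * rX Φ ψ y I x) 2 volume) atTop Tf := fun I => by
    have : ∀ k x, X k I x - χ x * rX Φ ψ y I x = ∑ J, a I J x * (Mo k (f J) x - f J x) := fun k x => by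
      rw [← haf]; simp only [X, mul_sub, Finset.sum_sub_distrib]
    simp only [this]
    exact sum_tendsto _ (fun J _ k => ((ha I J).1.continuous.aestronglyMeasurable).mul ((hMo k J).continuous.aestronglyMeasurable.sub (hf J).1))
      fun J _ => bdd_tendsto (ha I J) (sqn_tendsto (Mo_tendsto (hf J)))
  have hwt : ∀ {c l} {η : Qc}, ContDiff ℝ (⊤:ℕ∞) η → ∀ z, wD c l (fun z => χ z * η z) z = wD c l χ z * η z + χ z * wD c l η z :=
    fun hη z => wD_mul (hχ.1.differentiable Qy z) (hη.differentiable Qy z)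
  have L2 : ∀ J, Tendsto (fun k => eLpNorm (fun x => dX (X k) J x - (χ x * D J x + ∑ k, wDzbar k χ x * rX Φ ψ y Qw x)) 2 volume) atTop Tf := fun J => by
    have := friedrichs (Finset.univ : Finset (Fin n × Qp)) Complex.I Prod.fst (fun _ => 1)
      (fun i => a (Fin.cons i.1 J) i.2) (fun i => f i.2) (fun x => χ x * D J x + ∑ k, wDzbar k χ x * rX Φ ψ y Qw x)
      (fun i _ => (ha _ _).1) (fun i _ => (ha _ _).2.1) (fun i _ => hf _)
      ((test_mulr hΩ hχ (hD J).sm).memLp.add (memLp_finsetSum _ fun k _ => (hXL _).test (test_wD hχ))) ?_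
    · convert this using 5 with k x
      simp only [dX, X, one_mul, Fintype.sum_prod_type, wDzbar_eq]
      exact scg fun l _ => wD_sum _ fun K _ => ((test_mulr hΩ (ha _ K) (hMo k K).contDiffOn).1.differentiable Qy x)
    · intro η hη hηc
      have hc := weak_cut hΩ Finset.univ (fun _ => 1) Complex.I (fun k : Fin n => k) (fun k _ => hXL Qw) (hD J)
        (by simpa only [one_mul, wDzbar_eq] using hw J) hχ hη
      simp only [one_mul] at hc
      simp only [one_mul]
      rw [wDzbar_eq, ← hc, Fintype.sum_prod_type]
      refine scg fun l _ => ?_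
      rw [← integral_finsetSum _ fun K _ => ?_]
      · simp only [← Finset.mul_sum, haf]
      · exact (bdd_memLp_int (ha _ K) hη (hf K))
  have hm3 : ∀ M, MemLp (fun z => Alt (fun M => wDz Td χ z * y Qs z) M) 2 volume := fun M => by
    simp only [alt_fun, wDz_eq, Function.comp_apply]
    exact memLp_finsetSum (f := fun s x => sg s * (wD (-Complex.I) (M Hw) χ x * y (Fin.tail (M ∘ s)) x)) _
        fun s _ => ((hL _).test (test_wD hχ)).const_mul _
  have L3 : ∀ M, Tendsto (fun k => eLpNorm (fun x => (∑ s : Equiv.Perm (Fin Tg), sg s * wD (-Complex.I) (M Hw) (fun x => (χ' x : ℂ) * Mo k (f (Fin.tail (M ∘ s))) x) x)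
      - Alt (fun M => wDz Td χ x * y Qs x) M) 2 volume) atTop Tf := fun M => by
    have hm := hm3 M
    simp only [alt_fun, wDz_eq, Function.comp_apply] at hm ⊢
    refine friedrichs (Finset.univ : Finset (Equiv.Perm (Fin Tg))) (-Complex.I) (fun s => M Hw) sg
      (fun _ x => (χ' x : ℂ)) (fun s => f (Fin.tail (M ∘ s))) _
      (fun i _ => hχ'.1) (fun i _ => hχ'.2.1) (fun i _ => hf _) hm ?_
    · intro η hη hηc
      have hc := weak_cut hΩ Finset.univ sg (-Complex.I) (fun s : Equiv.Perm (Fin Tg) => M Hw) (fun s _ => hL (Fin.tail (M ∘ s))) test_zero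
        (fun η hη => by simpa [alt_fun, wDz_eq] using hcl M η hη) hχ hη
      simp only [mul_zero, zero_add] at hc
      rw [← hc]
      simp only [f, ← mul_assoc, hmul]
  set S := tsupport (fun z => (χ' z : ℂ))
  have hχS : tsupport χ ⊆ S := fun z hz => subset_tsupport _ (by simp [hχ1 z hz])
  have z0 : ∀ z ∉ S, (χ' z : ℂ) = 0 := fun z hz => image_eq_zero_of_notMem_tsupport (f := fun z => (χ' z : ℂ)) hz
  have z1 : ∀ z ∉ S, χ z = 0 := fun z hz => image_eq_zero_of_notMem_tsupport fun h => hz (hχS h)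
  have z2 : ∀ {c l}, ∀ z ∉ S, wD c l χ z = 0 := fun z hz => wD_zero_of_nmem fun h => hz (hχS h)
  have z3 : ∀ {c l} {F : Qc}, (∀ z ∉ S, F z = 0) → ∀ z ∉ S, wD c l F z = 0 := fun hF z hz =>
    wD_zero_of_nmem fun h => hz (closure_minimal (fun x hx => by by_contra h; exact hx (hF x h)) (isClosed_tsupport _) h)
  have z4 : ∀ k I, ∀ z ∉ S, X k I z = 0 := fun k I z hz => by simp [X, a, z0 z hz]
  have q1 := qlim (A := fun z => Qi • tpm Ta) hχ'.2.1 hχ'.2.2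
    (fun I J => ((exp_smul_tp_sm hψ (fun b i j => by
      refine Fin.cases ?_ (fun b => ?_) b
      · exact cHess_sm hΩ hψ i j
      · exact cHess_sm hΩ hΦ i j) I J).continuousOn.mono hχ'.2.2)) (fun k I => (hX k I).memLp) (fun I => (hXL I).test hχ)
    (Eventually.of_forall z4) (fun I z hz => by rw [z1 z hz, zero_mul]) L1
  have q2 := qlim (A := fun z => Qi • tp r Qn) hχ'.2.1 hχ'.2.2
    (fun I J => (exp_smul_tp_sm hψ (fun b i j => cHess_sm hΩ hΦ i j) I J).continuousOn.mono hχ'.2.2)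
    (fun k J => (test_dX (hX k) J).memLp)
    (fun J => (test_mulr hΩ hχ (hD J).sm).memLp.add (memLp_finsetSum _ fun k _ => (hXL _).test (test_wD hχ)))
    (Eventually.of_forall fun k J z hz => Finset.sum_eq_zero fun l _ => z3 (z4 k _) z hz)
    (fun J z hz => by simp [z1 z hz, wDzbar_eq, z2 z hz]) L2
  have q3 := qlim (A := fun z => ((Real.exp (-ψ z) : ℝ) : ℂ) • tp Tg Qn⁻¹) hχ'.2.1 hχ'.2.2
    (fun I J => (exp_smul_tp_sm hψ.neg (fun b i j => gi_sm hΩ hΦ hg i j) I J).continuousOn.mono hχ'.2.2)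
    (fun k M => (test_sum _ fun s _ => test_const_mul _ hΩ (test_wD (test_mulr hΩ hχ' (hMo k _).contDiffOn))).memLp)
    (fun M => hm3 M)
    (Eventually.of_forall fun k M z hz => Finset.sum_eq_zero fun s _ => by
      rw [z3 (fun z hz => by rw [z0 z hz, zero_mul]) z hz, mul_zero])
    (fun M z hz => by simp [alt_fun, wDz_eq, z2 z hz]) L3
  simp only [qf_smul] at q1 q2 q3
  refine le_of_tendsto_of_tendsto' q1 (q2.add q3) fun k => (BI hΩ hΦ hψ hg (hX k) (hXA k)).trans (le_of_eq ?_)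
  congr 1
  refine setIntegral_congr_fun hΩ.measurableSet fun z hz => ?_
  congr 2
  funext M
  rw [alt_fun]
  refine scg fun s _ => ?_
  rw [dY, wDz_eq, wD_congr_on hΩ hz (hlow k _)]; rfl
end core
section core
open scoped Matrix
variable {n r q : ℕ} {Ω : Set Qa} {Φ ψ : Qa → ℝ}
theorem qf_meas {ι : Type*} [Fintype ι] {A : Qa → Matrix ι ι ℂ} {F : ι → Qc} (hΩ : MeasurableSet Ω)
    (hA : ∀ i j, ContinuousOn Tr Ω) (hF : ∀ i, AEStronglyMeasurable (F i) Qr) :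
    AEStronglyMeasurable (fun z => qf (A z) Yw) Qr := by
  simp only [qf_expand]
  exact Complex.continuous_re.comp_aestronglyMeasurable (Finset.aestronglyMeasurable_fun_sum _ fun i _ =>
    Finset.aestronglyMeasurable_fun_sum _ fun j _ => (continuous_star.comp_aestronglyMeasurable (hF i)).mul
      (((hA i j).aestronglyMeasurable hΩ).mul (hF j)))
theorem star_alt_dot (w x : Qo → ℂ) : star Hk ⬝ᵥ x = star w ⬝ᵥ Alt x := by
  rw [← alt_star]; exact sum_alt_mul _ _
theorem alt_qf_le {M : Qb} (hM : M.PosSemidef) (w : Qo → ℂ) :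
    qf Uh Hk ≤ (q.factorial : ℝ)^2 * qf Uh w := by
  have hT : (tp q M).PosSemidef := tpm_psd fun _ => hM
  have h1 : (qf Uh Hk : ℂ) = q.factorial * (star w ⬝ᵥ tp q M *ᵥ Alt w) := by
    rw [← qf_eq hT, star_alt_dot, ← tp_mulVec_alt]
    have : Alt Hk = Qg • Alt w := funext fun J => (alt_asym w).alt J
    rw [this, Matrix.mulVec_smul, dotProduct_smul, smul_eq_mul]
  have h2 := qf_cs hT w Hk
  have h0 := qf_nonneg hT Hk
  have h3 : qf Uh Hk = q.factorial * ‖star w ⬝ᵥ tp q M *ᵥ Alt w‖ := by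
    have := congrArg norm h1
    rwa [Complex.norm_of_nonneg h0, norm_mul, Complex.norm_natCast] at this
  rcases h0.eq_or_lt with h | h
  · rw [← h]; have := qf_nonneg hT w; positivity
  · have : qf Uh Hk * qf Uh Hk ≤ ((q.factorial : ℝ)^2 * qf Uh w) * qf Uh Hk := by
      nth_rewrite 1 [h3]; nth_rewrite 1 [h3]; nlinarith [sq_nonneg (q.factorial : ℝ)]
    exact le_of_mul_le_mul_right this h
theorem tensor_dot (A : Qb) (c : Qa) (y : Qo → ℂ) :
    star (fun M : Fin Tc → Fin n => c Td * y Qs) ⬝ᵥ tp Tc A *ᵥ (fun M => c Td * y Qs) =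
      (star c ⬝ᵥ A *ᵥ c) * (star y ⬝ᵥ tp q A *ᵥ y) := by
  simp only [dotProduct, Matrix.mulVec, sum_cons (q := q), tp_cons, Pi.star_apply, Fin.cons_zero, Fin.tail_cons, star_mul']
  rw [Finset.sum_mul_sum]
  refine scg fun k _ => scg fun J _ => ?_
  rw [mul_mul_mul_comm, Finset.sum_mul_sum]
  congr 1
  exact scg fun l _ => scg fun K _ => by ring
theorem outer2 {g : Qb} (hg : g.PosDef) {b : Qa} {C : ℝ} (hC : 0 ≤ C)
    (hb : ∀ ξ : Qa, ‖∑ l, b l * ξ l‖^2 ≤ C * qf g ξ) (y : Qo → ℂ) :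
    qf (tp Tc g⁻¹) (fun M => star (b Td) * y Qs) ≤ C * qf (tp q g⁻¹) y := by
  have hi := hg.inv.posSemidef
  have hy := qf_nonneg (tpm_psd (q := q) fun _ => hi) y
  have e : qf (tp Tc g⁻¹) (fun M => star (b Td) * y Qs) = qf g⁻¹ (star b) * qf (tp q g⁻¹) y := by
    have := tensor_dot g⁻¹ (star b) y
    rw [qf_eq hi, qf_eq (tpm_psd fun _ => hi), qf_eq (M := tp q g⁻¹) (tpm_psd fun _ => hi)] at this
    exact_mod_cast this
  rw [e]
  refine mul_le_mul_of_nonneg_right ?_ hy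
  have h0 := qf_nonneg hi (star b)
  have h1 := hb (g⁻¹ *ᵥ star b)
  have h2 : ∑ l, b l * (g⁻¹ *ᵥ star b) l = (qf g⁻¹ (star b) : ℂ) := by
    rw [← qf_eq hi]; simp [dotProduct]
  have h3 : qf g (g⁻¹ *ᵥ star b) = qf g⁻¹ (star b) := by
    rw [qf, dot_herm hg.inv.1, Matrix.mulVec_mulVec, Matrix.mulVec_mulVec, Matrix.mul_assoc,
      Matrix.mul_nonsing_inv _ ((Matrix.isUnit_iff_isUnit_det _).1 hg.isUnit), Matrix.mul_one]; rfl
  rw [h2, h3, Complex.norm_of_nonneg h0] at h1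
  rcases h0.eq_or_lt with h | h
  · rwa [← h]
  · nlinarith
theorem outer1 {g : Qb} (hg : g.PosDef) {b : Qa} {C : ℝ}
    (hb : ∀ ξ : Qa, ‖∑ l, b l * ξ l‖^2 ≤ C * qf g ξ) (X : Qp → ℂ) :
    qf (tp r g) (fun J => ∑ k, b k * X Qw) ≤ C * qf (tp Qm g) X := by
  set B := Matrix.vecMulVec (star b) b
  have e1 : qf (tp r g) (fun J => ∑ k, b k * X Qw) = qf (tpm (Fin.cons B fun _ => g)) X := by
    simp only [qf_expand, sum_cons (q := r), tpm_cons, B, Matrix.vecMulVec_apply]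
    congr 1
    rw [Finset.sum_comm (s := (Finset.univ : Finset Yk))]
    refine scg fun J _ => ?_
    refine Eq.trans ?_ ((scg fun k _ => Finset.sum_comm).trans Finset.sum_comm).symm
    refine scg fun K _ => ?_
    rw [star_sum, Finset.mul_sum, Finset.sum_mul_sum]
    refine scg fun k _ => scg fun l _ => ?_
    simp only [star_mul', Pi.star_apply]; ring
  have hBp : B.PosSemidef := Matrix.posSemidef_vecMulVec_star_self b
  have hB : ((C:ℂ) • g - B).PosSemidef := by
    refine .of_dotProduct_mulVec_nonneg ?_ fun x => ?_
    · refine Matrix.IsHermitian.sub ?_ hBp.1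
      rw [Matrix.IsHermitian, Matrix.conjTranspose_smul, hg.1]; simp
    · have : star x ⬝ᵥ B *ᵥ x = ((‖∑ l, b l * x l‖^2 : ℝ) : ℂ) := by
        rw [Complex.ofReal_pow, ← Complex.conj_mul', map_sum, Finset.sum_mul_sum]
        simp only [dotProduct, Matrix.mulVec, Finset.mul_sum, B, Matrix.vecMulVec_apply]
        refine scg fun k _ => scg fun l _ => ?_
        simp; ring
      rw [Matrix.sub_mulVec, dotProduct_sub, this, Matrix.smul_mulVec, dotProduct_smul, qf_eq hg.posSemidef, smul_eq_mul,
        ← Complex.ofReal_mul, ← Complex.ofReal_sub]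
      exact_mod_cast sub_nonneg.2 (hb x)
  have e2 : tpm (Fin.cons ((C:ℂ) • g) fun _ => g) = (C:ℂ) • tp Qm g := by
    ext I J
    obtain ⟨k, I, rfl⟩ : ∃ k I', I = Fin.cons k I' := ⟨_, _, (Fin.cons_self_tail I).symm⟩
    obtain ⟨l, J, rfl⟩ : ∃ k I', J = Fin.cons k I' := ⟨_, _, (Fin.cons_self_tail J).symm⟩
    rw [tpm_cons, Matrix.smul_apply, Matrix.smul_apply, tp_cons, smul_eq_mul, smul_eq_mul, mul_assoc]
  rw [e1, ← qf_smul, ← e2]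
  refine qf_mono (tpm_mono (fun a => ?_) fun a => ?_) X
  · refine Fin.cases ?_ (fun a => ?_) a
    · exact hBp
    · exact hg.posSemidef
  · refine Fin.cases ?_ (fun a => ?_) a
    · exact hB
    · simp [Matrix.PosSemidef.zero]
end core
section core
open scoped Matrix
variable {n r q : ℕ} {Ω : Set Qa} {Φ ψ : Qa → ℝ}
theorem rX_vec (Φ ψ : Qa → ℝ) (y : Qo → Qc) (z : Qa) :
    Qu = Qj • (tp q Qn⁻¹ *ᵥ fun J => y J z) := rfl
theorem rX_norm {z : Qa} (hg : (cHess Φ z).PosDef) (y : Qo → Qc) :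
    Real.exp Tb * qf (tp q Qn) Qu = Real.exp (-ψ z) * qf (tp q Qn⁻¹) Qq := by
  rw [rX_vec, qf_smul_vec, Complex.norm_of_nonneg (Real.exp_pos _).le]
  have : qf (tp q Qn) (tp q Qn⁻¹ *ᵥ fun J => y J z) = qf (tp q Qn⁻¹) Qq := by
    rw [qf, dot_herm (tp_posDef hg.inv).1, Matrix.mulVec_mulVec, tp_inv hg, Matrix.one_mulVec]; rfl
  rw [this, sq, ← mul_assoc, ← mul_assoc, ← Real.exp_add]; simp
structure Cut (Ω : Set Qa) (g : Qa → Qb) (C : ℝ) (χ : ℕ → Qa → ℝ) : Prop where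
  hC : 0 ≤ C
  test : ∀ j, IsTest Ω Yc
  one : ∀ z ∈ Ω, ∀ᶠ j in atTop, ∀ᶠ x in 𝓝 z, χ j x = 1
  le : ∀ j, ∀ z ∈ Ω, |χ j z| ≤ 1
  grad : ∀ j, ∀ z ∈ Ω, ∀ ξ : Qa, ‖∑ l, wDzbar l Yc z * ξ l‖^2 ≤ C * qf (g z) ξ
theorem energy (hΩ : IsOpen Ω) (hΦ : Sm Ω Φ) (hψ : Sm Ω ψ) (hg : Qd)
    {y : Qp → Qc} (hL : ∀ I, LL Ω (y I)) (hA : ∀ z, Asym Qq)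
    (hcl : ∀ M, ∀ η, IsTest Ω η → ∫ z in Ω, Alt Hf M = 0)
    {D : Un → Qc} (hD : ∀ J, IsTest Ω (D J))
    (hw : ∀ J, ∀ η, IsTest Ω η → ∫ z in Ω, ∑ k, wDzbar k η z * rX Φ ψ y Qw z = - ∫ z in Ω, η z * D J z)
    (hm : ∀ I, AEStronglyMeasurable (y I) Qr)
    (hy : IntegrableOn Uj Ω)
    {g : Qa → Qb} (hgc : ∀ i j, ContinuousOn (fun z => g z i j) Ω)
    (hg0 : ∀ z ∈ Ω, (g z).PosSemidef) (hg1 : ∀ z ∈ Ω, (cHess Φ z - g z).PosSemidef) (hg2 : ∀ z ∈ Ω, (cHess ψ z - g z).PosSemidef)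
    {C : ℝ} {χ : ℕ → Qa → ℝ} (hχ : Cut Ω Tk C χ) :
    IntegrableOn (fun z => Real.exp Tb * qf Ye Qu) Ω ∧
    ∫ z in Ω, Real.exp Tb * qf Ye Qu ≤
      ∫ z in Ω, Real.exp Tb * qf Hh Hr := by
  have hΩm := hΩ.measurableSet
  have hec : ContinuousOn (fun z => Real.exp Tb) Ω := hψ.continuousOn.rexp
  have hec' : ContinuousOn (fun z => Real.exp (-ψ z)) Ω := hψ.continuousOn.neg.rexp
  have gc := fun i j => cont_of_sm (cHess_sm hΩ hΦ i j)
  have tc : ∀ {q : ℕ} (I J : Fin q → Fin n), ContinuousOn (fun z => tp q Qn I J) Ω := fun I J => (tp_sm hΩ hΦ I J).continuousOn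
  have tic : ∀ {q : ℕ} (I J : Fin q → Fin n), ContinuousOn (fun z => tp q Qn⁻¹ I J) Ω := fun I J =>
    (tpm_sm Tq I J).continuousOn
  have tgc : ∀ (I J : Fin Qm → Fin n), ContinuousOn (fun z => tp Qm (g z) I J) Ω := fun I J => by
    simp only [tp, tpm, Matrix.of_apply]; exact continuousOn_finsetProd _ fun a _ => hgc _ _
  have hmX : ∀ I, AEStronglyMeasurable (rX Φ ψ y I) Qr := fun I =>
    ((Complex.continuous_ofReal.comp_continuousOn hec').aestronglyMeasurable hΩm).mul
      (Finset.aestronglyMeasurable_fun_sum _ fun J _ => ((tic I J).aestronglyMeasurable hΩm).mul (hm J))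
  have hcx : ∀ j, AEStronglyMeasurable Yc Qr := fun j => (hχ.test j).1.continuous.aestronglyMeasurable
  have hcd : ∀ j c l, AEStronglyMeasurable (wD c l fun z => Qh) Qr := fun j c l =>
    (wD_contDiff (hχ.test j).1).continuous.aestronglyMeasurable
  -- dominating functions
  set N := fun z => Real.exp (-ψ z) * qf Tu Qq
  have hN : ∀ z ∈ Ω, N z = Real.exp Tb * qf (tp Qm Qn) Qu := fun z hz => (rX_norm Tp y).symm
  have hiD : IntegrableOn (fun z => Real.exp Tb * qf Hh Hr) Ω := by
    have t := test_qf hΩ (M := fun z => Qi • tp r Qn) (fun I J => exp_smul_tp_sm hψ (fun _ i j => cHess_sm hΩ hΦ i j) I J)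
      (fun J => (hD J).sm) hD
    have := t.integrable.re.integrableOn (s := Ω)
    refine this.congr (Eventually.of_forall fun z => ?_)
    simp only; rw [← qf_smul]; rfl
  have hpt : ∀ z ∈ Ω, Real.exp Tb * qf Ye Qu ≤ N z := fun z hz => by
    rw [hN z hz]
    exact mul_le_mul_of_nonneg_left (qf_mono (tpm_mono (fun _ => hg0 z hz) (fun _ => hg1 z hz)) _) (Real.exp_pos _).le
  have hp0 : ∀ z ∈ Ω, 0 ≤ Real.exp Tb * qf Ye Qu := fun z hz =>
    mul_nonneg (Real.exp_pos _).le (qf_nonneg (tpm_psd fun _ => hg0 z hz) _)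
  have hmQ : AEStronglyMeasurable (fun z => Real.exp Tb * qf Ye Qu) Qr :=
    (hec.aestronglyMeasurable hΩm).mul (qf_meas hΩm tgc hmX)
  have hiQ : IntegrableOn (fun z => Real.exp Tb * qf Ye Qu) Ω := by
    refine Integrable.mono' hy hmQ ?_
    filter_upwards [ae_restrict_mem hΩm] with z hz
    rw [Real.norm_of_nonneg (hp0 z hz)]; exact hpt z hz
  refine ⟨hiQ, ?_⟩
  -- three limits
  have T1 : Tendsto (fun j => ∫ z in Ω, (χ j z)^2 * (Real.exp Tb * qf Ye Qu)) atTop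
      (𝓝 (∫ z in Ω, Real.exp Tb * qf Ye Qu)) := by
    refine tendsto_integral_of_dominated_convergence N (fun j => ?_) hy (fun j => ?_) ?_
    · have : AEStronglyMeasurable (χ j) Qr := (Complex.continuous_re.comp_aestronglyMeasurable (hcx j))
      exact (this.pow 2).mul hmQ
    · filter_upwards [ae_restrict_mem hΩm] with z hz
      rw [norm_mul, Real.norm_of_nonneg (hp0 z hz), norm_pow, Real.norm_eq_abs]
      refine le_trans ?_ (hpt z hz)
      exact mul_le_of_le_one_left (hp0 z hz) (pow_le_one₀ (abs_nonneg _) (hχ.le j z hz))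
    · filter_upwards [ae_restrict_mem hΩm] with z hz
      refine tendsto_const_nhds.congr' ?_
      filter_upwards [hχ.one z hz] with j hj
      rw [hj.self_of_nhds]; simp
  have gz : ∀ z ∈ Ω, ∀ᶠ j in atTop, ∀ c l, wD c l Yc z = 0 := fun z hz => by
    filter_upwards [hχ.one z hz] with j hj c l
    rw [wD_congr (g := fun _ => 1) (by filter_upwards [hj] with x hx; simp [hx]), wD_const]
  have T2 : Tendsto (fun j => ∫ z in Ω, Real.exp Tb * qf Hh (fun J => χ j z * D J z + ∑ k, wDzbar k Yc z * rX Φ ψ y Qw z)) atTop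
      (𝓝 (∫ z in Ω, Real.exp Tb * qf Hh Hr)) := by
    refine tendsto_integral_of_dominated_convergence (fun z => 2 * (Real.exp Tb * qf Hh Hr) + 2 * C * N z)
      (fun j => ?_) ((hiD.const_mul 2).add (hy.const_mul (2*C))) (fun j => ?_) ?_
    · exact (hec.aestronglyMeasurable hΩm).mul (qf_meas hΩm tc fun J => ((hcx j).mul (hD J).1.continuous.aestronglyMeasurable).add
        (Finset.aestronglyMeasurable_fun_sum _ fun k _ => (hcd j _ k).mul (hmX _)))
    · filter_upwards [ae_restrict_mem hΩm] with z hz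
      have hP : (tp r Qn).PosSemidef := tpm_psd fun _ => (hg z hz).posSemidef
      rw [Real.norm_of_nonneg (mul_nonneg (Real.exp_pos _).le (qf_nonneg hP _)), hN z hz]
      have h1 := qf_add_le hP (Qh • fun J => D J z) (fun J => ∑ k, wDzbar k Yc z * rX Φ ψ y Qw z)
      have h2 := outer1 Tp (hχ.grad j z hz) Qu
      rw [qf_smul_vec] at h1
      have h3 : ‖Qh‖^2 ≤ 1 := by
        rw [Complex.norm_real]; exact pow_le_one₀ (abs_nonneg _) (hχ.le j z hz)
      have h4 := mul_le_of_le_one_left (qf_nonneg hP Hr) h3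
      have h5 : qf Hh (fun J => χ j z * D J z + ∑ k, wDzbar k Yc z * rX Φ ψ y Qw z) ≤
        2 * qf Hh Hr + 2 * (C * qf (tp Qm Qn) Qu) :=
        h1.trans Yr
      have := mul_le_mul_of_nonneg_left h5 (Real.exp_pos Tb).le
      linarith
    · filter_upwards [ae_restrict_mem hΩm] with z hz
      refine tendsto_const_nhds.congr' ?_
      filter_upwards [hχ.one z hz, gz z hz] with j hj hj'
      rw [hj.self_of_nhds]; simp [wDzbar_eq, hj']
  have T3 : Tendsto (fun j => ∫ z in Ω, Real.exp (-ψ z) * qf (tp Tg Qn⁻¹) (Alt (fun M => wDz Td Yc z * y Qs z))) atTop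
      (𝓝 (∫ z in Ω, (0:ℝ))) := by
    refine tendsto_integral_of_dominated_convergence (fun z => ((r+2).factorial : ℝ)^2 * (C * N z))
      (fun j => ?_) ((hy.const_mul C).const_mul _) (fun j => ?_) ?_
    · refine (hec'.aestronglyMeasurable hΩm).mul (qf_meas (F := fun M z => Alt (fun M => wDz Td Yc z * y Qs z) M) hΩm tic fun M => ?_)
      simp only [alt_fun, wDz_eq]
      exact Finset.aestronglyMeasurable_fun_sum _ fun s _ => aestronglyMeasurable_const.mul ((hcd j _ _).mul (hm _))
    · filter_upwards [ae_restrict_mem hΩm] with z hz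
      have hi := (hg z hz).inv.posSemidef
      rw [Real.norm_of_nonneg (mul_nonneg (Real.exp_pos _).le (qf_nonneg (tpm_psd fun _ => hi) _))]
      have h1 := alt_qf_le hi (fun M : Fin Tg → Fin n => wDz Td Yc z * y Qs z)
      have e : ∀ l, wDz l Yc z = star (wDzbar l Yc z) := fun l => by
        have := wD_star (c := -Complex.I) (j := l) (f := fun z => Qh) (z := z)
        rw [wDz_eq, wDzbar_eq]; simpa using this
      have h2 := outer2 Tp hχ.hC (hχ.grad j z hz) Qq
      simp only [← e] at h2
      have h3 := h1.trans (mul_le_mul_of_nonneg_left h2 Qt)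
      have := mul_le_mul_of_nonneg_left h3 (Real.exp_pos (-ψ z)).le
      refine this.trans (le_of_eq ?_)
      simp only [N]; ring
    · filter_upwards [ae_restrict_mem hΩm] with z hz
      refine tendsto_const_nhds.congr' ?_
      filter_upwards [gz z hz] with j hj'
      simp only [wDz_eq, hj', zero_mul]
      have : Alt (fun _ : Fin Tg → Fin n => (0:ℂ)) = 0 := by funext M; simp [Alt]
      rw [this]; simp [qf]
  have := T2.add T3
  simp only [integral_zero, add_zero] at this
  refine le_of_tendsto_of_tendsto' T1 this fun j => le_trans ?_ (cutBI hΩ hΦ hψ hg hL hA hcl hD hw (hχ.test j))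
  have hXL := rX_LL hΩ hΦ hψ hg hL
  have hI := (qf_int (A := fun z => Qi • tpm Ta) (hχ.test j).2.1 (hχ.test j).2.2
    (fun I J => ((exp_smul_tp_sm hψ (fun b i j => by
      refine Fin.cases ?_ (fun b => ?_) b
      · exact cHess_sm hΩ hψ i j
      · exact cHess_sm hΩ hΦ i j) I J).continuousOn.mono (hχ.test j).2.2)) (fun I => (hXL I).test (hχ.test j))
    (fun I x hx => by rw [image_eq_zero_of_notMem_tsupport (f := fun z => Qh) hx, zero_mul])).1
  simp only [qf_smul] at hI
  refine integral_mono_of_nonneg ?_ hI.integrableOn ?_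
  · filter_upwards [ae_restrict_mem hΩm] with z hz using mul_nonneg (sq_nonneg _) (hp0 z hz)
  · filter_upwards [ae_restrict_mem hΩm] with z hz
    have h1 := qf_smul_vec (tpm Ta) Qh (fun I : Fin Qm → Fin n => rX Φ ψ y I z)
    have h2 : qf Ye Qu ≤ qf (tpm Ta) Qu := by
      refine qf_mono (tpm_mono (fun _ => hg0 z hz) fun a => ?_) _
      refine Fin.cases ?_ (fun a => ?_) a
      · exact hg2 z hz
      · exact hg1 z hz
    show _ ≤ Real.exp Tb * qf _ (Qh • fun I : Fin Qm → Fin n => rX Φ ψ y I z)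
    rw [h1, Complex.norm_real, Real.norm_eq_abs, sq_abs]
    have := mul_le_mul_of_nonneg_left h2 (mul_nonneg (sq_nonneg (χ j z)) (Real.exp_pos Tb).le)
    linarith
end core
section core2
open scoped Matrix
variable {n r q : ℕ} {Ω : Set Qa} {Φ ψ : Qa → ℝ}
theorem alt_comp (F : Qo → ℂ) (t : Equiv.Perm Tl) (I) : Alt (fun M => F (M ∘ t)) I = sg t * Alt F I := by
  unfold Alt
  rw [Finset.mul_sum, ← Equiv.sum_comp (Equiv.mulRight t⁻¹)]
  refine scg fun s _ => ?_
  simp only [Equiv.coe_mulRight, sg_mul, sg_inv]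
  have : (I ∘ ⇑(s * t⁻¹)) ∘ t = I ∘ s := by funext a; simp
  rw [this]; ring
theorem alt_alt (b : Qa) (w : Qo → ℂ) (I : Fin Tc → Fin n) :
    Alt (fun M => b Td * Alt w Qs) I = Qg * Alt Ym I := by
  have h : ∀ s : Equiv.Perm Tl, Alt (fun M => b Td * w (Fin.tail M ∘ s)) I = sg s * Alt Ym I := fun s => by
    have h1 := alt_comp Ym Yq I
    have h2 : sg Yq = sg s := by
      simp only [sg, Equiv.Perm.decomposeFin.symm_sign]; simp
    rw [h2] at h1; rw [← h1]; congr 1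
  have e : (fun M : Fin Tc → Fin n => b Td * Alt w Qs) = fun M => ∑ s : Equiv.Perm Tl, (b Td * w (Fin.tail M ∘ s)) * sg s := by
    funext M; unfold Alt; rw [Finset.mul_sum]; exact scg fun s _ => by ring
  rw [e, alt_sum]
  simp only [alt_mulc, h]
  rw [scg fun s _ => show sg s * Alt Ym I * sg s = Alt Ym I by
    linear_combination (Alt Ym I) * sg_sq s]
  simp [Finset.card_univ, Fintype.card_perm]
def mW (Φ ψ : Qa → ℝ) (q : ℕ) (z : Qa) : Matrix Qo Qo ℂ := Qi • tp q Qn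
theorem mW_pd {z} (hg : (cHess Φ z).PosDef) : (mW Φ ψ q z).PosDef :=
  (tp_posDef hg).smul (by rw [Complex.zero_lt_real]; exact Real.exp_pos _)
theorem mW_inv {z} (hg : (cHess Φ z).PosDef) : (mW Φ ψ q z)⁻¹ = ((Real.exp (-ψ z) : ℝ) : ℂ) • tp q Qn⁻¹ := by
  refine Matrix.inv_eq_left_inv ?_
  rw [mW, Matrix.smul_mul, Matrix.mul_smul, tp_inv hg, smul_smul, ← Complex.ofReal_mul, ← Real.exp_add]; simp
theorem mW_sm (hΩ : IsOpen Ω) (hΦ : Sm Ω Φ) (hψ : Sm Ω ψ) (I J) : Sm Ω (fun z => mW Φ ψ q z I J) :=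
  exp_smul_tp_sm hψ (fun _ i j => cHess_sm hΩ hΦ i j) I J
theorem mWi_cont (hΩ : IsOpen Ω) (hΦ : Sm Ω Φ) (hψ : Sm Ω ψ) (hg : Qd) (I J) :
    ContinuousOn (fun z => (mW Φ ψ q z)⁻¹ I J) Ω :=
  (cont_of_sm (exp_smul_tp_sm hψ.neg Tq I J)).congr fun z hz => by simp only [mW_inv Tp]
theorem rX_mW {z} (hg : (cHess Φ z).PosDef) (y : Qo → Qc) :
    (mW Φ ψ q z)⁻¹ *ᵥ Qq = fun I => rX Φ ψ y I z := by
  rw [mW_inv hg, Matrix.smul_mulVec]; rfl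
theorem WL.test {ι : Type*} [Fintype ι] {m : Qa → Matrix ι ι ℂ} (hΩ : IsOpen Ω) (hm : ∀ i j, Sm Ω Hd) {X : ι → Qc} (hX : ∀ i, IsTest Ω (X i)) : WL Ω m X :=
  ⟨fun i => (hX i).1.continuous.aestronglyMeasurable, (test_qf hΩ hm (fun i => (hX i).sm) hX).integrable.re.integrableOn⟩
theorem WL.ll {ι : Type*} [Fintype ι] [DecidableEq ι] {m : Qa → Matrix ι ι ℂ} (hm : ∀ i j, ContinuousOn Hd Ω) (hp : ∀ z ∈ Ω, (m z).PosDef)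
    {w : ι → Qc} (hw : WL Ω Uf w) (i) : LL Ω (w i) := fun S hS hSΩ => by
  obtain ⟨C, hC⟩ := hS.exists_bound_of_continuousOn ((hm i i).mono hSΩ)
  have hmS : AEStronglyMeasurable (w i) (volume.restrict S) := (hw.1 i).mono_measure (Measure.restrict_mono hSΩ le_rfl)
  rw [memLp_indicator_iff_restrict hS.measurableSet, memLp_two_iff_integrable_sq_norm hmS]
  refine Integrable.mono' (((hw.2.mono_set hSΩ).const_mul C)) (hmS.norm.pow 2) ?_
  filter_upwards [ae_restrict_mem hS.measurableSet] with z hz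
  have h1 := qf_cs_inv (hp z (hSΩ hz)) Hq (Pi.single i 1)
  have h2 : qf Yf (Pi.single i 1) = (m z i i).re := by simp [qf, Pi.star_single]
  have h3 : ‖star Hq ⬝ᵥ Pi.single i 1‖ = ‖w i z‖ := by simp
  rw [h2, h3] at h1
  have h4 := (Complex.re_le_norm _).trans (hC z hz)
  rw [Real.norm_of_nonneg Qt]
  refine h1.trans ?_
  rw [mul_comm]
  exact mul_le_mul_of_nonneg_right h4 (qf_nonneg (hp z (hSΩ hz)).inv.posSemidef _)
def CL (Ω : Set Qa) (y : Qo → Qc) : Prop :=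
  ∀ M, ∀ η, IsTest Ω η → ∫ z in Ω, Alt Hf M = 0
open Classical in
def clY (M : Fin Tc → Fin n) (η : Qc) (J : Fin q → Fin n) (z : Qa) : ℂ :=
  star (∑ s : Equiv.Perm (Fin Tc), if Fin.tail (M ∘ s) = J then sg s * wDz (M Hw) η z else 0)
theorem clY_dot (M : Fin Tc → Fin n) (η : Qc) (y : Qo → Qc) (z) :
    star (fun J => clY M η J z) ⬝ᵥ (fun J => y J z) = Alt Hf M := by
  simp only [clY, dotProduct, Pi.star_apply, star_star, Finset.sum_mul, Alt]
  rw [Finset.sum_comm]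
  refine scg fun s _ => ?_
  simp [ite_mul, mul_assoc]
theorem clY_test (hΩ : IsOpen Ω) (M : Fin Tc → Fin n) {η} (hη : IsTest Ω η) (J) : IsTest Ω (clY M η J) := by
  refine test_star (test_sum _ fun s _ => ?_)
  split_ifs
  · rw [wDz_eq]; exact test_const_mul _ hΩ Yx
  · exact test_zero
theorem proj_alt (hΩ : IsOpen Ω) (hΦ : Sm Ω Φ) (hψ : Sm Ω ψ) (hg : Qd)
    {X : Qo → Qc} (hX : ∀ I, IsTest Ω Yt) :
    ∃ y2 : Qo → Qa → ℂ, WL Ω (fun z => (mW Φ ψ q z)⁻¹) y2 ∧ (∀ z, Asym fun I => y2 I z) ∧ CL Ω y2 ∧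
      ∀ y, WL Ω (fun z => (mW Φ ψ q z)⁻¹) y → CL Ω y → (∀ z ∈ Ω, Asym fun I => y I z) →
        ∫ z in Ω, star (fun i => X i z) ⬝ᵥ Tm = ∫ z in Ω, star (fun i => rX Φ ψ y2 i z) ⬝ᵥ Tm := by
  have hf : Qg ≠ 0 := by exact_mod_cast q.factorial_ne_zero
  have hc := fun I J => cont_of_sm (mW_sm (q := q) hΩ hΦ hψ I J)
  have hpd : ∀ z ∈ Ω, (mW Φ ψ q z).PosDef := fun z hz => mW_pd Tp
  obtain ⟨y1, h1, h2, h3⟩ := proj_lemma (m := mW Φ ψ q) hΩ.measurableSet hc Yj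
    hpd {Y | ∃ M η, IsTest Ω η ∧ Y = clY M η} (by
      rintro Y ⟨M, η, hη, rfl⟩; exact WL.test hΩ Hz (clY_test hΩ M hη)) (WL.test hΩ Hz hX)
  have h2' : CL Ω y1 := fun M η hη => by
    have := h2 _ ⟨M, η, hη, rfl⟩; simpa only [clY_dot] using this
  set y2 : Qo → Qc := fun I z => Qg⁻¹ * Alt Ug I with hy2
  have hA : ∀ z, Asym fun I => y2 I z := fun z => (alt_asym _).mulc _
  have hM : ∀ I, AEStronglyMeasurable (y2 I) Qr := fun I =>
    aestronglyMeasurable_const.mul (Finset.aestronglyMeasurable_fun_sum _ fun s _ => aestronglyMeasurable_const.mul (h1.1 _))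
  refine ⟨y2, ⟨hM, ?_⟩, hA, fun M η hη => ?_, fun y hy hcl hyA => ?_⟩
  · refine Integrable.mono' h1.2 (qf_meas hΩ.measurableSet Yj hM) ?_
    filter_upwards [ae_restrict_mem hΩ.measurableSet] with z hz
    rw [Real.norm_of_nonneg (qf_nonneg (hpd z hz).inv.posSemidef _), mW_inv Tp, qf_smul, qf_smul]
    refine mul_le_mul_of_nonneg_left ?_ (Real.exp_pos _).le
    have a1 := alt_qf_le (hg z hz).inv.posSemidef Ug
    have a2 := qf_smul_vec (tp q Qn⁻¹) Qg⁻¹ (Alt fun I => y1 I z)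
    have a3 : (fun I => y2 I z) = Qg⁻¹ • Alt fun I => y1 I z := rfl
    rw [a3, a2, norm_inv, Complex.norm_natCast, inv_pow, inv_mul_le_iff₀ Qt]; exact a1
  · rw [← h2' M η hη]
    refine integral_congr_ae (Eventually.of_forall fun z => ?_)
    simp only [hy2]
    have := alt_alt (fun k => wDz k η z) Ug M
    have e : (fun M : Fin Tc → Fin n => wDz Td η z * (Qg⁻¹ * Alt Ug Qs)) =
      fun M => (wDz Td η z * Alt Ug Qs) * Qg⁻¹ := by funext M; ring
    rw [e, alt_mulc, this]; field_simp
  · rw [h3 y hy (by rintro Y ⟨M, η, hη, rfl⟩; simpa only [clY_dot] using hcl M η hη)]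
    refine setIntegral_congr_fun hΩ.measurableSet fun z hz => ?_
    simp only [rX_mW Tp]
    have e : Hm = Qg⁻¹ • Alt (fun I => rX Φ ψ y1 I z) := by
      have e2 : (fun I => y2 I z) = Qg⁻¹ • Alt fun I => y1 I z := rfl
      rw [rX_vec, e2, Matrix.mulVec_smul, tp_mulVec_alt]
      funext I
      have := alt_mulc (tp q Qn⁻¹ *ᵥ fun J => y1 J z) Qj I
      simp only [Pi.smul_apply, smul_eq_mul]
      have e3 : (fun I => rX Φ ψ y1 I z) = fun I => (tp q Qn⁻¹ *ᵥ fun J => y1 J z) I * Qj := by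
        funext I; rw [mul_comm]; rfl
      rw [e3, this]; ring
    rw [e, star_smul, smul_dotProduct, star_alt_dot, show Alt Tm = Qg • fun i => y i z from funext fun J => (hyA z hz).alt J,
      dotProduct_smul]
    simp only [smul_eq_mul, star_inv₀, star_natCast]; field_simp
end core2
section core3
open scoped Matrix
variable {n r q : ℕ} {Ω : Set Qa} {Φ ψ : Qa → ℝ}
theorem cs_int {α : Type*} [MeasurableSpace α] {μ : Measure α} {f : α → ℂ} {a b : α → ℝ} (ha : Integrable a μ) (hb : Integrable b μ)
    (h : ∀ᵐ z ∂μ, 0 ≤ a z ∧ 0 ≤ b z ∧ ‖f z‖^2 ≤ a z * b z) : ‖∫ z, f z ∂μ‖^2 ≤ (∫ z, a z ∂μ) * ∫ z, b z ∂μ := by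
  set c := ∫ z, ‖f z‖ ∂μ
  have hc : 0 ≤ c := integral_nonneg fun _ => norm_nonneg _
  have h1 : ‖∫ z, f z ∂μ‖ ≤ c := norm_integral_le_integral_norm _
  have key : ∀ t : ℝ, 0 ≤ (∫ z, a z ∂μ) * (t * t) + (-2 * c) * t + ∫ z, b z ∂μ := by
    have k0 : ∀ t : ℝ, 0 ≤ t → 2 * t * c ≤ t * t * (∫ z, a z ∂μ) + ∫ z, b z ∂μ := fun t ht => by
      rw [← integral_const_mul, ← integral_const_mul, ← integral_add (ha.const_mul _) hb]
      refine integral_mono_of_nonneg (Eventually.of_forall fun z => by positivity) ((ha.const_mul _).add hb) ?_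
      filter_upwards [h] with z ⟨h0, h1, h2⟩
      have : ‖f z‖ ≤ Real.sqrt (a z) * Real.sqrt (b z) := by
        rw [← Real.sqrt_mul h0]; exact Real.le_sqrt_of_sq_le h2
      nlinarith [sq_nonneg (t * Real.sqrt (a z) - Real.sqrt (b z)), Real.sq_sqrt h0, Real.sq_sqrt h1]
    intro t
    rcases le_total 0 t with ht | ht
    · linarith [k0 t ht]
    · have := k0 (-t) Yr
      nlinarith [mul_nonneg hc (neg_nonneg.2 ht)]
  have := discrim_le_zero key
  rw [discrim] at this
  have h2 : ‖∫ z, f z ∂μ‖^2 ≤ c^2 := pow_le_pow_left₀ Tx h1 2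
  nlinarith
open Classical in
def yT (η : Qc) (J : Fin q → Fin n) (I : Fin Tc → Fin n) (z : Qa) : ℂ :=
  Alt (fun I => wDz Ti η z * if Fin.tail I = J then 1 else 0) I
theorem yT_test (hΩ : IsOpen Ω) {η} (hη : IsTest Ω η) (J : Fin q → Fin n) (I) : IsTest Ω (yT η J I) :=
  test_sum _ fun s _ => test_const_mul _ hΩ (by rw [wDz_eq]; exact test_mulr hΩ Yx contDiffOn_const)
theorem ibp {f g : Qc} (hΩ : IsOpen Ω) {c j} (hf : IsTest Ω f) (hg : IsTest Ω g) :
    ∫ z in Ω, wD c j f z * g z = - ∫ z in Ω, f z * wD c j g z := by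
  have h := int_wD_test (c := c) (j := j) (test_mul hΩ hf.sm hg)
  have e : ∀ z ∈ Ω, wD c j (fun z => f z * g z) z = wD c j f z * g z + f z * wD c j g z := fun z hz => by
    rw [wD_mul (hf.1.differentiable Qy z) (hg.1.differentiable Qy z)]
  rw [setIntegral_congr_fun hΩ.measurableSet e, integral_add (test_mulr hΩ (test_wD hf) hg.sm).integrable.integrableOn
    (test_mul hΩ hf.sm (test_wD hg)).integrable.integrableOn] at h
  exact eq_neg_of_add_eq_zero_left h
theorem yT_cl (hΩ : IsOpen Ω) {η} (hη : IsTest Ω η) (J : Fin q → Fin n) : CL Ω (yT η J) := fun M ζ hζ => by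
  classical
  simp only [yT]
  have e1 : ∀ z, Alt (fun M : Fin (q+2) → Fin n => wDz Td ζ z * Alt (fun I => wDz Ti η z * if Fin.tail I = J then 1 else 0) Qs) M =
      ((q+1).factorial : ℂ) * Alt (fun M : Fin (q+2) → Fin n => wDz Td ζ z * Yo) M :=
    fun z => alt_alt (fun k => wDz k ζ z) _ M
  simp only [e1]
  have hi : ∀ M : Fin (q+2) → Fin n, IsTest Ω (fun z => wDz Td ζ z * Yo) := fun M => by
    simp only [wDz_eq]; exact test_mul hΩ (test_wD hζ).sm (test_mulr hΩ Yx contDiffOn_const)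
  rw [integral_const_mul]
  simp only [alt_fun]
  rw [integral_finsetSum (f := fun s z => _) _ fun s _ => ((hi _).integrable.const_mul _).integrableOn]
  simp only [integral_const_mul]
  have := alt_zero_of_swap (w := fun M : Fin (q+2) → Fin n => ∫ z in Ω, wDz Td ζ z * Yo)
    0 1 Qy (fun M => by
      have t : Fin.tail (Fin.tail (M ∘ Equiv.swap (0 : Fin (q+2)) 1)) = Fin.tail Qs := by
        funext a; simp only [Fin.tail, Function.comp]
        rw [Equiv.swap_apply_of_ne_of_ne]
        · exact Fin.succ_ne_zero _
        · intro h
          rw [← Fin.succ_zero_eq_one] at h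
          exact Fin.succ_ne_zero _ (Fin.succ_injective _ h)
      simp only [t]
      split_ifs
      · simp only [mul_one, wDz_eq, Function.comp, Equiv.swap_apply_left, Equiv.swap_apply_right]
        rw [ibp hΩ hζ Yx, ibp hΩ hζ Yx]
        congr 2; funext z
        rw [wD_comm hη.1.contDiffAt]
      · simp) M
  rw [Alt] at this
  rw [this, mul_zero]
theorem yT_dot (η : Qc) (J : Fin q → Fin n) {x : (Fin Tc → Fin n) → ℂ} (hx : Asym x) (z) :
    star (fun I => yT He J I z) ⬝ᵥ x = ((q+1).factorial : ℂ) * ∑ k, wDzbar k η z * x Qw := by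
  classical
  have e : (fun I => yT He J I z) = Alt (fun I => star (wDzbar Ti η z) * if Fin.tail I = J then 1 else 0) := by
    funext I; unfold yT; congr 1; funext I
    have := wD_star (c := -Complex.I) (j := I 0) (f := η) (z := z)
    rw [wDz_eq, wDzbar_eq]; rw [show wD (-Complex.I) Ti He z = star (wD Complex.I Ti η z) by simpa using this]
  rw [e, star_alt_dot, show Alt x = ((q+1).factorial : ℂ) • x from funext fun J => hx.alt J, dotProduct_smul, smul_eq_mul]
  congr 1
  simp [dotProduct, sum_cons (q := q), apply_ite (starRingEnd ℂ), ite_mul]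
theorem core (hΩ : IsOpen Ω) (hΦ : Sm Ω Φ) (hψ : Sm Ω ψ) (hg : Qd)
    {g : Qa → Qb} (hgc : ∀ i j, ContinuousOn (fun z => g z i j) Ω)
    (hg0 : ∀ z ∈ Ω, (g z).PosDef) (hg1 : ∀ z ∈ Ω, (cHess Φ z - g z).PosSemidef) (hg2 : ∀ z ∈ Ω, (cHess ψ z - g z).PosSemidef)
    {C : ℝ} {χ : ℕ → Qa → ℝ} (hχ : Cut Ω Tk C χ)
    {X : Qp → Qc} (hX : ∀ I, IsTest Ω Yt) (hXA : ∀ z, Asym fun I => X I z)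
    {y : Qp → Qc} (hym : ∀ I, AEStronglyMeasurable (y I) Qr)
    (hyi : IntegrableOn (fun z => Real.exp (-ψ z) * qf (tp Qm (g z)⁻¹) Qq) Ω)
    (hyA : ∀ z ∈ Ω, Asym fun I => y I z) (hcl : CL Ω y) :
    ‖∫ z in Ω, star Qq ⬝ᵥ Th‖^2 ≤
      (∫ z in Ω, Real.exp (-ψ z) * qf (tp Qm (g z)⁻¹) Qq) *
      ∫ z in Ω, Real.exp Tb * qf Hh Qx := by
  have hΩm := hΩ.measurableSet
  obtain ⟨y2, w2, a2, c2, p2⟩ := proj_alt hΩ hΦ hψ hg hX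
  have hpd : ∀ z ∈ Ω, (mW Φ ψ Qm z).PosDef := fun z hz => mW_pd Tp
  have hL := WL.ll (fun I J => cont_of_sm (mW_sm hΩ hΦ hψ I J)) hpd w2
  have hwy : WL Ω (fun z => (mW Φ ψ Qm z)⁻¹) y := by
    refine ⟨hym, Integrable.mono' hyi (qf_meas hΩm Yj hym) ?_⟩
    filter_upwards [ae_restrict_mem hΩm] with z hz
    rw [Real.norm_of_nonneg (qf_nonneg (hpd z hz).inv.posSemidef _), mW_inv Tp, qf_smul]
    exact mul_le_mul_of_nonneg_left (qf_mono (tpm_mono (fun _ => (hg z hz).inv.posSemidef) fun _ => inv_anti (hg0 z hz) (hg1 z hz)) _) (Real.exp_pos _).le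
  have rA : ∀ z, Asym fun I => rX Φ ψ y2 I z := fun z => Asym.mulc (tp_mulVec_asym _ (a2 z)) _
  have hf : ((r+1).factorial : ℂ) ≠ 0 := by exact_mod_cast (r+1).factorial_ne_zero
  have hw : ∀ J, ∀ η, IsTest Ω η → ∫ z in Ω, ∑ k, wDzbar k η z * rX Φ ψ y2 Qw z = - ∫ z in Ω, η z * dX X J z := fun J η hη => by
    have h := p2 (yT He J) (WL.test hΩ (fun I J => (exp_smul_tp_sm hψ.neg Tq I J).congr
      fun z hz => by simp only [mW_inv Tp]) (yT_test hΩ (test_star hη) J)) (yT_cl hΩ (test_star hη) J) (fun z _ => alt_asym _)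
    have h' := congrArg star h
    have sw : ∀ F : Qp → Qa → ℂ, star (∫ z in Ω, star Yw ⬝ᵥ (fun i => yT He J i z)) =
        ∫ z in Ω, star (fun i => yT He J i z) ⬝ᵥ Yw := fun F => by
      rw [Complex.star_def, ← integral_conj]
      congr 1; funext z
      rw [← Complex.star_def, Matrix.star_dotProduct, star_star]
    rw [sw, sw] at h'
    simp only [yT_dot η J (hXA _), yT_dot η J (rA _), integral_const_mul] at h'
    rw [← mul_left_cancel₀ hf h']
    have hi : ∀ k ∈ Finset.univ, IntegrableOn (fun z => wDzbar k η z * X Qw z) Ω := fun k _ => by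
      rw [wDzbar_eq]; exact (test_mulr hΩ Yx (hX _).sm).integrable.integrableOn
    have hi' : ∀ k ∈ Finset.univ, IntegrableOn (fun z => η z * wDzbar k (X Qw) z) Ω := fun k _ => by
      rw [wDzbar_eq]; exact (test_mul hΩ hη.sm (test_wD (hX _))).integrable.integrableOn
    simp only [dX, Finset.mul_sum]
    rw [integral_finsetSum _ hi, integral_finsetSum _ hi', ← Finset.sum_neg_distrib]
    exact scg fun k _ => by rw [wDzbar_eq]; exact ibp hΩ hη (hX _)
  have hE := energy hΩ hΦ hψ hg hL a2 c2 (test_dX hX) hw w2.1 (by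
      refine w2.2.congr ?_
      filter_upwards [ae_restrict_mem hΩm] with z hz
      rw [mW_inv Tp, qf_smul]) hgc (fun z hz => (hg0 z hz).posSemidef) hg1 hg2 hχ
  have sw : ‖∫ z in Ω, star Qq ⬝ᵥ Th‖ = ‖∫ z in Ω, star (fun i => rX Φ ψ y2 i z) ⬝ᵥ Tm‖ := by
    rw [← p2 y hwy hcl hyA, ← norm_star (∫ z in Ω, star (fun i => X i z) ⬝ᵥ Tm), Complex.star_def, ← integral_conj]
    congr 2; funext z
    rw [← Complex.star_def, Matrix.star_dotProduct]
  rw [sw]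
  refine (cs_int hE.1 hyi ?_).trans ?_
  · filter_upwards [ae_restrict_mem hΩm] with z hz
    have h1 := qf_nonneg (tp_posDef (q := r+1) (hg0 z hz)).posSemidef Hm
    have h2 := qf_nonneg (tp_posDef (q := r+1) (hg0 z hz).inv).posSemidef Qq
    have h3 := qf_cs_inv (tp_posDef (q := r+1) (hg0 z hz)) Qq Hm
    rw [tp_nonsing_inv (hg0 z hz)] at h3
    refine ⟨mul_nonneg (Real.exp_pos _).le h1, mul_nonneg (Real.exp_pos _).le h2, ?_⟩
    rw [Matrix.star_dotProduct, norm_star]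
    refine h3.trans (le_of_eq ?_)
    have : Real.exp Tb * Real.exp (-ψ z) = 1 := by rw [← Real.exp_add]; simp
    linear_combination (-(qf Ye Hm) * qf (tp Qm (g z)⁻¹) Qq) * this
  · rw [mul_comm]
    refine mul_le_mul_of_nonneg_left hE.2 (setIntegral_nonneg hΩm fun z hz => mul_nonneg (Real.exp_pos _).le
      (qf_nonneg (tp_posDef (hg0 z hz).inv).posSemidef _))
end core3
section holo
variable {n : ℕ} {U : Set Qa} {f : Qc}
theorem line_diff (hU : IsOpen U) (hf : DifferentiableOn ℂ f U) {z v : Qa} {ζ : ℂ}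
    (h : z + ζ • v ∈ U) : HasDerivAt (fun ζ : ℂ => f (z + ζ • v)) (fderiv ℂ f (z + ζ • v) v) ζ := by
  have h1 : HasDerivAt (fun ζ : ℂ => z + ζ • v) v ζ := by
    simpa using ((hasDerivAt_id ζ).smul_const v).const_add z
  exact (((hf _ h).differentiableAt (hU.mem_nhds h)).hasFDerivAt.comp_hasDerivAt ζ h1)
theorem holo_fderiv (hU : IsOpen U) (hf : DifferentiableOn ℂ f U) (v : Qa) :
    DifferentiableOn ℂ (fun z => fderiv ℂ f z v) U := by
  intro z₀ hz₀
  obtain ⟨R, hR, hRU⟩ := Metric.nhds_basis_closedBall.mem_iff.1 (hU.mem_nhds hz₀)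
  obtain ⟨M, hM⟩ := ((isCompact_closedBall z₀ R).image_of_continuousOn
    (hf.continuousOn.mono hRU).norm).bddAbove
  have hM' : ∀ z, dist z z₀ ≤ R → ‖f z‖ ≤ M := fun z hz => hM ⟨z, hz, rfl⟩
  set ε := R / 4 with hε
  have hε0 : 0 < ε := by positivity
  have key : ∀ z w : Qa, dist z z₀ ≤ 2 * ε → ‖w‖ ≤ ε → dist (z + w) z₀ ≤ R := by
    intro z w h1 h2
    rw [dist_eq_norm] at *
    have : z + w - z₀ = (z - z₀) + w := by abel
    rw [this]
    exact (norm_add_le _ _).trans Yr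
  have circ : ∀ (z v : Qa) (r : ℝ), 0 < r → r * ‖v‖ ≤ ε → dist z z₀ ≤ 2 * ε →
      ∀ ζ ∈ Metric.closedBall (0 : ℂ) r, dist (z + ζ • v) z₀ ≤ R := by
    intro z v r hr h1 h2 ζ hζ
    refine key z _ h2 ?_
    rw [norm_smul]
    exact (mul_le_mul_of_nonneg_right (by simpa using hζ) Tx).trans h1
  have hb : ∀ z, dist z z₀ ≤ 2 * ε → ‖fderiv ℂ f z‖ ≤ M / ε := by
    intro z hz
    have hM0 : 0 ≤ M := (norm_nonneg _).trans (hM' z Yr)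
    refine ContinuousLinearMap.opNorm_le_bound _ Qt fun w => ?_
    by_cases hw : w = 0
    · simp [hw]
    have hw' : 0 < ‖w‖ := norm_pos_iff.2 hw
    have hr : 0 < ε / ‖w‖ := by positivity
    have hc := circ z w _ hr (by rw [div_mul_cancel₀ _ hw'.ne']) hz
    have := Complex.norm_deriv_le_of_forall_mem_sphere_norm_le (f := fun ζ : ℂ => f (z + ζ • w)) (c := 0) (C := M) hr
      (DifferentiableOn.diffContOnCl fun ζ hζ => ((line_diff hU hf (hRU (hc ζ
        (Metric.closure_ball_subset_closedBall hζ)))).differentiableAt.differentiableWithinAt))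
      (fun ζ hζ => hM' _ (hc ζ (Metric.sphere_subset_closedBall hζ)))
    rw [(line_diff hU hf (hRU (hc 0 (by simp [hr.le])))).deriv] at this
    simp only [zero_smul, add_zero] at this
    refine this.trans (le_of_eq ?_)
    field_simp
  set r := ε / (‖v‖ + 1) with hr
  have hr0 : 0 < r := by positivity
  have hrv : r * ‖v‖ ≤ ε := by
    rw [hr, div_mul_eq_mul_div, div_le_iff₀ Qt]; nlinarith [norm_nonneg v]
  set c : ℝ → ℂ := fun θ => deriv (circleMap 0 r) θ * ((circleMap 0 r θ) ^ 2)⁻¹ with hc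
  have hcc : Continuous c := by
    rw [hc]; simp only [deriv_circleMap]
    refine ((continuous_circleMap 0 r).mul continuous_const).mul
      (((continuous_circleMap 0 r).pow 2).inv₀ fun θ => ?_)
    simp [hr0.ne']
  have hcm : ∀ θ, circleMap 0 r θ ∈ Metric.closedBall (0 : ℂ) r := fun θ =>
    Metric.sphere_subset_closedBall (circleMap_mem_sphere 0 hr0.le θ)
  have rep : ∀ z, dist z z₀ ≤ 2 * ε → fderiv ℂ f z v =
      (2 * Real.pi * Complex.I)⁻¹ * ∫ θ in (0 : ℝ)..2 * Real.pi, c θ * f Ua := by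
    intro z hz
    have hc' := circ z v r hr0 hrv hz
    have hO : IsOpen ((fun ζ : ℂ => z + ζ • v) ⁻¹' U) := hU.preimage (by fun_prop)
    have := Complex.two_pi_I_inv_smul_circleIntegral_sub_sq_inv_smul_of_differentiable
      (f := fun ζ : ℂ => f (z + ζ • v)) (c := 0) (w₀ := 0) (R := r) hO (fun ζ hζ => hRU (hc' ζ hζ))
      (fun ζ hζ => (line_diff hU hf hζ).differentiableAt.differentiableWithinAt) (by simp [hr0])
    rw [(line_diff hU hf (hRU (hc' 0 (by simp [hr0.le])))).deriv] at this
    simp only [zero_smul, add_zero] at this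
    rw [← this, circleIntegral]
    simp only [sub_zero, smul_eq_mul, hc, mul_assoc]
  have cont : ∀ z, dist z z₀ ≤ 2 * ε → Continuous fun θ => c θ * f Ua := fun z hz =>
    hcc.mul (hf.continuousOn.comp_continuous (by fun_prop) fun θ => hRU (circ z v r hr0 hrv hz _ (hcm θ)))
  obtain ⟨A, hA⟩ := (isCompact_Icc (a := (0:ℝ)) (b := 2 * Real.pi)).exists_bound_of_continuousOn hcc.continuousOn
  have hD := intervalIntegral.hasFDerivAt_integral_of_dominated_of_fderiv_le (μ := volume) (𝕜 := ℂ)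
    (a := 0) (b := 2 * Real.pi) (x₀ := z₀) (s := Metric.ball z₀ ε)
    (F := fun z θ => c θ * f Ua)
    (F' := fun z θ => c θ • fderiv ℂ f Ua) (bound := fun _ => A * (M / ε))
    (Metric.ball_mem_nhds z₀ hε0)
    (by
      filter_upwards [Metric.ball_mem_nhds z₀ hε0] with z hz
      exact (cont z (by rw [Metric.mem_ball] at hz; linarith)).aestronglyMeasurable)
    ((cont z₀ (by simp; positivity)).intervalIntegrable _ _)
    (by
      refine AEStronglyMeasurable.smul hcc.aestronglyMeasurable ?_
      exact ((measurable_fderiv ℂ f).comp (by fun_prop : Measurable fun θ : ℝ => z₀ + circleMap 0 r θ • v)).aestronglyMeasurable)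
    (by
      refine Eventually.of_forall fun θ hθ z hz => ?_
      rw [norm_smul]
      rw [Set.uIoc_of_le Real.two_pi_pos.le] at hθ
      refine mul_le_mul (hA θ ⟨hθ.1.le, hθ.2⟩) (hb _ ?_) Tx ((norm_nonneg _).trans (hA θ ⟨hθ.1.le, hθ.2⟩))
      rw [Metric.mem_ball, dist_eq_norm] at hz
      have h1 : ‖circleMap 0 r θ • v‖ ≤ ε := by
        rw [norm_smul]
        exact (mul_le_mul_of_nonneg_right (by simpa using hcm θ) Tx).trans hrv
      have : z + circleMap 0 r θ • v - z₀ = (z - z₀) + circleMap 0 r θ • v := by abel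
      rw [dist_eq_norm, this]
      exact (norm_add_le _ _).trans Yr)
    intervalIntegrable_const
    (by
      refine Eventually.of_forall fun θ _ z hz => ?_
      have hm := hRU (circ z v r hr0 hrv (by rw [Metric.mem_ball] at hz; linarith) _ (hcm θ))
      have h1 := ((hf _ hm).differentiableAt (hU.mem_nhds hm)).hasFDerivAt
      exact (h1.comp z ((hasFDerivAt_id z).add_const _)).const_mul (c θ))
  refine DifferentiableAt.differentiableWithinAt ?_
  refine ((hD.differentiableAt).const_mul ((2 * Real.pi * Complex.I)⁻¹)).congr_of_eventuallyEq ?_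
  filter_upwards [Metric.ball_mem_nhds z₀ hε0] with z hz
  exact rep z (by rw [Metric.mem_ball] at hz; linarith)
theorem holo_sm (hU : IsOpen U) (hf : DifferentiableOn ℂ f U) : Sm U f := by
  refine ContDiffOn.restrict_scalars (𝕜 := ℝ) (𝕜' := ℂ) ?_
  refine contDiffOn_infty.2 fun k => ?_
  induction k generalizing f with
  | zero => exact contDiffOn_zero.2 hf.continuousOn
  | succ k ih =>
    push_cast
    rw [contDiffOn_succ_iff_fderiv_of_isOpen hU]
    exact ⟨hf, by simp, contDiffOn_clm_apply.2 fun v => ih (holo_fderiv hU hf v)⟩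
end holo
section dd
open scoped Matrix
variable {n : ℕ} {Ω : Set Qa} {z : Qa} {c d : ℂ} {ξ η : Qa}
def DD (c : ℂ) (η : Qa) (f : Qc) (z : Qa) : ℂ := ∑ l, wD c l f z * η l
def Dx (ξ : Qa) (f : Qa → ℝ) (z : Qa) : ℂ := DD Complex.I ξ Hc z
def Hx (ξ : Qa) (f : Qa → ℝ) (z : Qa) : ℝ :=
  (DD (-Complex.I) (star ξ) (Dx ξ f) z).re
section
variable {f g : Qc}
theorem DD_congr (h : f =ᶠ[𝓝 z] g) : DD c η f z = DD c η g z := by simp only [DD, wD_congr h]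
theorem DD_on (hΩ : IsOpen Ω) (hz : z ∈ Ω) (h : ∀ x ∈ Ω, f x = g x) : DD c η f z = DD c η g z :=
  DD_congr (eventually_of_mem Ya h)
theorem DD_sm (hΩ : IsOpen Ω) (h : Sm Ω f) : Sm Ω (DD c η f) :=
  ContDiffOn.sum fun _ _ => (wD_sm hΩ h).mul contDiffOn_const
theorem DD_mul (hf : DifferentiableAt ℝ f z) (hg : DifferentiableAt ℝ g z) :
    DD c η Tt z = DD c η f z * g z + f z * DD c η g z := by
  simp only [DD, wD_mul hf hg, Finset.sum_mul, Finset.mul_sum, ← Finset.sum_add_distrib]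
  exact scg fun _ _ => by ring
theorem DD_add (hf : DifferentiableAt ℝ f z) (hg : DifferentiableAt ℝ g z) :
    DD c η (fun x => f x + g x) z = DD c η f z + DD c η g z := by
  simp only [DD, wD_add hf hg, ← Finset.sum_add_distrib, add_mul]
theorem DD_sum {ι : Type*} (s : Finset ι) {f : ι → Qc} (h : ∀ i ∈ s, DifferentiableAt ℝ Hl z) :
    DD c η Yi z = ∑ i ∈ s, DD c η Hl z := by
  simp only [DD, wD_sum s h, Finset.sum_mul]; exact Finset.sum_comm
theorem DD_const_mul (a : ℂ) : DD c η Ud z = a * DD c η f z := by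
  simp only [DD, wD_const_mul, Finset.mul_sum, mul_assoc]
theorem DD_star : DD c η (fun x => star Hy) z = star (DD (star c) (star η) f z) := by
  simp only [DD, wD_star, star_sum, star_mul', Pi.star_apply, star_star]
theorem DD_comm (hΩ : IsOpen Ω) (h : Sm Ω f) (hz : z ∈ Ω) : DD c η (DD d ξ f) z = DD d ξ (DD c η f) z := by
  have e : ∀ c η d ξ, DD c η (DD d ξ f) z = ∑ l, ∑ k, wD c l (wD d k f) z * ξ k * η l := by
    intro c η d ξ
    refine scg fun l _ => ?_
    have : DD d ξ f = fun x => ∑ k, ξ k * wD d k f x := by funext x; simp only [DD, mul_comm]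
    rw [this, wD_sum _ fun k _ => ((wD_sm hΩ h).diff hΩ hz).const_mul _, Finset.sum_mul]
    simp only [wD_const_mul, mul_comm]
  rw [e, e, Finset.sum_comm]
  refine scg fun l _ => scg fun k _ => ?_
  rw [wD_comm (h.at hΩ hz)]; ring
theorem DD_holo (h : DifferentiableAt ℂ f z) : DD Complex.I ξ f z = 0 :=
  Finset.sum_eq_zero fun l _ => by rw [← wDzbar_eq, wDzbar_holo h, zero_mul]
end
variable {f g : Qa → ℝ}
theorem Dx_sm (hΩ : IsOpen Ω) (h : Sm Ω f) : Sm Ω (Dx ξ f) := DD_sm hΩ (ofReal_sm h)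
theorem DD_real : DD (-Complex.I) (star ξ) Hc z = star (Dx ξ f z) := by
  have := DD_star (c := -Complex.I) (η := star ξ) (f := fun z => (f z : ℂ)) (z := z)
  simpa [Dx] using this
theorem Hx_eq (hΩ : IsOpen Ω) (h : Sm Ω f) (hz : z ∈ Ω) : qf (cHess f z) ξ = Hx ξ f z := by
  have e : Dx ξ f = fun x => ∑ k, ξ k * wD Complex.I k Hc x := by
    funext x; simp only [Dx, DD, mul_comm]
  rw [Hx, e]
  simp only [qf, DD, dotProduct, Matrix.mulVec, cHess, Matrix.of_apply, wDz_eq, wDzbar_eq]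
  congr 1
  refine scg fun l _ => ?_
  rw [wD_sum _ fun k _ => ((wD_sm hΩ (ofReal_sm h)).diff hΩ hz).const_mul _]
  simp only [wD_const_mul, mul_comm]
theorem psd_of_Hx (hΩ : IsOpen Ω) (h : Sm Ω f) (hz : z ∈ Ω) (hp : ∀ ξ, 0 ≤ Hx ξ f z) : (cHess f z).PosSemidef := by
  have hh := cHess_herm hΩ h hz
  refine Matrix.PosSemidef.of_dotProduct_mulVec_nonneg hh fun x => ?_
  have h1 := dot_herm hh x x
  rw [Matrix.star_dotProduct] at h1
  refine Complex.le_def.2 ⟨(hp x).trans (Hx_eq hΩ h hz).ge, ?_⟩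
  have := congrArg Complex.im h1
  simp at this ⊢
  linarith
theorem Dx_mul (hΩ : IsOpen Ω) (hf : Sm Ω f) (hg : Sm Ω g) (hz : z ∈ Ω) :
    Dx ξ Tt z = Dx ξ f z * g z + f z * Dx ξ g z := by
  simp only [Dx, Complex.ofReal_mul]
  exact DD_mul ((ofReal_sm hf).diff hΩ hz) ((ofReal_sm hg).diff hΩ hz)
theorem Hx_mul (hΩ : IsOpen Ω) (hf : Sm Ω f) (hg : Sm Ω g) (hz : z ∈ Ω) :
    Hx ξ Tt z = Hx ξ f z * g z + f z * Hx ξ g z + 2 * (star (Dx ξ f z) * Dx ξ g z).re := by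
  have hf' := ofReal_sm hf
  have hg' := ofReal_sm hg
  have hd : ∀ {f : Qc}, Sm Ω f → DifferentiableAt ℝ f z := fun h => h.diff hΩ hz
  rw [Hx, DD_on hΩ hz (f := Dx ξ _) (fun x hx => Dx_mul hΩ hf hg hx), DD_add (hd ((Dx_sm hΩ hf).mul hg')) (hd (hf'.mul (Dx_sm hΩ hg))),
    DD_mul (hd (Dx_sm hΩ hf)) (hd hg'), DD_mul (hd hf') (hd (Dx_sm hΩ hg)), DD_real, DD_real]
  simp only [Hx, Complex.add_re, Complex.mul_re, Complex.star_def, Complex.conj_re, Complex.conj_im,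
    Complex.ofReal_re, Complex.ofReal_im]
  ring
theorem Dx_comp {G : ℝ → ℝ} {G' : ℝ} (hf : DifferentiableAt ℝ f z) (hG : HasDerivAt G G' (f z)) :
    Dx ξ (fun x => G Hy) z = G' * Dx ξ f z := by
  simp only [Dx, DD, wD_real_comp hG hf, Finset.mul_sum, mul_assoc]
theorem Hx_comp {G G' : ℝ → ℝ} {G'' : ℝ} (hΩ : IsOpen Ω) (hf : Sm Ω f) (hz : z ∈ Ω)
    (hG : ∀ x ∈ Ω, HasDerivAt G (G' Hy) Hy) (hG' : HasDerivAt G' G'' (f z)) :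
    Hx ξ (fun x => G Hy) z = G' (f z) * Hx ξ f z + G'' * ‖Dx ξ f z‖^2 := by
  have hd : ∀ x ∈ Ω, DifferentiableAt ℝ f x := fun x hx => (hf.contDiffAt (hΩ.mem_nhds hx)).differentiableAt Qy
  rw [Hx, DD_on hΩ hz (f := Dx ξ _) (fun x hx => Dx_comp (hd x hx) (hG x hx)),
    DD_mul (f := fun x => ((G' Hy : ℝ) : ℂ)) (Complex.ofRealCLM.differentiableAt.comp z (hG'.differentiableAt.comp z (hd z hz)))
      ((Dx_sm hΩ hf).diff hΩ hz)]
  have := Dx_comp (ξ := ξ) (hd z hz) hG'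
  have e := DD_real (ξ := ξ) (f := fun x => G' Hy) (z := z)
  rw [this] at e
  rw [e, Complex.add_re, add_comm]
  congr 1
  · simp only [Hx, Complex.mul_re, Complex.ofReal_re, Complex.ofReal_im]; ring
  · rw [star_mul', mul_assoc, Complex.star_def, Complex.conj_ofReal, Complex.conj_mul', ← Complex.ofReal_pow, ← Complex.ofReal_mul, Complex.ofReal_re]
theorem Dx_sum {ι : Type*} (s : Finset ι) {f : ι → Qa → ℝ} (hΩ : IsOpen Ω) (hz : z ∈ Ω) (h : ∀ i, Sm Ω Hl) :
    Dx ξ Yi z = ∑ i ∈ s, Dx ξ Hl z := by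
  simp only [Dx, Complex.ofReal_sum]
  exact DD_sum s fun i _ => (ofReal_sm (h i)).diff hΩ hz
theorem Hx_sum {ι : Type*} (s : Finset ι) {f : ι → Qa → ℝ} (hΩ : IsOpen Ω) (hz : z ∈ Ω) (h : ∀ i, Sm Ω Hl) :
    Hx ξ Yi z = ∑ i ∈ s, Hx ξ Hl z := by
  rw [Hx, DD_on hΩ hz (f := Dx ξ _) (fun x hx => Dx_sum s hΩ hx h),
    DD_sum s fun i _ => (Dx_sm hΩ (h i)).diff hΩ hz, Complex.re_sum]; rfl
theorem Hx_add (hΩ : IsOpen Ω) (hf : Sm Ω f) (hg : Sm Ω g) (hz : z ∈ Ω) :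
    Hx ξ (fun x => f x + g x) z = Hx ξ f z + Hx ξ g z := by
  have := Hx_sum (ξ := ξ) Finset.univ (f := ![f, g]) hΩ hz (by intro i; fin_cases i <;> assumption)
  simpa [Fin.sum_univ_two] using this
theorem Hx_cmul (a : ℝ) : Hx ξ Ud z = a * Hx ξ f z := by
  have : Dx ξ Ud = fun x => a * Dx ξ f x := by
    funext x; simp only [Dx, Complex.ofReal_mul]; exact DD_const_mul _
  rw [Hx, this, DD_const_mul, Complex.re_ofReal_mul]; rfl
theorem tau_sm {ι : Type*} [Fintype ι] {F : ι → Qc} (hΩ : IsOpen Ω) (hF : ∀ i, DifferentiableOn ℂ (F i) Ω) :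
    Sm Ω Te :=
  ContDiffOn.sum fun i _ => (holo_sm hΩ (hF i)).norm_sq ℝ
theorem tau_H {ι : Type*} [Fintype ι] {F : ι → Qc} (hΩ : IsOpen Ω) (hz : z ∈ Ω)
    (hF : ∀ i, DifferentiableOn ℂ (F i) Ω) :
    Dx ξ Te z = ∑ i, F i z * star (DD (-Complex.I) (star ξ) (F i) z) ∧
    Hx ξ Te z = ∑ i, ‖DD (-Complex.I) (star ξ) (F i) z‖^2 := by
  have hs := fun i => holo_sm hΩ (hF i)
  have hs' : ∀ i, Sm Ω (fun x => star (F i x)) := fun i => star_sm (hs i)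
  have hd : ∀ {f : Qc} {x}, Sm Ω f → x ∈ Ω → DifferentiableAt ℝ f x := fun h hx => h.diff hΩ hx
  have e : (fun x => ((∑ i, ‖F i x‖^2 : ℝ) : ℂ)) = fun x => ∑ i, F i x * star (F i x) := by
    funext x; push_cast; refine scg fun i _ => ?_
    rw [Complex.star_def, Complex.mul_conj']
  have h1 : ∀ x ∈ Ω, Dx ξ Te x =
      ∑ i, F i x * star (DD (-Complex.I) (star ξ) (F i) x) := by
    intro x hx
    rw [Dx, e, DD_sum _ fun i _ => hd ((hs i).mul (hs' i)) hx]
    refine scg fun i _ => ?_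
    rw [DD_mul (hd (hs i) hx) (hd (hs' i) hx), DD_holo ((hF i x hx).differentiableAt (hΩ.mem_nhds hx)), DD_star]
    simp
  refine ⟨h1 z hz, ?_⟩
  rw [Hx, DD_on hΩ hz h1, DD_sum _ fun i _ => hd ((hs i).mul (star_sm (DD_sm hΩ (hs i)))) hz, Complex.re_sum]
  refine scg fun i _ => ?_
  rw [DD_mul (hd (hs i) hz) (hd (star_sm (DD_sm hΩ (hs i))) hz), DD_star,
    DD_comm (c := star (-Complex.I)) (η := star (star ξ)) hΩ (hs i) hz, DD_on (f := DD (star (-Complex.I)) (star (star ξ)) (F i)) hΩ hz (g := fun _ => 0) (fun x hx => ?_)]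
  · have : ∀ c η, DD c η (fun _ => 0) z = 0 := fun c η => by simp [DD, wD_const]
    rw [this, star_zero, mul_zero, add_zero, Complex.star_def, Complex.mul_conj', ← Complex.ofReal_pow, Complex.ofReal_re]
  · have := DD_holo (ξ := ξ) ((hF i x hx).differentiableAt (hΩ.mem_nhds hx))
    simpa using this
end dd
section pieces
open scoped Matrix
variable {n : ℕ} {Ω : Set Qa} {z : Qa} {ξ : Qa} {f : Qa → ℝ}
theorem tau_cs {ι : Type*} [Fintype ι] {F : ι → Qc} (hΩ : IsOpen Ω) (hz : z ∈ Ω)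
    (hF : ∀ i, DifferentiableOn ℂ (F i) Ω) :
    ‖Dx ξ Te z‖^2 ≤ (∑ i, ‖F i z‖^2) * Hx ξ Te z := by
  obtain ⟨h1, h2⟩ := tau_H (ξ := ξ) hΩ hz hF
  rw [h1, h2]
  refine (pow_le_pow_left₀ Tx (norm_sum_le _ _) 2).trans ?_
  simp only [norm_mul, norm_star]
  exact Finset.sum_mul_sq_le_sq_mul_sq _ _ _
theorem log_psh (hΩ : IsOpen Ω) (hz : z ∈ Ω) (hf : Sm Ω f) (h0 : ∀ x ∈ Ω, 0 < f x)
    (h : ‖Dx ξ f z‖^2 ≤ f z * Hx ξ f z) : 0 ≤ Hx ξ (fun x => Real.log Hy) z := by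
  have h1 := h0 z hz
  rw [Hx_comp (G' := fun t => t⁻¹) hΩ hf hz (fun x hx => Real.hasDerivAt_log (h0 x hx).ne') (hasDerivAt_inv h1.ne')]
  have : (f z)⁻¹ * Hx ξ f z + -(f z ^ 2)⁻¹ * ‖Dx ξ f z‖ ^ 2 = (f z * Hx ξ f z - ‖Dx ξ f z‖^2) / f z ^ 2 := by
    field_simp; ring
  rw [this]
  exact div_nonneg Yr Qt
theorem neglog (hΩ : IsOpen Ω) (hz : z ∈ Ω) (hf : Sm Ω f) (h0 : ∀ x ∈ Ω, f x < 0) (h : 0 ≤ Hx ξ f z) :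
    ‖Dx ξ (fun x => Real.log (-f x)) z‖^2 ≤ - Hx ξ (fun x => Real.log (-f x)) z := by
  have h1 := h0 z hz
  have hd : ∀ x ∈ Ω, HasDerivAt (fun t => Real.log (-t)) Hy⁻¹ Hy := fun x hx => by
    simpa using Real.hasDerivAt_log (h0 x hx).ne
  rw [Hx_comp (G := fun t => Real.log (-t)) (G' := fun t => t⁻¹) hΩ hf hz hd (hasDerivAt_inv h1.ne),
    Dx_comp (G := fun t => Real.log (-t)) ((hf.contDiffAt Ya).differentiableAt Qy) (hd z hz), norm_mul, mul_pow]
  have : (f z)⁻¹ * Hx ξ f z ≤ 0 := mul_nonpos_of_nonpos_of_nonneg (inv_nonpos.2 h1.le) h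
  have e : ‖(((f z)⁻¹ : ℝ) : ℂ)‖ ^ 2 = (f z ^ 2)⁻¹ := by rw [Complex.norm_real, Real.norm_eq_abs, sq_abs, inv_pow]
  rw [e]; linarith
theorem inv_psh {L : Qa → ℝ} (hΩ : IsOpen Ω) (hz : z ∈ Ω) (hf : Sm Ω L) (h0 : ∀ x ∈ Ω, 1 ≤ L x)
    (h : ‖Dx ξ L z‖^2 ≤ - Hx ξ L z) :
    ‖Dx ξ Uk z‖^2 ≤ Hx ξ Qz z ∧
    ‖Dx ξ Qz z‖^2 ≤ Hx ξ Qz z := by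
  have h1 := h0 z hz
  have h2 : 0 < L z := by linarith
  have hd : DifferentiableAt ℝ L z := (hf.contDiffAt Ya).differentiableAt Qy
  have hG' : HasDerivAt (fun t : ℝ => -(t ^ 2)⁻¹) (2 / L z ^ 3) (L z) := by
    have := ((hasDerivAt_pow 2 (L z)).fun_inv Qt).fun_neg
    refine this.congr_deriv ?_
    field_simp; simp; ring
  rw [Hx_comp (G := fun t => t⁻¹) hΩ hf hz (fun x hx => hasDerivAt_inv (by linarith [h0 x hx])) hG',
    Dx_comp hd (Real.hasDerivAt_log h2.ne'), Dx_comp (G := fun t => t⁻¹) hd (hasDerivAt_inv h2.ne'), norm_mul, norm_mul, mul_pow, mul_pow,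
    Complex.norm_real, Complex.norm_real, Real.norm_eq_abs, Real.norm_eq_abs, sq_abs, sq_abs]
  set D := ‖Dx ξ L z‖^2
  have hD : 0 ≤ D := by positivity
  have k1 : (L z)⁻¹ ^ 2 * D ≤ -(L z ^ 2)⁻¹ * Hx ξ L z + 2 / L z ^ 3 * D := by
    have : 0 ≤ 2 / L z ^ 3 * D := by positivity
    have := mul_le_mul_of_nonneg_left h (by positivity : 0 ≤ (L z ^ 2)⁻¹)
    rw [inv_pow]; linarith
  refine ⟨k1, le_trans ?_ k1⟩
  refine mul_le_mul_of_nonneg_right ?_ hD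
  rw [neg_sq, ← inv_pow]
  have : (L z)⁻¹ ≤ 1 := inv_le_one_of_one_le₀ h1
  have h3 : 0 < (L z)⁻¹ := by positivity
  nlinarith [pow_pos h3 2, pow_le_one₀ h3.le this (n := 2)]
def Nx (ξ : Qa) : ℝ := ∑ i, ‖ξ i‖^2
theorem Nx_nonneg : 0 ≤ Nx ξ := Finset.sum_nonneg fun _ _ => by positivity
theorem le_Nx (i : Fin n) : ‖ξ i‖ ≤ √(Nx ξ) :=
  Real.le_sqrt_of_sq_le (Finset.single_le_sum (f := fun i => ‖ξ i‖^2) (fun _ _ => by positivity) (Finset.mem_univ i))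
theorem bd_test {θ : Qa → ℝ} (h : IsTest Set.univ (fun z => (θ z : ℂ))) : ∃ A : ℝ, 0 ≤ A ∧ ∀ z ξ,
    ‖Dx ξ θ z‖^2 ≤ A * Nx ξ ∧ |Hx ξ Ho z| ≤ A * Nx ξ := by
  have hb : ∀ {f : Qc}, IsTest Set.univ f → ∃ B, ∀ z, ‖f z‖ ≤ B := fun h =>
    h.2.1.exists_bound_of_continuous h.1.continuous
  have hre : ContDiff ℝ Qe θ := by
    have := Complex.reCLM.contDiff.comp h.1
    simpa [Function.comp_def] using this
  have h2 : IsTest Set.univ (fun z => ((θ z * θ z : ℝ) : ℂ)) := by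
    simpa using test_mul isOpen_univ h.sm h
  choose B hB using fun l => hb (test_wD (c := Complex.I) (j := l) h)
  choose E hE using fun l k => hb (test_wD (c := -Complex.I) (j := l) (test_wD (c := Complex.I) (j := k) h2))
  have hB0 : ∀ l, 0 ≤ B l := fun l => (norm_nonneg _).trans (hB l 0)
  have hE0 : ∀ l k, 0 ≤ E l k := fun l k => (norm_nonneg _).trans (hE l k 0)
  have hE1 : 0 ≤ ∑ l, ∑ k, E l k := Finset.sum_nonneg fun _ _ => Finset.sum_nonneg fun _ _ => hE0 _ _
  refine ⟨(∑ l, B l)^2 + ∑ l, ∑ k, E l k, by positivity, fun z ξ => ⟨?_, ?_⟩⟩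
  · have : ‖Dx ξ θ z‖ ≤ (∑ l, B l) * √(Nx ξ) := by
      rw [Dx, DD, Finset.sum_mul]
      refine (norm_sum_le _ _).trans (Finset.sum_le_sum fun l _ => ?_)
      rw [norm_mul]
      exact mul_le_mul (hB l z) (le_Nx l) Tx (hB0 l)
    have := pow_le_pow_left₀ Tx this 2
    rw [mul_pow, Real.sq_sqrt Nx_nonneg] at this
    nlinarith [mul_nonneg hE1 (Nx_nonneg (ξ := ξ))]
  · have : |Hx ξ Ho z| ≤ (∑ l, ∑ k, E l k) * Nx ξ := by
      rw [← Hx_eq isOpen_univ (hre.mul hre).contDiffOn (Set.mem_univ z), qf]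
      refine (Complex.abs_re_le_norm _).trans ?_
      simp only [dotProduct, Matrix.mulVec, Finset.sum_mul, Finset.mul_sum]
      refine (norm_sum_le _ _).trans (Finset.sum_le_sum fun l _ => (norm_sum_le _ _).trans (Finset.sum_le_sum fun k _ => ?_))
      rw [norm_mul, norm_mul, Pi.star_apply, norm_star]
      have := mul_le_mul (le_Nx (ξ := ξ) l) (le_Nx (ξ := ξ) k) Tx (Real.sqrt_nonneg _)
      rw [Real.mul_self_sqrt Nx_nonneg] at this
      have hh : ‖cHess Ho z l k‖ ≤ E l k := by
        simpa only [cHess, Matrix.of_apply, wDz_eq, wDzbar_eq] using hE l k z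
      calc _ = ‖cHess Ho z l k‖ * (‖ξ l‖ * ‖ξ k‖) := by ring
        _ ≤ _ := mul_le_mul hh this Qt (hE0 _ _)
    nlinarith [mul_nonneg (sq_nonneg (∑ l, B l)) (Nx_nonneg (ξ := ξ))]
theorem step_bd : ∃ R : ℝ, 0 ≤ R ∧ ∀ t, |deriv Real.smoothTransition t| ≤ R := by
  have hc : Continuous (deriv Real.smoothTransition) :=
    (Real.smoothTransition.contDiff (n := 1)).continuous_deriv le_rfl
  obtain ⟨R, hR⟩ := (isCompact_Icc (a := (0:ℝ)) (b := 1)).exists_bound_of_continuousOn hc.continuousOn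
  refine ⟨R, (norm_nonneg _).trans (hR 0 Qy), fun t => ?_⟩
  by_cases ht : t ∈ Set.Icc (0:ℝ) 1
  · exact hR t ht
  have : deriv Real.smoothTransition t = 0 := by
    rw [Set.mem_Icc, not_and_or, not_le, not_le] at ht
    rcases ht with ht | ht
    · have : Real.smoothTransition =ᶠ[𝓝 t] fun _ => 0 :=
        eventually_of_mem (Iio_mem_nhds ht) fun x hx => Real.smoothTransition.zero_of_nonpos (le_of_lt hx)
      rw [this.deriv_eq]; simp
    · have : Real.smoothTransition =ᶠ[𝓝 t] fun _ => 1 :=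
        eventually_of_mem (Ioi_mem_nhds ht) fun x hx => Real.smoothTransition.one_of_one_le (le_of_lt hx)
      rw [this.deriv_eq]; simp
  rw [this, abs_zero]
  exact (norm_nonneg _).trans (hR 0 Qy)
end pieces
section pieces2
open scoped Matrix
variable {n : ℕ} {Ω Ω' U : Set Qa} {z : Qa} {ξ : Qa} {f : Qa → ℝ}
structure Piece (Ω : Set Qa) (q : Qa → ℝ) (A : ℝ) (a : ℕ → Qa → ℝ) : Prop where
  A0 : 0 ≤ A
  qs : Sm Ω q
  as : ∀ k, Sm Ω (a k)
  a0 : ∀ k, ∀ z ∈ Ω, 0 ≤ a k z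
  ev : ∀ z ∈ Ω, ∀ᶠ k in atTop, ∀ᶠ x in 𝓝 z, a k x = 0
  pos : ∀ z ∈ Ω, ∀ ξ, 0 ≤ Hx ξ q z + A * Nx ξ
  gr : ∀ k, ∀ z ∈ Ω, ∀ ξ, ‖Dx ξ (a k) z‖^2 ≤ A * (Hx ξ q z + A * Nx ξ)
theorem Piece.mono {q A a} (h : Piece Ω q A a) (hs : Ω' ⊆ Ω) : Piece Ω' q A a where
  A0 := h.A0
  qs := h.qs.mono hs
  as := fun k => (h.as k).mono hs
  a0 := fun k z hz => h.a0 k z (hs hz)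
  ev := fun z hz => h.ev z (hs hz)
  pos := fun z hz => h.pos z (hs hz)
  gr := fun k z hz => h.gr k z (hs hz)
theorem sm_cut {θ : Qa → ℝ} (hU : IsOpen U) (hΩ : IsOpen Ω) (hθ : IsTest U (fun z => (θ z : ℂ)))
    (hf : Sm (U ∩ Ω) f) : Sm Ω (fun x => θ x * f x) := by
  have hre : ContDiff ℝ Qe θ := by
    have := Complex.reCLM.contDiff.comp hθ.1
    simpa [Function.comp_def] using this
  intro x hx
  refine ContDiffAt.contDiffWithinAt ?_
  by_cases hxU : x ∈ U
  · exact hre.contDiffAt.mul (hf.contDiffAt ((hU.inter hΩ).mem_nhds ⟨hxU, hx⟩))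
  · have h0 := notMem_tsupport_iff_eventuallyEq.1 (fun h => hxU (hθ.2.2 h))
    refine contDiffAt_const (c := (0:ℝ)) |>.congr_of_eventuallyEq ?_
    filter_upwards [h0] with y hy
    have : θ y = 0 := by simpa using hy
    simp [this]
theorem loc0 (h : f =ᶠ[𝓝 z] fun _ => 0) : Dx ξ f z = 0 ∧ Hx ξ f z = 0 := by
  have h1 : ∀ᶠ x in 𝓝 z, Dx ξ f x = 0 := by
    filter_upwards [h.eventually_nhds] with x hx
    have : Hc =ᶠ[𝓝 x] fun _ => 0 := by filter_upwards [hx] with y hy; simp [hy]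
    rw [Dx, DD_congr this]; simp [DD, wD_const]
  refine ⟨h1.self_of_nhds, ?_⟩
  rw [Hx, DD_congr (g := fun _ => 0) h1]; simp [DD, wD_const]
theorem step_ev {l : Qa → ℝ} (h : ContinuousAt l z) :
    ∀ᶠ k : ℕ in atTop, ∀ᶠ x in 𝓝 z, Real.smoothTransition (l x / Tn - 1) = 0 := by
  obtain ⟨N, hN⟩ := exists_nat_gt (l z)
  filter_upwards [eventually_ge_atTop N] with k hk
  filter_upwards [h.eventually_lt continuousAt_const hN] with x hx
  refine Real.smoothTransition.zero_of_nonpos ?_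
  have : (N : ℝ) ≤ k := by exact_mod_cast hk
  rw [sub_nonpos, div_le_one Qt]; linarith
theorem step_sm {l : Qa → ℝ} (h : Sm Ω l) (k : ℕ) : Sm Ω (fun x => Real.smoothTransition (l x / Tn - 1)) :=
  Real.smoothTransition.contDiff.comp_contDiffOn ((h.div_const _).sub contDiffOn_const)
theorem step_D {l : Qa → ℝ} (hΩ : IsOpen Ω) (h : Sm Ω l) (hz : z ∈ Ω) {R : ℝ}
    (hR : ∀ t, |deriv Real.smoothTransition t| ≤ R) (k : ℕ) :
    ‖Dx ξ (fun x => Real.smoothTransition (l x / Tn - 1)) z‖ ≤ R * ‖Dx ξ l z‖ := by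
  have hd : HasDerivAt (fun t : ℝ => Real.smoothTransition (t / Tn - 1))
      (deriv Real.smoothTransition (l z / Tn - 1) * (1 / Tn)) (l z) :=
    ((Real.smoothTransition.contDiff (n := 1)).differentiable Qy _).hasDerivAt.comp (l z)
      (((hasDerivAt_id (l z)).div_const _).sub_const 1)
  rw [Dx_comp (G := fun t : ℝ => Real.smoothTransition (t / Tn - 1))
    ((h.contDiffAt Ya).differentiableAt Qy) hd, norm_mul, Complex.norm_real, norm_mul]
  refine mul_le_mul_of_nonneg_right ?_ Tx
  have h1 : ‖(1 / Tn : ℝ)‖ ≤ 1 := by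
    rw [Real.norm_of_nonneg Qt, div_le_one Qt]
    have : (0:ℝ) ≤ k := by positivity
    linarith
  calc _ ≤ R * 1 := mul_le_mul (hR _) h1 Tx ((abs_nonneg _).trans (hR 0))
    _ = R := mul_one R
theorem bpiece (hΩ : IsOpen Ω) (hf : Sm Ω f) (h0 : ∀ x ∈ Ω, f x < 0) (h : ∀ x ∈ Ω, ∀ ξ, 0 ≤ Hx ξ f x) :
    ∃ A, Piece Ω Tz A
      (fun k x => 2 * Real.smoothTransition Uc) := by
  obtain ⟨R, hR0, hR⟩ := step_bd
  have hb : Sm Ω Tz :=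
    contDiffOn_const.mul (hf.neg.log fun x hx => (by linarith [h0 x hx] : (0:ℝ) < -f x).ne')
  have hk : ∀ z ∈ Ω, ∀ ξ, ‖Dx ξ Tz z‖^2 ≤ Hx ξ Tz z := by
    intro z hz ξ
    have := neglog hΩ hz hf h0 (h z hz ξ)
    rw [Hx_cmul]
    have e : Dx ξ Tz z = ((-1 : ℝ) : ℂ) * Dx ξ (fun x => Real.log (-f x)) z := by
      simp only [Dx, Complex.ofReal_mul]; exact DD_const_mul _
    rw [e, norm_mul, Complex.norm_real]
    simpa using this
  refine ⟨4 * R^2, by positivity, hb, fun k => contDiffOn_const.mul (step_sm hb k),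
    fun k z hz => mul_nonneg To (Real.smoothTransition.nonneg _), fun z hz => ?_, fun z hz ξ => ?_, fun k z hz ξ => ?_⟩
  · filter_upwards [step_ev (hb.contDiffAt Ya).continuousAt] with k hk
    filter_upwards [hk] with x hx
    rw [hx, mul_zero]
  · have := (sq_nonneg _).trans (hk z hz ξ)
    have := Nx_nonneg (ξ := ξ)
    positivity
  · have e : Dx ξ (fun x => 2 * Real.smoothTransition Uc) z = ((2 : ℝ) : ℂ) * Dx ξ (fun x => Real.smoothTransition Uc) z := by
      simp only [Dx, Complex.ofReal_mul]; exact DD_const_mul _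
    rw [e, norm_mul, mul_pow]
    have h1 := pow_le_pow_left₀ Tx (step_D (ξ := ξ) hΩ hb hz hR k) 2
    rw [mul_pow] at h1
    have h2 := mul_le_mul_of_nonneg_left (hk z hz ξ) (sq_nonneg R)
    have h3 : ‖((2:ℝ) : ℂ)‖^2 = 4 := by norm_num
    have h4 : 0 ≤ (4 * R^2) * ((4 * R^2) * Nx ξ) := by have := Nx_nonneg (ξ := ξ); positivity
    rw [h3]; linarith
end pieces2
section pieces3
open scoped Matrix
variable {n : ℕ} {B Z : Set Qa}
theorem open_diff (hB : IsOpen B) (hZ : IsAnalyticIn Z B) : IsOpen (B \ Z) := by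
  refine isOpen_iff_mem_nhds.2 fun z hz => ?_
  obtain ⟨U, hU, m, F, hF, he⟩ := hZ.2 z hz.1
  have : ∃ i, F i z ≠ 0 := by
    by_contra h; push Not at h
    have : z ∈ Z ∩ U := he ▸ ⟨mem_of_mem_nhds hU, h⟩
    exact hz.2 this.1
  obtain ⟨i, hi⟩ := this
  filter_upwards [hB.mem_nhds hz.1, hU, (((hF i).differentiableAt hU).continuousAt.eventually_ne hi)] with x h1 h2 h3
  refine ⟨h1, fun hx => h3 ?_⟩
  have : x ∈ {w ∈ U | ∀ i, F i w = 0} := he ▸ ⟨hx, h2⟩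
  exact this.2 i
theorem quad_aux {θ h H D E A R N P Q T : ℝ} (hθ : 0 ≤ θ) (h0 : 0 ≤ h) (h1 : h ≤ 1) (hN : 0 ≤ N) (hA : 0 ≤ A)
    (hH : E ^ 2 ≤ H) (hT : T ^ 2 ≤ H) (hD : D ^ 2 ≤ A * N) (hP : |P| ≤ A * N) (hQ : |Q| ≤ 2 * θ * D * E) :
    θ ^ 2 * H / 2 - 9 * A * N ≤ P * h + θ * θ * H + 2 * Q ∧
    (2 * (D + θ * (R * T))) ^ 2 ≤ 8 * A * N + 8 * R ^ 2 * (θ ^ 2 * H) := by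
  have a1 := neg_le_of_abs_le hP
  have a2 := neg_le_of_abs_le hQ
  have a3 : -(A * N) ≤ P * h := by nlinarith [mul_nonneg hA hN]
  have a4 := mul_le_mul_of_nonneg_left hH (sq_nonneg θ)
  have a5 := mul_le_mul_of_nonneg_left hT (sq_nonneg (θ * R))
  constructor
  · nlinarith [sq_nonneg (θ * E - 4 * D)]
  · nlinarith [sq_nonneg (D - θ * (R * T))]
theorem zpiece (hB : IsOpen B) (hZ : IsAnalyticIn Z B) {z₀ : Qa} (hz₀ : z₀ ∈ B) :
    ∃ W, IsOpen W ∧ z₀ ∈ W ∧ ∃ q A a, Piece (B \ Z) q A a ∧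
      ∀ k, ∀ z ∈ Z ∩ W, ∀ᶠ x in 𝓝 z, x ∉ Z → 2 ≤ a k x := by
  have hΩ := open_diff hB hZ
  set Ω := B \ Z with hΩdef
  obtain ⟨U, hU, m, F, hF, he⟩ := hZ.2 z₀ hz₀
  obtain ⟨r, hr, hrU⟩ := Metric.nhds_basis_closedBall.mem_iff.1 hU
  have hball : Metric.ball z₀ r ⊆ U := Metric.ball_subset_closedBall.trans hrU
  have hcont : ContinuousOn Te (Metric.closedBall z₀ r) :=
    continuousOn_finsetSum _ fun i _ => ((hF i).continuousOn.mono hrU).norm.pow 2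
  obtain ⟨M, hM⟩ := (isCompact_closedBall z₀ r).exists_bound_of_continuousOn hcont
  have hM0 : 0 ≤ M := (norm_nonneg _).trans (hM z₀ (by simp [hr.le]))
  set κ : ℝ := √(Real.exp (-Real.exp 1) / (M + 1)) with hκ
  have hκ0 : 0 < κ := Real.sqrt_pos.2 Qt
  have hκ2 : κ ^ 2 = Real.exp (-Real.exp 1) / (M + 1) := Real.sq_sqrt Qt
  set F' : Fin m → Qc := fun i x => (κ : ℂ) * F i x with hF'
  set τ : Qa → ℝ := fun x => ∑ i, ‖F' i x‖^2 with hτ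
  set V := Metric.ball z₀ r ∩ Ω with hV
  have hVo : IsOpen V := Metric.isOpen_ball.inter hΩ
  have hF'd : ∀ i, DifferentiableOn ℂ (F' i) (Metric.ball z₀ r) := fun i => ((hF i).mono hball).const_mul _
  have hF'V : ∀ i, DifferentiableOn ℂ (F' i) V := fun i => (hF'd i).mono Set.inter_subset_left
  have τe : ∀ x, τ x = κ ^ 2 * ∑ i, ‖F i x‖^2 := fun x => by
    simp only [hτ, hF', norm_mul, mul_pow, Finset.mul_sum, Complex.norm_real, Real.norm_eq_abs, sq_abs]
  have τpos : ∀ x ∈ Metric.ball z₀ r, x ∉ Z → 0 < τ x := fun x hx hxZ => by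
    rw [τe]
    refine mul_pos Qt ?_
    by_contra h
    have h0 := le_antisymm (not_lt.1 h) (Finset.sum_nonneg fun i _ => by positivity)
    rw [Finset.sum_eq_zero_iff_of_nonneg fun i _ => by positivity] at h0
    have : x ∈ Z ∩ U := by
      rw [he]; exact ⟨hball hx, fun i => by simpa using h0 i (Finset.mem_univ i)⟩
    exact hxZ this.1
  have τle : ∀ x ∈ Metric.ball z₀ r, τ x ≤ Real.exp (-Real.exp 1) := fun x hx => by
    rw [τe, hκ2, div_mul_eq_mul_div, div_le_iff₀ Qt]
    refine mul_le_mul_of_nonneg_left ?_ (Real.exp_pos _).le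
    have := (le_abs_self _).trans (hM x (Metric.ball_subset_closedBall hx))
    linarith
  have τV : ∀ x ∈ V, 0 < τ x := fun x hx => τpos x hx.1 hx.2.2
  have tle : ∀ x ∈ V, Real.log (τ x) ≤ -Real.exp 1 := fun x hx => by
    rw [Real.log_le_iff_le_exp (τV x hx)]; exact τle x hx.1
  have tneg : ∀ x ∈ V, Real.log (τ x) < 0 := fun x hx => (tle x hx).trans_lt (by simp [Real.exp_pos])
  set L : Qa → ℝ := fun x => Real.log (-Real.log (τ x)) with hL
  have L1 : ∀ x ∈ V, 1 ≤ L x := fun x hx => by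
    rw [hL]; simp only
    rw [Real.le_log_iff_exp_le (by linarith [tneg x hx])]; linarith [tle x hx]
  have τs : Sm V τ := tau_sm hVo hF'V
  have ts : Sm V (fun x => Real.log (τ x)) := τs.log fun x hx => (τV x hx).ne'
  have Ls : Sm V L := ts.neg.log fun x hx => (by linarith [tneg x hx] : (0:ℝ) < -Real.log (τ x)).ne'
  have lLs : Sm V Uk := Ls.log fun x hx => by linarith [L1 x hx]
  have hs : Sm V Qz := Ls.inv fun x hx => by linarith [L1 x hx]
  have key : ∀ x ∈ V, ∀ ξ, ‖Dx ξ Uk x‖^2 ≤ Hx ξ Qz x ∧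
    ‖Dx ξ Qz x‖^2 ≤ Hx ξ Qz x := fun x hx ξ =>
    inv_psh hVo hx Ls L1 (neglog hVo hx ts tneg (log_psh hVo hx τs τV (tau_cs hVo hx hF'V)))
  obtain ⟨θ, hθ, hθ01, hθ1⟩ := test_cut (Metric.isOpen_ball (x := z₀) (ε := r)) (isCompact_closedBall z₀ (r/2))
    (Metric.closedBall_subset_ball Yr)
  obtain ⟨A, hA0, hA⟩ := bd_test (hθ.mono (Set.subset_univ _))
  obtain ⟨R, hR0, hR⟩ := step_bd
  have hθs : ContDiff ℝ Qe θ := by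
    have := Complex.reCLM.contDiff.comp hθ.1
    simpa [Function.comp_def] using this
  have out : ∀ (x : Qa) (g : Qa → ℝ), x ∉ Metric.ball z₀ r → (fun x => θ x * g x) =ᶠ[𝓝 x] fun _ => 0 := by
    intro x g hx
    have h0 := notMem_tsupport_iff_eventuallyEq.1 (fun h => hx (hθ.2.2 h))
    filter_upwards [h0] with y hy
    have : θ y = 0 := by simpa using hy
    simp [this]
  set S : ℕ → Qa → ℝ := fun k x => Real.smoothTransition (Real.log (L x) / Tn - 1) with hS
  have hθV : Sm V θ := hθs.contDiffOn
  have main : ∀ k, ∀ x ∈ Ω, ∀ ξ, 0 ≤ Hx ξ Hj x + Hn * Nx ξ ∧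
      ‖Dx ξ (fun x => θ x * (2 * S k x)) x‖^2 ≤ Hn * (Hx ξ Hj x + Hn * Nx ξ) := by
    intro k x hx ξ
    have hN := Nx_nonneg (ξ := ξ)
    by_cases hxb : x ∈ Metric.ball z₀ r
    · have hxV : x ∈ V := ⟨hxb, hx⟩
      have e1 : Hj = fun x => (θ x * θ x) * (L x)⁻¹ := by funext x; ring
      rw [e1, Hx_mul hVo (hθV.mul hθV) hs hxV, Dx_mul hVo hθV hθV hxV,
        Dx_mul hVo hθV (contDiffOn_const.mul (step_sm lLs k)) hxV]
      have e2 : Dx ξ (fun x => 2 * S k x) x = ((2:ℝ):ℂ) * Dx ξ (S k) x := by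
        simp only [Dx, Complex.ofReal_mul]; exact DD_const_mul _
      have hSD := step_D (ξ := ξ) hVo lLs hxV hR k
      have hL1 := L1 x hxV
      obtain ⟨q1, q2⟩ := quad_aux (R := R) (Q := (star (Dx ξ θ x * (θ x : ℂ) + (θ x : ℂ) * Dx ξ θ x) * Dx ξ Qz x).re)
        (hθ01 x).1 (inv_nonneg.2 Yr) (inv_le_one_of_one_le₀ hL1) hN hA0
        (key x hxV ξ).2 (key x hxV ξ).1 (hA x ξ).1 (hA x ξ).2 (by
          refine (Complex.abs_re_le_norm _).trans (le_of_eq ?_)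
          have : Dx ξ θ x * (θ x : ℂ) + (θ x : ℂ) * Dx ξ θ x = 2 * (θ x : ℂ) * Dx ξ θ x := by ring
          rw [this, norm_mul, norm_star, norm_mul, norm_mul, Complex.norm_real, Real.norm_of_nonneg (hθ01 x).1]; simp)
      have q3 : ‖Dx ξ θ x * ((2 * S k x : ℝ) : ℂ) + (θ x : ℂ) * Dx ξ (fun x => 2 * S k x) x‖ ≤
          2 * (‖Dx ξ θ x‖ + θ x * (R * ‖Dx ξ Uk x‖)) := by
        rw [e2]
        refine (norm_add_le _ _).trans ?_
        rw [norm_mul, norm_mul, norm_mul, Complex.norm_real, Complex.norm_real, Complex.norm_real, Real.norm_of_nonneg (hθ01 x).1,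
          Real.norm_of_nonneg (mul_nonneg zero_le_two (Real.smoothTransition.nonneg _)), Real.norm_of_nonneg zero_le_two]
        have b1 := mul_le_mul_of_nonneg_left (Real.smoothTransition.le_one (Real.log (L x) / Tn - 1)) (norm_nonneg (Dx ξ θ x))
        have b2 := mul_le_mul_of_nonneg_left hSD (hθ01 x).1
        simp only [hS] at *
        linarith
      have q4 := (pow_le_pow_left₀ Tx q3 2).trans q2
      have q5 : 0 ≤ θ x ^ 2 * Hx ξ Qz x := mul_nonneg (sq_nonneg _) ((sq_nonneg _).trans (key x hxV ξ).1)
      have hAN := mul_nonneg hA0 hN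
      have hRN := mul_nonneg (sq_nonneg R) hN
      refine ⟨by nlinarith, q4.trans ?_⟩
      have q6 : θ x ^ 2 * Hx ξ Qz x / 2 + Nx ξ ≤ Hx ξ Ho x * (L x)⁻¹ +
          θ x * θ x * Hx ξ Qz x + 2 * (star (Dx ξ θ x * (θ x : ℂ) + (θ x : ℂ) * Dx ξ θ x) *
            Dx ξ Qz x).re + Hn * Nx ξ := by
        nlinarith [q1, hRN]
      refine le_trans ?_ (mul_le_mul_of_nonneg_left q6 (by positivity : 0 ≤ 9 * A + 16 * R^2 + 1))
      nlinarith [mul_nonneg hA0 q5]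
    · rw [(loc0 (out x _ hxb)).2, (loc0 (out x _ hxb)).1]
      simp only [norm_zero, zero_add]
      exact ⟨by positivity, by norm_num; positivity⟩
  refine ⟨Metric.ball z₀ (r/2), Metric.isOpen_ball, by simp [hr], fun x => θ x * (θ x * (L x)⁻¹), 9 * A + 16 * R^2 + 1,
    fun k x => θ x * (2 * S k x), ⟨by positivity, sm_cut Metric.isOpen_ball hΩ hθ (hθV.mul hs),
    fun k => sm_cut Metric.isOpen_ball hΩ hθ (contDiffOn_const.mul (step_sm lLs k)),
    fun k x _ => mul_nonneg (hθ01 x).1 (mul_nonneg zero_le_two (Real.smoothTransition.nonneg _)), fun x hx => ?_,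
    fun x hx ξ => (main 0 x hx ξ).1, fun k x hx ξ => (main k x hx ξ).2⟩, fun k x hx => ?_⟩
  · by_cases hxb : x ∈ Metric.ball z₀ r
    · filter_upwards [step_ev (lLs.contDiffAt (hVo.mem_nhds ⟨hxb, hx⟩)).continuousAt] with k hk
      filter_upwards [hk] with y hy
      simp only [hS, hy, mul_zero]
    · exact Eventually.of_forall fun k => out x _ hxb
  · have hxr : x ∈ Metric.ball z₀ r := Metric.ball_subset_ball Yr hx.2
    have h0 : τ x = 0 := by
      have : x ∈ {w ∈ U | ∀ i, F i w = 0} := he ▸ ⟨hx.1, hball hxr⟩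
      rw [τe, Finset.sum_eq_zero fun i _ => by simp [this.2 i], mul_zero]
    have hc : ContinuousAt τ x :=
      (tau_sm Metric.isOpen_ball hF'd).continuousOn.continuousAt (Metric.isOpen_ball.mem_nhds hxr)
    have hlt : τ x < Real.exp (-Real.exp (Real.exp (2 * Tn))) := by rw [h0]; positivity
    filter_upwards [hc.eventually_lt continuousAt_const hlt, Metric.isOpen_ball.mem_nhds hx.2, Metric.isOpen_ball.mem_nhds hxr]
      with y h1 h2 h3 h4
    have h5 := τpos y h3 h4
    have h6 : Real.exp (Real.exp (2 * Tn)) < -Real.log (τ y) := by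
      have := (Real.log_lt_iff_lt_exp h5).2 h1; linarith
    have h7 : Real.exp (2 * Tn) < L y := (Real.lt_log_iff_exp_lt ((Real.exp_pos _).trans h6)).2 h6
    have h8 : 2 * Ht < Real.log (L y) := (Real.lt_log_iff_exp_lt ((Real.exp_pos _).trans h7)).2 h7
    rw [hθ1 y (Metric.ball_subset_closedBall h2)]
    simp only [hS]
    rw [Real.smoothTransition.one_of_one_le]
    · norm_num
    · rw [le_sub_iff_add_le, le_div_iff₀ Qt]; linarith
end pieces3
section pieces4
open scoped Matrix
variable {n : ℕ} {Ω : Set Qa} {z ξ : Qa}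
theorem Nx_H (hΩ : IsOpen Ω) (hz : z ∈ Ω) : Hx ξ (fun x => ∑ i, ‖x i‖^2) z = Nx ξ := by
  have hF : ∀ i : Fin n, DifferentiableOn ℂ (fun x : Qa => x i) Ω := fun i => by fun_prop
  rw [(tau_H hΩ hz hF).2]
  refine scg fun i _ => ?_
  have hd : ∀ l, wD (-Complex.I) l (fun x : Qa => x i) z = if i = l then 1 else 0 := by
    intro l
    have : fderiv ℝ (fun x : Qa => x i) z = ContinuousLinearMap.proj i :=
      (ContinuousLinearMap.proj (R := ℝ) (φ := fun _ : Fin n => ℂ) i).hasFDerivAt.fderiv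
    simp only [wD, this, ContinuousLinearMap.proj_apply, Pi.single_apply]
    split_ifs
    · rw [neg_mul, Complex.I_mul_I]; norm_num
    · simp
  simp [DD, hd]
theorem cut_of_pieces {ι : Type} [Fintype ι] (hΩ : IsOpen Ω) {q : ι → Qa → ℝ} {A : ι → ℝ}
    {a : ι → ℕ → Qa → ℝ} (hp : ∀ i, Piece Ω (q i) (A i) (a i))
    (hK : ∀ k, ∃ K, IsCompact K ∧ K ⊆ Ω ∧ ∀ z ∈ Ω, (∀ i, a i k z < 2) → z ∈ K) :
    ∃ s C χ, Sm Ω s ∧ (∀ z ∈ Ω, (cHess s z).PosSemidef) ∧ Cut Ω (cHess s) C χ := by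
  classical
  obtain ⟨R, hR0, hR⟩ := step_bd
  set c := ∑ i, A i with hc
  have hN : Sm Ω (fun x => c * ∑ i, ‖x i‖^2) := contDiffOn_const.mul (tau_sm hΩ fun i => by fun_prop)
  have hQ : Sm Ω (fun x => ∑ i, q i x) := ContDiffOn.sum fun i _ => (hp i).qs
  have hs : Sm Ω (fun x => c * (∑ i, ‖x i‖^2) + ∑ i, q i x) := hN.add hQ
  have hH : ∀ z ∈ Ω, ∀ ξ, Hx ξ (fun x => c * (∑ i, ‖x i‖^2) + ∑ i, q i x) z = ∑ i, (Hx ξ (q i) z + A i * Nx ξ) := by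
    intro z hz ξ
    rw [Hx_add hΩ hN hQ hz, Hx_cmul, Nx_H hΩ hz, Hx_sum _ hΩ hz fun i => (hp i).qs, Finset.sum_add_distrib, ← Finset.sum_mul, add_comm]
  set β : ℕ → Qa → ℝ := fun k x => ∑ i, a i k x with hβ
  have hβs : ∀ k, Sm Ω (β k) := fun k => ContDiffOn.sum fun i _ => (hp i).as k
  set χ : ℕ → Qa → ℝ := fun k x => if x ∈ Ω then Real.smoothTransition (2 - β k x) else 0 with hχ
  have hle : ∀ k x, |χ k x| ≤ 1 := fun k x => by
    simp only [hχ]; split_ifs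
    · rw [abs_of_nonneg (Real.smoothTransition.nonneg _)]; exact Real.smoothTransition.le_one _
    · simp
  have hloc : ∀ k, ∀ z ∈ Ω, χ k =ᶠ[𝓝 z] fun x => Real.smoothTransition (2 - β k x) := fun k z hz => by
    filter_upwards [hΩ.mem_nhds hz] with x hx; simp only [hχ, if_pos hx]
  have htest : ∀ k, IsTest Ω Ub := by
    intro k
    obtain ⟨K, hKc, hKΩ, hKs⟩ := hK k
    have h0 : ∀ x, x ∉ K → χ k x = 0 := by
      intro x hx
      by_cases hxΩ : x ∈ Ω
      · simp only [hχ, if_pos hxΩ]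
        have : ∃ i, 2 ≤ a i k x := by by_contra h; push Not at h; exact hx (hKs x hxΩ h)
        obtain ⟨i, hi⟩ := this
        have := Finset.single_le_sum (f := fun i => a i k x) (fun i _ => (hp i).a0 k x hxΩ) (Finset.mem_univ i)
        exact Real.smoothTransition.zero_of_nonpos (by simp only [hβ]; linarith)
      · simp only [hχ, if_neg hxΩ]
    have ht : tsupport Ub ⊆ K := closure_minimal (fun x hx => by
      by_contra h; exact hx (by simp [h0 x h])) hKc.isClosed
    refine ⟨contDiff_iff_contDiffAt.2 fun x => ?_, hKc.of_isClosed_subset (isClosed_tsupport _) ht, ht.trans hKΩ⟩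
    by_cases hx : x ∈ Ω
    · have h1 : Sm Ω (fun x => Real.smoothTransition (2 - β k x)) :=
        Real.smoothTransition.contDiff.comp_contDiffOn (contDiffOn_const.sub (hβs k))
      refine ((ofReal_sm h1).contDiffAt (hΩ.mem_nhds hx)).congr_of_eventuallyEq ?_
      filter_upwards [hloc k x hx] with y hy; rw [hy]
    · refine (contDiffAt_const (c := (0:ℂ))).congr_of_eventuallyEq ?_
      filter_upwards [hKc.isClosed.isOpen_compl.mem_nhds fun h => hx (hKΩ h)] with y hy
      rw [h0 y hy]; simp
  have hT : ∀ z ∈ Ω, ∀ ξ i, 0 ≤ Hx ξ (q i) z + A i * Nx ξ := fun z hz ξ i => (hp i).pos z hz ξ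
  refine ⟨_, R^2 * (Fintype.card ι * c), χ, hs, fun z hz => psd_of_Hx hΩ hs hz fun ξ => ?_,
    ⟨mul_nonneg (sq_nonneg _) (mul_nonneg (Nat.cast_nonneg _) (Finset.sum_nonneg fun i _ => (hp i).A0)), htest, fun z hz => ?_, fun k z _ => hle k z, fun k z hz ξ => ?_⟩⟩
  · rw [hH z hz]; exact Finset.sum_nonneg fun i _ => hT z hz ξ i
  · have := eventually_all.2 fun i => (hp i).ev z hz
    filter_upwards [this] with k hk
    filter_upwards [eventually_all.2 hk, hloc k z hz] with x hx h
    rw [h]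
    simp only [hβ, hx, Finset.sum_const_zero]
    exact Real.smoothTransition.one_of_one_le To
  · rw [Hx_eq hΩ hs hz, hH z hz]
    have e1 : ∑ l, wDzbar l Ub z * ξ l = Dx ξ (fun x => Real.smoothTransition (2 - β k x)) z := by
      have : Ub =ᶠ[𝓝 z] fun x => ((Real.smoothTransition (2 - β k x) : ℝ) : ℂ) := by
        filter_upwards [hloc k z hz] with y hy; rw [hy]
      rw [Dx, ← DD_congr this]; simp only [DD, wDzbar_eq]
    have hd : HasDerivAt (fun t : ℝ => Real.smoothTransition (2 - t)) (-deriv Real.smoothTransition (2 - β k z)) (β k z) := by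
      have h1 := (Real.smoothTransition.contDiff (n := 1)).differentiable To (2 - β k z)
      simpa using h1.hasDerivAt.comp_const_sub 2 (β k z)
    rw [e1, Dx_comp (((hβs k).contDiffAt Ya).differentiableAt Qy) hd,
      Dx_sum _ hΩ hz fun i => (hp i).as k, norm_mul, mul_pow, Complex.norm_real, norm_neg]
    have h2 : ‖∑ i, Dx ξ (a i k) z‖^2 ≤ Fintype.card ι * ∑ i, ‖Dx ξ (a i k) z‖^2 := by
      refine (pow_le_pow_left₀ Tx (norm_sum_le _ _) 2).trans ?_
      simpa using sq_sum_le_card_mul_sum_sq (s := Finset.univ) (f := fun i => ‖Dx ξ (a i k) z‖)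
    have h3 : ∑ i, ‖Dx ξ (a i k) z‖^2 ≤ c * ∑ i, (Hx ξ (q i) z + A i * Nx ξ) := by
      rw [Finset.mul_sum]
      refine Finset.sum_le_sum fun i _ => ((hp i).gr k z hz ξ).trans (mul_le_mul_of_nonneg_right ?_ (hT z hz ξ i))
      exact Finset.single_le_sum (f := A) (fun i _ => (hp i).A0) (Finset.mem_univ i)
    rw [mul_assoc, mul_assoc]
    refine mul_le_mul (pow_le_pow_left₀ Tx (hR _) 2) (h2.trans (mul_le_mul_of_nonneg_left h3 (Nat.cast_nonneg _))) Qt Qt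
end pieces4
section geom
variable {n : ℕ} {B B'' K V Z : Set Qa}
theorem poly (hK : IsCompact K) (hKB : K ⊆ B) {D : Set Qa} (hB : IsOpen B) (hD : IsCompact D) (hDB : D ⊆ B)
    (h : ∀ z ∈ D, ∃ f : Qa → ℂ, DifferentiableOn ℂ f B ∧ sSup ((fun w => ‖f w‖) '' K) < ‖f z‖) :
    ∃ (T : Finset Qa) (F : T → Qc), (∀ i, DifferentiableOn ℂ (F i) B) ∧
      (∀ w ∈ K, ∑ i, ‖F i w‖^2 < 1) ∧ ∀ w ∈ D, 1 < ∑ i, ‖F i w‖^2 := by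
  have h' : ∀ z : Qa, ∃ (f : Qc) (ρ : ℝ), DifferentiableOn ℂ f B ∧ 0 ≤ ρ ∧ ρ < 1 ∧ (∀ w ∈ K, ‖f w‖ ≤ ρ) ∧
      (z ∈ D → 1 < ‖f z‖) := by
    intro z
    by_cases hz : z ∈ D
    swap
    · exact ⟨fun _ => 0, 0, differentiableOn_const _, le_rfl, one_pos, fun _ _ => by simp, fun h => absurd h hz⟩
    obtain ⟨f, hf, hlt⟩ := h z hz
    set S := sSup ((fun w => ‖f w‖) '' K) with hS
    have hS0 : 0 ≤ S := Real.sSup_nonneg (by rintro _ ⟨w, -, rfl⟩; exact norm_nonneg _)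
    have ht : 0 < Hp / 2 := by linarith
    have hn : ∀ w, ‖f w / ((Hp / 2 : ℝ) : ℂ)‖ = ‖f w‖ / (Hp / 2) := fun w => by
      rw [norm_div, Complex.norm_real, Real.norm_of_nonneg ht.le]
    refine ⟨fun w => f w / ((Hp / 2 : ℝ) : ℂ), S / (Hp / 2), by simp only [div_eq_mul_inv]; exact hf.mul_const _, by positivity,
      (div_lt_one ht).2 Yr, fun w hw => ?_, fun _ => ?_⟩
    · rw [hn]
      gcongr
      exact le_csSup (hK.image_of_continuousOn (hf.continuousOn.mono hKB).norm).bddAbove ⟨w, hw, rfl⟩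
    · rw [hn, one_lt_div ht]; linarith
  choose f ρ hf h0 h1 hfK hfz using h'
  obtain ⟨T, hTD, hT⟩ := hD.elim_nhds_subcover (fun z => {w | 1 < ‖f z w‖}) fun z hz =>
    ((hf z).continuousOn.norm.continuousAt (hB.mem_nhds (hDB hz))).eventually_const_lt (hfz z hz)
  have hlim : Tendsto (fun N : ℕ => ∑ i : T, (ρ i ^ 2) ^ N) atTop Tf := by
    have := tendsto_finsetSum (f := fun (i : T) (N : ℕ) => (ρ i ^ 2) ^ N) (x := atTop) (a := fun _ => 0) Finset.univ fun i _ =>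
      tendsto_pow_atTop_nhds_zero_of_lt_one (sq_nonneg (ρ i)) (pow_lt_one₀ (h0 i) (h1 i) two_ne_zero)
    simpa using this
  obtain ⟨N, hN1, hN2⟩ := ((hlim.eventually_lt_const one_pos).and (eventually_gt_atTop 0)).exists
  refine ⟨T, fun i w => f i w ^ N, fun i => (hf i).pow N, fun w hw => lt_of_le_of_lt (Finset.sum_le_sum fun i _ => ?_) hN1, fun w hw => ?_⟩
  · rw [norm_pow, ← pow_mul, ← pow_mul, mul_comm]; exact pow_le_pow_left₀ Tx (hfK i w hw) _
  · obtain ⟨i, hi, hiw⟩ := Set.mem_iUnion₂.1 (hT hw)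
    refine lt_of_lt_of_le ?_ (Finset.single_le_sum (f := fun i : T => ‖f i w ^ N‖^2) (fun _ _ => by positivity) (Finset.mem_univ (⟨i, hi⟩ : T)))
    simp only [norm_pow, ← pow_mul]
    exact one_lt_pow₀ hiw (by omega)
theorem geom (hB : IsSteinOpen B) (hB'' : IsOpen B'') (hBB : B ⊆ B'') (hZ : IsAnalyticIn Z B'') (hK : IsCompact K) (hKB : K ⊆ B \ Z) :
    ∃ Ω, IsOpen Ω ∧ K ⊆ Ω ∧ Ω ⊆ B \ Z ∧ ∃ s C χ, Sm Ω s ∧ (∀ z ∈ Ω, (cHess s z).PosSemidef) ∧ Cut Ω (cHess s) C χ := by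
  classical
  have hKB' : K ⊆ B := fun z hz => (hKB hz).1
  set H := {z ∈ B | ∀ f : Qa → ℂ, DifferentiableOn ℂ f B → ‖f z‖ ≤ sSup ((fun w => ‖f w‖) '' K)} with hH
  obtain ⟨L, hL, hHL, hLB⟩ := exists_compact_between (hB.2 K hKB' hK) hB.1 (fun z hz => hz.1)
  set V := interior L with hV
  have hVL : closure V ⊆ L := closure_minimal interior_subset hL.isClosed
  have hKV : K ⊆ V := fun z hz => hHL ⟨hKB' hz, fun f hf =>
    le_csSup (hK.image_of_continuousOn (hf.continuousOn.mono hKB').norm).bddAbove ⟨z, hz, rfl⟩⟩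
  have hfr : frontier V ⊆ L := fun z hz => hVL hz.1
  have hVo : IsOpen V := isOpen_interior
  obtain ⟨T, F, hF, hFK, hFD⟩ := poly hK hKB' hB.1 (hL.of_isClosed_subset isClosed_frontier hfr) (hfr.trans hLB) (by
    intro z hz
    have : z ∉ H := fun h => (hVo.frontier_eq ▸ hz).2 (hHL h)
    by_contra hn
    push Not at hn
    exact this ⟨hLB (hfr hz), hn⟩)
  set τ : Qa → ℝ := fun x => ∑ i, ‖F i x‖^2 with hτ
  have hτs : Sm B τ := tau_sm hB.1 hF
  set Ω := ({x ∈ V | τ x < 1}) ∩ (B'' \ Z) with hΩd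
  have hVB : V ⊆ B := interior_subset.trans hLB
  have hΩ : IsOpen Ω :=
    ((hτs.continuousOn.mono hVB).isOpen_inter_preimage hVo isOpen_Iio).inter (open_diff hB'' hZ)
  have hΩB : Ω ⊆ B := fun z hz => hVB hz.1.1
  obtain ⟨A₀, hP⟩ := bpiece (f := fun x => τ x + (-1)) hΩ ((hτs.mono hΩB).add contDiffOn_const) (fun x hx => by linarith [hx.1.2])
    (fun x hx ξ => by
      rw [Hx_add hΩ (hτs.mono hΩB) contDiffOn_const hx]
      have e : Hx ξ (fun _ => (-1:ℝ)) x = 0 := by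
        have : Dx ξ (fun _ : Qa => (-1:ℝ)) = fun _ => 0 := by funext y; simp [Dx, DD, wD_const]
        rw [Hx, this]; simp [DD, wD_const]
      rw [e, add_zero, (tau_H hΩ hx fun i => (hF i).mono hΩB).2]; positivity)
  have hW : ∀ z : Qa, ∃ W, IsOpen W ∧ (z ∈ B'' → z ∈ W) ∧ ∃ q A a, Piece (B'' \ Z) q A a ∧
      ∀ k : ℕ, ∀ z ∈ Z ∩ W, ∀ᶠ x in 𝓝 z, x ∉ Z → 2 ≤ a k x := by
    intro z
    by_cases hz : z ∈ B''
    · obtain ⟨W, h1, h2, h3⟩ := zpiece hB'' hZ hz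
      exact ⟨W, h1, fun _ => h2, h3⟩
    · refine ⟨∅, isOpen_empty, fun h => absurd h hz, fun _ => 0, 0, fun _ _ => 0, ⟨le_rfl, contDiffOn_const, fun _ => contDiffOn_const, fun _ _ _ => le_rfl,
        fun _ _ => by simp, fun z _ ξ => ?_, fun k z _ ξ => ?_⟩, fun k z hz => absurd hz.2 (Set.notMem_empty z)⟩
      · rw [(loc0 EventuallyEq.rfl).2]; simp
      · rw [(loc0 EventuallyEq.rfl).1]; simp
  choose W hWo hzW q A a hpc hev using hW
  obtain ⟨T2, -, hT2⟩ := hL.elim_nhds_subcover W fun z hz => (hWo z).mem_nhds (hzW z (hBB (hLB hz)))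
  refine ⟨Ω, hΩ, fun z hz => ⟨⟨hKV hz, hFK z hz⟩, hBB (hKB' hz), (hKB hz).2⟩, fun z hz => ⟨hΩB hz, hz.2.2⟩, ?_⟩
  set a₀ : ℕ → Qa → ℝ := fun k x => 2 * Real.smoothTransition (((-1) * Real.log (-(τ x + (-1)))) / Tn - 1) with ha₀
  refine cut_of_pieces (ι := Option T2) hΩ
    (q := fun o => o.elim (fun x => (-1) * Real.log (-(τ x + (-1)))) fun j => q j) (A := fun o => o.elim A₀ fun j => A j) (a := fun o => o.elim a₀ fun j => a j)
    (fun o => by cases o with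
      | none => exact hP
      | some j => exact (hpc j).mono fun z hz => hz.2) fun k => ?_
  set S := {z ∈ Ω | ∀ o : Option T2, o.elim a₀ (fun j => a j) k z < 2} with hS
  have hSL : closure S ⊆ L := closure_minimal (fun z hz => interior_subset hz.1.1.1) hL.isClosed
  refine ⟨closure S, hL.of_isClosed_subset isClosed_closure hSL, fun z hz => ?_, fun z hz h => subset_closure ⟨hz, h⟩⟩
  have hzL := hSL hz
  have hτz : τ z ≤ 1 - Real.exp (-(2 * Tn)) := by
    have hcl : IsClosed (L ∩ τ ⁻¹' Set.Iic (1 - Real.exp (-(2 * Ht)))) :=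
      (hτs.continuousOn.mono hLB).preimage_isClosed_of_isClosed hL.isClosed isClosed_Iic
    refine (closure_minimal (s := S) (fun x hx => Set.mem_inter (interior_subset hx.1.1.1 : x ∈ L) ?_) hcl hz).2
    have h1 := hx.2 none
    have h2 : (1:ℝ) - τ x > 0 := by linarith [hx.1.1.2]
    simp only [Option.elim, ha₀] at h1
    have h3 : ((-1) * Real.log (-(τ x + (-1)))) / Tn - 1 < 1 := by
      by_contra h; push Not at h
      rw [Real.smoothTransition.one_of_one_le h] at h1; norm_num at h1
    rw [sub_lt_iff_lt_add, div_lt_iff₀ Qt, show -(τ x + (-1)) = 1 - τ x by ring] at h3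
    have h4 : -(2 * Ht) < Real.log (1 - τ x) := by linarith
    have := (Real.lt_log_iff_exp_lt h2).1 h4
    simp only [Set.mem_preimage, Set.mem_Iic]; linarith
  have hzτ : τ z < 1 := by linarith [Real.exp_pos (-(2 * Ht))]
  have hzV : z ∈ V := by
    by_contra hn
    have : z ∈ frontier V := by
      rw [hVo.frontier_eq]; exact ⟨closure_mono (fun x hx => hx.1.1.1) hz, hn⟩
    linarith [hFD z this]
  refine ⟨⟨hzV, hzτ⟩, hBB (hVB hzV), fun hzZ => ?_⟩
  obtain ⟨j, hj, hjW⟩ := Set.mem_iUnion₂.1 (hT2 hzL)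
  obtain ⟨x, hx1, hx2⟩ := ((mem_closure_iff_frequently.1 hz).and_eventually (hev j k z ⟨hzZ, hjW⟩)).exists
  have := hx1.2 (some ⟨j, hj⟩)
  simp only [Option.elim] at this
  linarith [hx2 hx1.1.2.2]
end geom
section apri
open scoped Matrix
variable {n r : ℕ} {Ω B B'' Z K : Set Qa} {Φ ψ s : Qa → ℝ}
theorem qf_add (M N : Qb) (x : Qa) : qf (M + N) x = qf M x + qf N x := by
  simp [qf, Matrix.add_mulVec]
theorem pick (hΩ : IsOpen Ω) (hΦ : Sm Ω Φ) (hs : Sm Ω s) (hg : Qd) (hK : IsCompact K) (hKΩ : K ⊆ Ω) :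
    ∃ δ : ℝ, 0 < δ ∧ ∀ z ∈ K, (cHess Φ z + ((-δ : ℝ) : ℂ) • cHess s z).PosSemidef := by
  have hc : ∀ {f : Qa → ℝ}, Sm Ω f → ContinuousOn (fun p : Qa × Qa => qf (cHess f p.1) p.2) (K ×ˢ Metric.sphere 0 1) := by
    intro f hf
    simp only [qf, dotProduct, Matrix.mulVec]
    refine Complex.continuous_re.comp_continuousOn (continuousOn_finsetSum _ fun i _ => ContinuousOn.mul ?_ (continuousOn_finsetSum _ fun j _ => ContinuousOn.mul ?_ ?_))
    · simp only [Pi.star_apply]; fun_prop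
    · exact ((cont_of_sm (cHess_sm hΩ hf i j)).mono hKΩ).comp continuousOn_fst fun p hp => hp.1
    · fun_prop
  have hcpt := hK.prod (isCompact_sphere (0 : Qa) 1)
  obtain ⟨c, hc0, hcF⟩ := hcpt.exists_forall_le' (hc hΦ) (a := 0) fun p hp => by
    have h0 : p.2 ≠ 0 := by rintro h; have := hp.2; simp [h] at this
    exact (Complex.lt_def.1 ((hg p.1 (hKΩ hp.1)).dotProduct_mulVec_pos h0)).1
  obtain ⟨C, hC⟩ := hcpt.exists_bound_of_continuousOn (hc hs)
  refine ⟨c / (|C| + 1), by positivity, fun z hz => ?_⟩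
  have hf : Sm Ω (fun x => Φ x + (-(c / (|C| + 1))) * s x) := hΦ.add (contDiffOn_const.mul hs)
  have e : cHess (fun x => Φ x + (-(c / (|C| + 1))) * s x) z = cHess Φ z + ((-(c / (|C| + 1)) : ℝ) : ℂ) • cHess s z := by
    rw [cHess_add hΩ hΦ (contDiffOn_const.mul hs) (hKΩ hz), cHess_smul]
  rw [← e]
  refine psd_of_Hx hΩ hf (hKΩ hz) fun ξ => ?_
  rw [← Hx_eq hΩ hf (hKΩ hz), e, qf_add, qf_smul]
  rcases eq_or_ne ξ 0 with rfl | h0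
  · simp [qf]
  have hn : 0 < ‖ξ‖ := norm_pos_iff.2 h0
  set η : Fin n → ℂ := ((‖ξ‖⁻¹ : ℝ) : ℂ) • ξ with hη
  have hη1 : η ∈ Metric.sphere (0 : Qa) 1 := by
    simp [hη, norm_smul, hn.ne']
  have hξ : ξ = ((‖ξ‖ : ℝ) : ℂ) • η := by
    rw [hη, smul_smul, ← Complex.ofReal_mul, mul_inv_cancel₀ hn.ne']; simp
  have h1 := hcF (z, η) ⟨hz, hη1⟩
  have h2 := (le_abs_self _).trans (hC (z, η) ⟨hz, hη1⟩)
  simp only at h1 h2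
  have hq : ∀ M, qf M ξ = ‖((‖ξ‖ : ℝ) : ℂ)‖^2 * qf M η := fun M => by conv_lhs => rw [hξ, qf_smul_vec M _ η]
  rw [hq, hq]
  have h3 : c / (|C| + 1) * qf (cHess s z) η ≤ c := by
    rw [div_mul_eq_mul_div, div_le_iff₀ Qt]
    exact mul_le_mul_of_nonneg_left (by linarith [le_abs_self C]) hc0.le
  have := mul_nonneg (sq_nonneg ‖((‖ξ‖ : ℝ) : ℂ)‖) (by linarith : 0 ≤ qf Qn η - c / (|C| + 1) * qf (cHess s z) η)
  linarith
theorem tp_two (M : Qb) (x) : qf (tp r (((2:ℝ) : ℂ) • M)) x = 2^r * qf (tp r M) x := by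
  have : tp r (((2:ℝ) : ℂ) • M) = ((2^r : ℝ) : ℂ) • tp r M := by
    ext J L; simp [tp, tpm, Finset.prod_mul_distrib]
  rw [this, qf_smul]
theorem apriori (hB : IsSteinOpen B) (hB'' : IsOpen B'') (hBB : B ⊆ B'') (hZ : IsAnalyticIn Z B'') (hΩd : Ω = B \ Z) (hΩ : IsOpen Ω)
    (hΦ : Sm Ω Φ) (hψ : Sm Ω ψ) (hg : Qd) (hg2 : ∀ z ∈ Ω, (cHess ψ z - cHess Φ z).PosSemidef)
    {X : Qp → Qc} (hX : ∀ I, IsTest Ω Yt) (hXA : ∀ z, Asym fun I => X I z)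
    {y : Qp → Qc} (hym : ∀ I, AEStronglyMeasurable (y I) Qr)
    (hyi : IntegrableOn Uj Ω)
    (hyA : ∀ z ∈ Ω, Asym fun I => y I z) (hcl : CL Ω y) :
    ‖∫ z in Ω, star Qq ⬝ᵥ Th‖^2 ≤
      (2^r * ∫ z in Ω, Real.exp (-ψ z) * qf Tu Qq) *
      ∫ z in Ω, qf Yg Qx := by
  set K := ⋃ I, tsupport Yt with hK
  have hKc : IsCompact K := isCompact_iUnion fun I => (hX I).2.1
  have hKΩ : K ⊆ Ω := Set.iUnion_subset fun I => (hX I).2.2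
  obtain ⟨Ω₀, hΩ₀, hKΩ₀, hΩ₀Ω, s, C, χ, hs, hsp, hχ⟩ := geom hB hB'' hBB hZ hKc (hΩd ▸ hKΩ)
  rw [← hΩd] at hΩ₀Ω
  have hΦ₀ := hΦ.mono hΩ₀Ω
  have hψ₀ := hψ.mono hΩ₀Ω
  have hg₀ : ∀ z ∈ Ω₀, (cHess Φ z).PosDef := fun z hz => hg z (hΩ₀Ω hz)
  obtain ⟨δ, hδ, hpick⟩ := pick hΩ₀ hΦ₀ hs hg₀ hKc hKΩ₀
  have hδs : Sm Ω₀ (fun x => δ * s x) := contDiffOn_const.mul hs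
  have hd : ∀ z ∈ Ω₀, cHess (fun x => Φ x + δ * s x) z = cHess Φ z + (δ : ℂ) • cHess s z := fun z hz => by
    rw [cHess_add hΩ₀ hΦ₀ hδs hz, cHess_smul]
  have hδp : ∀ z ∈ Ω₀, ((δ : ℂ) • cHess s z).PosSemidef := fun z hz => (hsp z hz).smul (by rw [Complex.zero_le_real]; exact hδ.le)
  have hpd : ∀ z ∈ Ω₀, (cHess (fun x => Φ x + δ * s x) z).PosDef := fun z hz => by
    rw [hd z hz]; exact (hg₀ z hz).add_posSemidef (hδp z hz)
  have hX₀ : ∀ I, IsTest Ω₀ Yt := fun I => ⟨(hX I).1, (hX I).2.1, (Set.subset_iUnion _ I).trans hKΩ₀⟩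
  have hXK : ∀ z, z ∉ K → ∀ I, z ∉ tsupport Yt := fun z hz I h => hz (Set.mem_iUnion.2 ⟨I, h⟩)
  have hdXK : ∀ z, z ∉ K → Qx = 0 := fun z hz => by
    funext J
    exact Finset.sum_eq_zero fun k _ => by rw [wDzbar_eq]; exact wD_zero_of_nmem (hXK z hz _)
  have hcut : Cut Ω₀ (cHess fun x => Φ x + δ * s x) (C / δ) χ := ⟨div_nonneg hχ.hC hδ.le, hχ.test, hχ.one, hχ.le, fun j z hz ξ => by
    refine (hχ.grad j z hz ξ).trans ?_
    rw [hd z hz, qf_add, qf_smul]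
    have := mul_nonneg (div_nonneg hχ.hC hδ.le) (qf_nonneg (hg₀ z hz).posSemidef ξ)
    have e : C / δ * (δ * qf (cHess s z) ξ) = C * qf (cHess s z) ξ := by field_simp
    rw [mul_add, e]; linarith⟩
  have hcl₀ : CL Ω₀ y := fun M η hη => by
    have hη' : IsTest Ω η := ⟨hη.1, hη.2.1, hη.2.2.trans hΩ₀Ω⟩
    rw [← hcl M η hη']
    refine (setIntegral_eq_of_subset_of_forall_sdiff_eq_zero hΩ.measurableSet hΩ₀Ω fun z hz => ?_).symm
    have : ∀ l, wDz l η z = 0 := fun l => by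
      rw [wDz_eq]; exact wD_zero_of_nmem fun h => hz.2 (hη.2.2 h)
    simp [Alt, this]
  have h := core hΩ₀ (hΦ₀.add hδs) hψ₀ hpd (g := cHess Φ) (fun i j => cont_of_sm (cHess_sm hΩ₀ hΦ₀ i j)) hg₀
    (fun z hz => by rw [hd z hz]; simpa using hδp z hz) (fun z hz => hg2 z (hΩ₀Ω hz)) hcut hX₀ hXA
    (fun I => (hym I).mono_measure (Measure.restrict_mono hΩ₀Ω le_rfl)) (hyi.mono_set hΩ₀Ω) (fun z hz => hyA z (hΩ₀Ω hz)) hcl₀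
  have e1 : ∫ z in Ω, star Qq ⬝ᵥ Th = ∫ z in Ω₀, star Qq ⬝ᵥ Th := by
    refine setIntegral_eq_of_subset_of_forall_sdiff_eq_zero hΩ.measurableSet hΩ₀Ω fun z hz => ?_
    have : ∀ I, X I z = 0 := fun I => image_eq_zero_of_notMem_tsupport fun h => hz.2 ((hX₀ I).2.2 h)
    simp [dotProduct, this]
  have n1 : ∀ z ∈ Ω, 0 ≤ Real.exp (-ψ z) * qf Tu Qq := fun z hz =>
    mul_nonneg (Real.exp_pos _).le (qf_nonneg (tpm_psd fun _ => (hg z hz).posSemidef.inv) _)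
  have n2 : ∀ z ∈ Ω, 0 ≤ qf Yg Qx := fun z hz => qf_nonneg (mW_pd Tp).posSemidef _
  have i2 : IntegrableOn (fun z => qf Yg Qx) Ω := (WL.test hΩ Hz (test_dX hX)).2
  have b1 := setIntegral_mono_set hyi ((ae_restrict_iff' hΩ.measurableSet).2 (ae_of_all _ n1)) hΩ₀Ω.eventuallyLE
  have b2 := setIntegral_mono_set i2 ((ae_restrict_iff' hΩ.measurableSet).2 (ae_of_all _ n2)) hΩ₀Ω.eventuallyLE
  have b3 : ∫ z in Ω₀, Real.exp Tb * qf (tp r (cHess (fun x => Φ x + δ * s x) z)) Qx ≤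
      ∫ z in Ω₀, 2^r * qf Yg Qx := by
    refine setIntegral_mono_on ?_ ((i2.mono_set hΩ₀Ω).const_mul _) hΩ₀.measurableSet fun z hz => ?_
    · have := (WL.test hΩ₀ (mW_sm hΩ₀ (hΦ₀.add hδs) hψ₀) (test_dX hX₀)).2
      simpa only [mW, qf_smul] using this
    · by_cases hzK : z ∈ K
      · rw [mW, qf_smul, mul_left_comm, ← tp_two]
        refine mul_le_mul_of_nonneg_left (qf_mono (tpm_mono (fun _ => (hpd z hz).posSemidef) fun _ => ?_) _) (Real.exp_pos _).le
        have := hpick z hzK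
        rw [hd z hz]
        convert this using 1
        ext i j
        simp; ring
      · rw [hdXK z hzK]; simp [qf]
  rw [integral_const_mul] at b3
  rw [e1, mul_comm ((2:ℝ)^r), mul_assoc]
  have p0 : 0 ≤ ∫ z in Ω₀, Real.exp (-ψ z) * qf Tu Qq :=
    setIntegral_nonneg hΩ₀.measurableSet fun z hz => n1 z (hΩ₀Ω hz)
  refine h.trans (mul_le_mul b1 (b3.trans (mul_le_mul_of_nonneg_left b2 Qt)) ?_ (p0.trans b1))
  exact setIntegral_nonneg hΩ₀.measurableSet fun z hz =>
    mul_nonneg (Real.exp_pos _).le (qf_nonneg (tpm_psd fun _ => (hpd z hz).posSemidef) _)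
end apri
section solv
open scoped Matrix
variable {n r q : ℕ} {Ω B B'' Z : Set Qa} {Φ ψ : Qa → ℝ}
theorem int_star_dot {ι : Type*} [Fintype ι] {y X : ι → Qc} (hy : ∀ i, LL Ω (y i)) (hX : ∀ i, IsTest Ω (X i)) :
    Integrable (fun z => star Tm ⬝ᵥ (fun i => X i z)) Qr := by
  simp only [dotProduct]
  refine integrable_finsetSum _ fun i _ => ?_
  have h := (LL.int (test_star (hX i)) (hy i)).restrict (s := Ω)
  refine (integrable_norm_iff ?_).1 ?_
  · refine (h.aestronglyMeasurable.star).congr (Eventually.of_forall fun z => ?_)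
    simp [mul_comm]
  · refine h.norm.congr (Eventually.of_forall fun z => ?_)
    simp [mul_comm]
theorem dX_asym {X : Qp → Qc} (hX : ∀ I, IsTest Ω Yt) (hA : ∀ z, Asym fun I => X I z) (z) : Asym fun J => dX X J z := by
  intro s J
  simp only [dX, Finset.mul_sum]
  refine scg fun k _ => ?_
  have h2 : sg Yq = sg s := by
    simp only [sg, Equiv.Perm.decomposeFin.symm_sign]; simp
  have e : X (Fin.cons k Hu) = fun z => sg s * X Qw z := by
    funext z
    have := hA z Yq Qw
    simp only at this
    rw [h2] at this; rw [← this]; congr 1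
    funext a; refine Fin.cases ?_ (fun b => ?_) a <;> simp
  rw [e, wDzbar_eq, wD_const_mul]
theorem solve (hB : IsSteinOpen B) (hB'' : IsOpen B'') (hBB : B ⊆ B'') (hZ : IsAnalyticIn Z B'') (hΩd : Ω = B \ Z) (hΩ : IsOpen Ω)
    (hΦ : Sm Ω Φ) (hψ : Sm Ω ψ) (hg : Qd) (hg2 : ∀ z ∈ Ω, (cHess ψ z - cHess Φ z).PosSemidef)
    {y : Qp → Qc} (hym : ∀ I, AEStronglyMeasurable (y I) Qr)
    (hyi : IntegrableOn Uj Ω)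
    (hyA : ∀ z ∈ Ω, Asym fun I => y I z) (hcl : CL Ω y) :
    ∃ v : Un → Qa → ℂ, (∀ J, LL Ω (v J)) ∧ (∀ z, Asym fun J => v J z) ∧
      IntegrableOn (fun z => Real.exp (-ψ z) * qf Hs Yb) Ω ∧
      (∫ z in Ω, Real.exp (-ψ z) * qf Hs Yb) ≤
        2^r * ∫ z in Ω, Real.exp (-ψ z) * qf Tu Qq ∧
      ∀ X : Qp → Qa → ℂ, (∀ I, IsTest Ω Yt) → (∀ z, Asym fun I => X I z) →
        ∫ z in Ω, star Qq ⬝ᵥ Th = ∫ z in Ω, star (fun J => v J z) ⬝ᵥ Qx := by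
  have hc := fun q I J => cont_of_sm (mW_sm (q := q) hΩ hΦ hψ I J)
  have hpd : ∀ q, ∀ z ∈ Ω, (mW Φ ψ q z).PosDef := fun q z hz => mW_pd Tp
  have hyW : WL Ω (fun z => (mW Φ ψ Qm z)⁻¹) y := ⟨hym, hyi.congr_fun (fun z hz => by simp only [mW_inv Tp, qf_smul]) hΩ.measurableSet⟩
  have hyL := WL.ll (hc _) (hpd _) hyW
  let V : Submodule ℂ (Qp → Qc) :=
    { carrier := {X | (∀ I, IsTest Ω Yt) ∧ ∀ z, Asym fun I => X I z}
      add_mem' := fun {a b} ha hb => ⟨fun I => test_add (ha.1 I) (hb.1 I), fun z s J => by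
        have h1 := ha.2 z s J
        have h2 := hb.2 z s J
        simp only at h1 h2
        simp only [Pi.add_apply, h1, h2]; ring⟩
      zero_mem' := ⟨fun I => test_zero, fun z s J => by simp⟩
      smul_mem' := fun c a ha => ⟨fun I => test_const_mul c hΩ (ha.1 I), fun z => (ha.2 z).mulc c⟩ }
  have hd : ∀ X ∈ V, ∀ I z, DifferentiableAt ℝ Yt z := fun X hX I z => ((hX.1 I).1.differentiable Qy) z
  let T : V →ₗ[ℂ] (Un → Qc) :=
    { toFun := fun X => dX X.1
      map_add' := fun X Y => by
        funext J z
        simp only [dX, Pi.add_apply, ← Finset.sum_add_distrib]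
        refine scg fun k _ => ?_
        simp only [wDzbar_eq]
        exact wD_add (hd _ X.2 _ z) (hd _ Y.2 _ z)
      map_smul' := fun c X => by
        funext J z
        simp only [dX, Pi.smul_apply, smul_eq_mul, Finset.mul_sum, RingHom.id_apply]
        refine scg fun k _ => ?_
        simp only [wDzbar_eq]
        exact wD_const_mul .. }
  let l : V →ₗ[ℂ] ℂ :=
    { toFun := fun X => ∫ z in Ω, star Qq ⬝ᵥ (fun I => X.1 I z)
      map_add' := fun X Y => by
        rw [← integral_add (int_star_dot hyL X.2.1) (int_star_dot hyL Y.2.1)]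
        refine integral_congr_ae (Eventually.of_forall fun z => ?_)
        exact dotProduct_add _ _ _
      map_smul' := fun c X => by
        rw [RingHom.id_apply, smul_eq_mul, ← integral_const_mul]
        refine integral_congr_ae (Eventually.of_forall fun z => ?_)
        exact dotProduct_smul c _ _ }
  have hE : 0 ≤ ∫ z in Ω, Real.exp (-ψ z) * qf Tu Qq :=
    setIntegral_nonneg hΩ.measurableSet fun z hz => mul_nonneg (Real.exp_pos _).le (qf_nonneg (tpm_psd fun _ => (hg z hz).posSemidef.inv) _)
  obtain ⟨w, hw, hwN, hwl⟩ := riesz_wl hΩ.measurableSet (hc r) Yj (hpd r) T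
    (fun X => WL.test hΩ Hz (test_dX X.2.1)) l _ (mul_nonneg Qt hE)
    (fun X => apriori hB hB'' hBB hZ hΩd hΩ hΦ hψ hg hg2 X.2.1 X.2.2 hym hyi hyA hcl)
  have hf : (r.factorial : ℂ) ≠ 0 := by exact_mod_cast r.factorial_ne_zero
  set v : Un → Qc := fun I z => (r.factorial : ℂ)⁻¹ * Alt (fun I => w I z) I with hv
  have hM : ∀ I, AEStronglyMeasurable (v I) Qr := fun I =>
    aestronglyMeasurable_const.mul (Finset.aestronglyMeasurable_fun_sum _ fun s _ => aestronglyMeasurable_const.mul (hw.1 _))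
  have hle : ∀ z ∈ Ω, qf Yg⁻¹ Yb ≤ qf Yg⁻¹ (fun I => w I z) := fun z hz => by
    rw [mW_inv Tp, qf_smul, qf_smul]
    refine mul_le_mul_of_nonneg_left ?_ (Real.exp_pos _).le
    have a1 := alt_qf_le (hg z hz).inv.posSemidef (fun I => w I z)
    have a2 := qf_smul_vec Hs (r.factorial : ℂ)⁻¹ (Alt fun I => w I z)
    have a3 : Yb = (r.factorial : ℂ)⁻¹ • Alt fun I => w I z := rfl
    rw [a3, a2, norm_inv, Complex.norm_natCast, inv_pow, inv_mul_le_iff₀ Qt]; exact a1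
  have hvW : WL Ω (fun z => Yg⁻¹) v := by
    refine ⟨hM, Integrable.mono' hw.2 (qf_meas hΩ.measurableSet Yj hM) ?_⟩
    filter_upwards [ae_restrict_mem hΩ.measurableSet] with z hz
    rw [Real.norm_of_nonneg (qf_nonneg (hpd r z hz).inv.posSemidef _)]
    exact hle z hz
  have e : Set.EqOn (fun z => qf Yg⁻¹ Yb) (fun z => Real.exp (-ψ z) * qf Hs Yb) Ω :=
    fun z hz => by simp only [mW_inv Tp, qf_smul]
  refine ⟨v, WL.ll (hc _) (hpd _) hvW, fun z => (alt_asym _).mulc _, hvW.2.congr_fun e hΩ.measurableSet, ?_, fun X hX hXA => ?_⟩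
  · rw [← setIntegral_congr_fun hΩ.measurableSet e]
    exact (setIntegral_mono_on hvW.2 hw.2 hΩ.measurableSet hle).trans hwN
  · rw [show ∫ z in Ω, star Qq ⬝ᵥ Th = ∫ z in Ω, star (fun J => w J z) ⬝ᵥ Qx from hwl ⟨X, hX, hXA⟩]
    refine integral_congr_ae (Eventually.of_forall fun z => ?_)
    simp only
    have a3 : Yb = (r.factorial : ℂ)⁻¹ • Alt fun I => w I z := rfl
    have a4 : Alt Qx = (r.factorial : ℂ) • fun J => dX X J z := funext fun J => (dX_asym hX hXA z).alt J
    rw [a3, star_smul, smul_dotProduct, star_alt_dot, a4, dotProduct_smul, smul_smul]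
    simp [hf]
end solv
section conv
open scoped Matrix
variable {n r q : ℕ} {Ω : Set Qa} {Φ ψ : Qa → ℝ}
theorem fd_qf (g : Qa → Qb) (u : Finset Yk → Qc) (z) :
    qf (tp q (g z)⁻¹) (star (tform q Tv)) = q.factorial * formDensity q g u z := by
  have h := congrArg Complex.re (form_norm (q := q) (g z)⁻¹ Tv)
  unfold qf formDensity
  rw [h, ← Complex.ofReal_natCast, Complex.re_ofReal_mul]
theorem li_int {w a : Qc} (hw : LocallyIntegrableOn w Ω) (ha : IsTest Ω a) : Integrable (fun z => w z * a z) Qr := by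
  have h1 : IntegrableOn (fun z => w z * a z) (tsupport a) :=
    (hw.integrableOn_compact_subset ha.2.2 ha.2.1).mul_continuousOn ha.1.continuous.continuousOn ha.2.1
  refine Integrable.restrict ((integrableOn_iff_integrable_of_support_subset fun z hz => ?_).1 h1)
  refine subset_tsupport a fun h => hz ?_
  simp only; rw [h, mul_zero]
theorem cl_of_weak {u : Finset Yk → Qc} (hu : ∀ K, LocallyIntegrableOn (u K) Ω)
    (h : HasWeakDbar Ω q u (fun _ _ => 0)) : CL Ω (fun (I : Fin q → Fin n) z => star (tform q Tv I)) := by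
  intro M η hη
  by_cases hM : Function.Injective M
  · have e : ∀ z, Alt (fun M => wDz Td η z * star (tform q Tv Qs)) M =
        star ((eps M * q.factorial) * ∑ m ∈ Finset.univ.image M, csign (Finset.univ.image M) m *
          (u ((Finset.univ.image M).erase m) z * wDzbar m (fun x => star (η x)) z)) := fun z => by
      have h1 := alt_form (fun m => wDzbar m (fun x => star (η x)) z) Tv M hM
      rw [scg fun m _ => by rw [mul_comm (u _ z)], ← h1]
      unfold Alt
      rw [star_sum]
      refine scg fun s _ => ?_
      rw [star_mul', star_mul', star_sg, wDzbar_eq, wD_star, wDz_eq]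
      simp
    simp only [e]
    have hc : (Finset.univ.image M).card = q + 1 := by rw [Finset.card_image_of_injective _ hM]; simp
    have h0 := h _ hc _ (test_star hη)
    have h2 : ∫ z in Ω, (∑ m ∈ Finset.univ.image M, csign (Finset.univ.image M) m *
          (u ((Finset.univ.image M).erase m) z * wDzbar m (fun x => star (η x)) z)) = 0 := by
      rw [integral_finsetSum]
      · simp only [integral_const_mul]
        simpa [Finset.sum_neg_distrib] using h0
      · intro m _
        rw [wDzbar_eq]
        exact (li_int (hu _) (test_wD (test_star hη))).const_mul _
    have h3 : ∀ f : Qa → ℂ, ∫ z in Ω, star (f z) = star (∫ z in Ω, f z) := fun f => integral_conj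
    rw [h3, integral_const_mul, h2]; simp
  · have : ∀ z, Alt (fun M => wDz Td η z * star (tform q Tv Qs)) M = 0 := fun z =>
      asym_zero (alt_asym _) M hM
    simp only [this, integral_zero]
theorem weak_of {u u' : Finset Yk → Qc} (hΩ : IsOpen Ω) (hu : ∀ K, LocallyIntegrableOn (u' K) Ω)
    {y : Qp → Qc} (hy : ∀ z, (fun I => star (y I z)) = tform Qm Tv)
    {v : Un → Qc} (hv : ∀ z J, star (v J z) = -Yh * tform r (fun K => u' K z) J)
    (h : ∀ X : Qp → Qa → ℂ, (∀ I, IsTest Ω Yt) → (∀ z, Asym fun I => X I z) →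
        ∫ z in Ω, star Qq ⬝ᵥ Th = ∫ z in Ω, star (fun J => v J z) ⬝ᵥ Qx) :
    HasWeakDbar Ω r u' u := by
  intro L hL η hη
  set S : Fin Qm → Fin n := srt ⟨L, hL⟩
  set a : Qp → ℂ := Alt (Pi.single S 1)
  have hS := srt_image (⟨L, hL⟩ : {K : Finset Yk // K.card = r+1})
  have hdot : ∀ w : Qp → ℂ, ∑ I, w I * a I = Alt w S := fun w => by
    rw [← sum_alt_mul]; simp [Pi.single_apply]
  have h0 := h (fun I z => a I * η z) (fun I => test_const_mul _ hΩ hη) (fun z s J => by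
    simp only [a, alt_asym (Pi.single S 1) s J]; ring)
  have e1 : ∀ z, star Qq ⬝ᵥ (fun I => a I * η z) = ((r+1).factorial : ℂ) * (u L z * η z) := fun z => by
    have : star Qq = tform Qm Tv := hy z
    rw [this]
    simp only [dotProduct, ← mul_assoc]
    rw [← Finset.sum_mul, hdot, (tform_asym _).alt, tform_srt]
  have e2 : ∀ z, star (fun J => v J z) ⬝ᵥ (fun J => dX (fun I z => a I * η z) J z) =
      (-Yh * r.factorial) * ∑ m ∈ L, csign L m * (u' (L.erase m) z * wDzbar m η z) := fun z => by
    have h1 := alt_form (fun m => wDzbar m η z) (fun K => u' K z) S (srt_inj _)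
    rw [eps_srt, hS, one_mul, ← hdot] at h1
    rw [scg fun m _ => by rw [mul_comm (u' _ z)], mul_assoc, ← h1, sum_cons]
    simp only [dotProduct, Pi.star_apply, hv, dX, wDzbar_eq, wD_const_mul, Finset.mul_sum, Fin.cons_zero, Fin.tail_cons]
    rw [Finset.sum_comm]
    refine scg fun k _ => scg fun J _ => by ring
  simp only [e1, e2, integral_const_mul] at h0
  rw [integral_finsetSum] at h0
  · simp only [integral_const_mul] at h0
    have hf : ((r+1).factorial : ℂ) ≠ 0 := by exact_mod_cast (r+1).factorial_ne_zero
    refine mul_left_cancel₀ hf ?_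
    rw [h0]
    simp only [mul_neg, Finset.sum_neg_distrib]
    rw [Nat.factorial_succ]; push_cast; ring
  · intro m _
    rw [wDzbar_eq]
    exact (li_int (hu _) Yx).const_mul _
theorem LL.li (hΩ : IsOpen Ω) {w : Qc} (hw : LL Ω w) : LocallyIntegrableOn w Ω := by
  rw [locallyIntegrableOn_iff hΩ.isLocallyClosed]
  intro K hKΩ hK
  have h1 := hw K hK hKΩ
  have h2 := (MemLp.locallyIntegrable h1 To).integrableOn_isCompact hK
  exact h2.congr_fun (fun z hz => Set.indicator_of_mem hz w) hK.measurableSet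
end conv

/-- **uniform local `L²` solvability of `∂̄`.**
Let `B' ⋐ B''` be Stein open sets in `ℂⁿ`, `Z ⊆ B''` an analytic subset,
`ω̃ = i∂∂̄Φ` a Kähler form on `B'' ∖ Z` with smooth bounded potential `Φ`, and
`h_ε = e^{-φ_ε}` a metric on the (trivialized) line bundle `F`, smooth on
`B'' ∖ Z`, with `√-1 Θ_{h_ε}(F) = i∂∂̄φ_ε ≥ -ε ω̃` for `0 < ε ≤ 1/2`.  Then
there is a constant `C`, independent of `ε` and of `u`, such that for every
`∂̄`-closed `F`-valued `(n,p)`-form `u` on `B' ∖ Z` with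
`∫|u|²_{h_ε,ω̃} ω̃ⁿ < ∞` there exists `v` with `∂̄v = u` and
`∫|v|²_{h_ε,ω̃} ω̃ⁿ ≤ C ∫|u|²_{h_ε,ω̃} ω̃ⁿ`. -/
theorem stmt_11 {n : ℕ} (p : ℕ) (hp : 1 ≤ p)
    (B' B'' : Set (Fin n → ℂ)) (hB' : IsSteinOpen B') (hB'' : IsSteinOpen B'')
    (hB'B'' : closure B' ⊆ B'') (hB'cpt : IsCompact (closure B'))
    (Z : Set (Fin n → ℂ)) (hZ : IsAnalyticIn Z B'')
    (Φ : (Fin n → ℂ) → ℝ) (hΦsm : ContDiffOn ℝ (⊤ : ℕ∞) Φ (B'' \ Z))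
    (hΦbd : ∃ M : ℝ, ∀ z ∈ B'' \ Z, |Φ z| ≤ M)
    (hKahler : ∀ z ∈ B'' \ Z, (cHess Φ z).PosDef) :
    ∃ C : ℝ, 0 < C ∧
      ∀ ε : ℝ, 0 < ε → ε ≤ 1 / 2 →
      ∀ φe : (Fin n → ℂ) → ℝ, ContDiffOn ℝ (⊤ : ℕ∞) φe (B'' \ Z) →
        (∀ z ∈ B'' \ Z,
          (cHess φe z + (ε : ℂ) • cHess Φ z).PosSemidef) →
      ∀ u : Finset (Fin n) → (Fin n → ℂ) → ℂ,
        (∀ K : Finset (Fin n), LocallyIntegrableOn (u K) (B' \ Z)) →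
        HasWeakDbar (B' \ Z) p u (fun _ _ => 0) →
        IntegrableOn
          (fun z => formDensity p (cHess Φ) u z * Real.exp (-2 * φe z))
          (B' \ Z) →
        ∃ v : Finset (Fin n) → (Fin n → ℂ) → ℂ,
          (∀ K : Finset (Fin n), LocallyIntegrableOn (v K) (B' \ Z)) ∧
          HasWeakDbar (B' \ Z) (p - 1) v u ∧
          IntegrableOn
            (fun z => formDensity (p - 1) (cHess Φ) v z * Real.exp (-2 * φe z))
            (B' \ Z) ∧
          (∫ z in B' \ Z,
              formDensity (p - 1) (cHess Φ) v z * Real.exp (-2 * φe z))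
            ≤ C * ∫ z in B' \ Z,
                formDensity p (cHess Φ) u z * Real.exp (-2 * φe z) := by
  obtain ⟨r, rfl⟩ : ∃ r, p = r + 1 := ⟨p - 1, by omega⟩
  obtain ⟨M, hM⟩ := hΦbd
  have hBB : B' ⊆ B'' := subset_closure.trans hB'B''
  have hsub : B' \ Z ⊆ B'' \ Z := Set.sdiff_subset_sdiff_left hBB
  have hΩ : IsOpen (B' \ Z) := by
    have : B' \ Z = B' ∩ (B'' \ Z) := by
      ext z; exact ⟨fun h => ⟨h.1, hsub h⟩, fun h => ⟨h.1, h.2.2⟩⟩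
    rw [this]; exact hB'.1.inter (open_diff hB''.1 hZ)
  refine ⟨2^r * (Real.exp Ys * Real.exp Ys), by positivity, fun ε hε0 hε φe hφ hcurv u hu hdb hint => ?_⟩
  simp only [Nat.add_sub_cancel]
  generalize hΩd : B' \ Z = Ω at *
  have hΦ : Sm Ω Φ := hΦsm.mono hsub
  have hφ' : Sm Ω φe := hφ.mono hsub
  have hg : Qd := fun z hz => hKahler z (hsub hz)
  have hψ : Sm Ω (fun z => 2 * (φe z + Φ z)) := contDiffOn_const.mul (hφ'.add hΦ)
  have hexp : ∀ z, Real.exp (-(2 * (φe z + Φ z))) = Real.exp (-2 * φe z) * Real.exp (-2 * Φ z) := fun z => by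
    rw [← Real.exp_add]; congr 1; ring
  have hb1 : ∀ z ∈ Ω, Real.exp (-2 * Φ z) ≤ Real.exp Ys := fun z hz => by
    have := abs_le.1 (hM z (hsub hz)); exact Real.exp_le_exp.2 Yr
  have hb2 : ∀ z ∈ Ω, Real.exp (2 * Φ z) ≤ Real.exp Ys := fun z hz => by
    have := abs_le.1 (hM z (hsub hz)); exact Real.exp_le_exp.2 Yr
  have hfd : ∀ q (w : Finset Yk → Qc), ∀ z ∈ Ω, 0 ≤ formDensity q Tk w z := fun q w z hz => by
    have h1 := fd_qf (q := q) Tk w z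
    have h2 := qf_nonneg (tpm_psd (q := q) fun _ => (hg z hz).posSemidef.inv) (star (tform q (fun K => w K z)))
    have h3 : (0:ℝ) < q.factorial := by positivity
    have h4 : 0 ≤ (q.factorial : ℝ) * formDensity q Tk w z := h1 ▸ h2
    exact nonneg_of_mul_nonneg_right h4 h3
  have hcomp : ∀ (c : ℝ) (F : Qa → ℝ), IntegrableOn F Ω → (∀ z ∈ Ω, Real.exp (c * Φ z) ≤ Real.exp Ys) →
      IntegrableOn (fun z => F z * Real.exp (c * Φ z)) Ω := fun c F hF hb => by
    refine Integrable.mul_bdd (c := Real.exp Ys) hF ?_ ?_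
    · exact (Real.continuous_exp.comp_continuousOn (continuousOn_const.mul hΦ.continuousOn)).aestronglyMeasurable hΩ.measurableSet
    · filter_upwards [ae_restrict_mem hΩ.measurableSet] with z hz
      rw [Real.norm_of_nonneg (Real.exp_pos _).le]; exact hb z hz
  set y : Qp → Qc := fun I z => star (tform Qm Tv I) with hy
  have hyq : ∀ z, Real.exp (-(2 * (φe z + Φ z))) * qf Tu Qq =
      ((r+1).factorial : ℝ) * (formDensity Qm Tk u z * Real.exp (-2 * φe z) * Real.exp (-2 * Φ z)) := fun z => by
    have := fd_qf (q := r+1) Tk u z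
    rw [show Qq = star (tform Qm Tv) from rfl, this, hexp]; ring
  have hIu := hcomp (-2) _ hint hb1
  obtain ⟨v, hvL, hvA, hvi, hvb, hvw⟩ := solve (r := r) (y := y) (ψ := fun z => 2 * (φe z + Φ z)) hB' hB''.1 hBB hZ hΩd.symm hΩ hΦ hψ hg (by
      intro z hz
      rw [cHess_smul 2, cHess_add hΩ hφ' hΦ hz]
      have h1 := (hcurv z (hsub hz)).smul (show (0:ℂ) ≤ ((2:ℝ):ℂ) by rw [Complex.zero_le_real]; norm_num)
      have h2 := (hg z hz).posSemidef.smul (show (0:ℂ) ≤ ((1 - 2*ε : ℝ):ℂ) by rw [Complex.zero_le_real]; linarith)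
      convert h1.add h2 using 1
      ext i j
      simp; ring)
    (fun I => by
      simp only [hy, tform]
      exact (aestronglyMeasurable_const.mul (hu _).aestronglyMeasurable).star)
    (by simp only [hyq]; exact hIu.const_mul _) (fun z _ => (tform_asym _).star) (cl_of_weak hu hdb)
  have hr : Yh ≠ 0 := by exact_mod_cast r.succ_ne_zero
  set w : Finset Yk → Qc := fun K z => if h : K.card = r then -Yh⁻¹ * star (v (srt ⟨K, h⟩) z) else 0 with hw
  have hwt : ∀ z, (fun J => -Yh⁻¹ * star (v J z)) = tform r (fun K => w K z) := fun z =>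
    asym_eq_tform ((hvA z).star.mulc _) fun K => by simp [hw, K.2]
  have hwl : ∀ K, LocallyIntegrableOn (w K) Ω := fun K => by
    by_cases h : K.card = r
    · have h1 := (hvL (srt ⟨K, h⟩)).li hΩ
      have h2 : w K = fun z => -Yh⁻¹ * star (v (srt ⟨K, h⟩) z) := by funext z; simp [hw, h]
      rw [h2]
      intro x hx
      obtain ⟨t, ht, hi⟩ := h1 x hx
      refine ⟨t, ht, ?_⟩
      refine Integrable.const_mul ?_ _
      refine (integrable_norm_iff hi.aestronglyMeasurable.star).1 (hi.norm.congr (Eventually.of_forall fun z => ?_))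
      simp
    · have : w K = fun _ => 0 := by funext z; simp [hw, h]
      rw [this]; exact (locallyIntegrable_zero).locallyIntegrableOn _
  have hwq : ∀ z, Real.exp (-(2 * (φe z + Φ z))) * qf Hs Yb =
      (Yy^2 * r.factorial) * (formDensity r Tk w z * Real.exp (-2 * φe z) * Real.exp (-2 * Φ z)) := fun z => by
    have h1 := fd_qf (q := r) Tk w z
    have h2 : star (tform r (fun K => w K z)) = (-Yh⁻¹) • fun I => v I z := by
      rw [← hwt z]; funext J; simp
    have h3 : ‖-Yh⁻¹‖ = Yy⁻¹ := by
      rw [norm_neg, norm_inv]; congr 1; exact_mod_cast Complex.norm_natCast Qm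
    rw [h2, qf_smul_vec, h3] at h1
    have h4 : qf Hs Yb = Yy^2 * (r.factorial * formDensity r Tk w z) := by
      rw [← h1]; field_simp
    rw [h4, hexp]; ring
  have hc0 : (0:ℝ) < Yy^2 * r.factorial := by positivity
  have hIw : IntegrableOn (fun z => formDensity r Tk w z * Real.exp (-2 * φe z) * Real.exp (-2 * Φ z)) Ω := by
    simp only [hwq] at hvi
    exact (integrable_const_mul_iff (IsUnit.mk0 _ hc0.ne') _).1 hvi
  have e2 : ∀ z, formDensity r Tk w z * Real.exp (-2 * φe z) * Real.exp (-2 * Φ z) * Real.exp (2 * Φ z) =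
      formDensity r Tk w z * Real.exp (-2 * φe z) := fun z => by
    rw [mul_assoc, ← Real.exp_add]; simp
  have hIw2 := hcomp 2 _ hIw hb2
  simp only [e2] at hIw2
  refine ⟨w, hwl, weak_of hΩ hwl (y := y) (v := v) (fun z => by simp [hy]) (fun z J => ?_) hvw, hIw2, ?_⟩
  · rw [← hwt z]; field_simp
  simp only [hwq, hyq, integral_const_mul] at hvb
  have c1 : ∫ z in Ω, formDensity r Tk w z * Real.exp (-2 * φe z) ≤
      Real.exp Ys * ∫ z in Ω, formDensity r Tk w z * Real.exp (-2 * φe z) * Real.exp (-2 * Φ z) := by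
    rw [← integral_const_mul]
    refine setIntegral_mono_on hIw2 (hIw.const_mul _) hΩ.measurableSet fun z hz => ?_
    rw [mul_comm (Real.exp Ys)]
    exact (e2 z).symm.le.trans (mul_le_mul_of_nonneg_left (hb2 z hz) (mul_nonneg Yz (Real.exp_pos _).le))
  have c2 : ∫ z in Ω, formDensity Qm Tk u z * Real.exp (-2 * φe z) * Real.exp (-2 * Φ z) ≤
      Real.exp Ys * ∫ z in Ω, formDensity Qm Tk u z * Real.exp (-2 * φe z) := by
    rw [← integral_const_mul]
    refine setIntegral_mono_on hIu (hint.const_mul _) hΩ.measurableSet fun z hz => ?_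
    rw [mul_comm (Real.exp Ys)]
    exact mul_le_mul_of_nonneg_left (hb1 z hz) Yz
  set a := ∫ z in Ω, formDensity r Tk w z * Real.exp (-2 * φe z) * Real.exp (-2 * Φ z)
  set b := ∫ z in Ω, formDensity Qm Tk u z * Real.exp (-2 * φe z) * Real.exp (-2 * Φ z)
  have ha : 0 ≤ a := setIntegral_nonneg hΩ.measurableSet fun z hz =>
    mul_nonneg Yz (Real.exp_pos _).le
  have hab : a ≤ 2^r * b := by
    have h1 : Yy * r.factorial * (Yy * a) ≤ Yy * r.factorial * (2^r * b) := by
      rw [Nat.factorial_succ] at hvb; push_cast at hvb; linarith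
    have h2 := le_of_mul_le_mul_left h1 Qt
    have : 0 ≤ (r:ℝ) * a := by positivity
    linarith
  calc _ ≤ _ := c1
    _ ≤ Real.exp Ys * (2^r * (Real.exp Ys * ∫ z in Ω, formDensity Qm Tk u z * Real.exp (-2 * φe z))) :=
      mul_le_mul_of_nonneg_left (hab.trans (mul_le_mul_of_nonneg_left c2 Qt)) (Real.exp_pos _).le
    _ = _ := by ring

end
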